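/- arXiv:2107.05131 — 13 statements merged into one kernel-verified Lean document; each statement's English description precedes it below -/
import Mathlib

section
/- Let G=(S,T;E) be a finite bipartite graph, w: E → ℝ_+ a nonnegative weight function, and b: S∪T → ℤ_{>0} an upper bound function with b(s)=1 for every s∈S. Then the maximum of ∑_{e∈M} w(e) over all b-matchings M of G equals the minimum of ∑_{v∈S∪T} π(v)·b(v) over all nonnegative weighted coverings π of w. -/
open Finset

variable {S T : Type*} [DecidableEq S] [DecidableEq T]

/-- The number of edges of `M` incident to the item `s`. -/
def degS (M : Finset (S × T)) (s : S) : ℕ := (M.filter fun e => e.1 = s).card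

/-- The number of edges of `M` incident to the buyer `t`. -/
def degT (M : Finset (S × T)) (t : T) : ℕ := (M.filter fun e => e.2 = t).card

/-- The set of items adjacent (via the edge set `E`) to some buyer in `X`. -/
def nbhd (E : Finset (S × T)) (X : Finset T) : Finset S :=
  (E.filter fun e => e.2 ∈ X).image Prod.fst

theorem exists_min_dual {N : Type*} [Fintype N] (W : N → N → ℝ) (hW : ∀ i j, 0 ≤ W i j) :
    ∃ u v : N → ℝ, (∀ i, 0 ≤ u i) ∧ (∀ j, 0 ≤ v j) ∧ (∀ i j, W i j ≤ u i + v j) ∧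
      ∀ u' v' : N → ℝ, (∀ i, 0 ≤ u' i) → (∀ j, 0 ≤ v' j) → (∀ i j, W i j ≤ u' i + v' j) →
        ∑ i, u i + ∑ j, v j ≤ ∑ i, u' i + ∑ j, v' j := by
  set C : ℝ := ∑ i, ∑ j, W i j with hC
  let K : Set ((N → ℝ) × (N → ℝ)) := {p | (∀ i, 0 ≤ p.1 i) ∧ (∀ j, 0 ≤ p.2 j) ∧
    (∀ i j, W i j ≤ p.1 i + p.2 j) ∧ ∑ i, p.1 i + ∑ j, p.2 j ≤ C}
  have hclosed : IsClosed K := by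
    refine IsClosed.and ?_ (IsClosed.and ?_ (IsClosed.and ?_ ?_))
    · simp only [Set.setOf_forall]
      exact isClosed_iInter fun i => isClosed_le (by fun_prop) (by fun_prop)
    · simp only [Set.setOf_forall]
      exact isClosed_iInter fun i => isClosed_le (by fun_prop) (by fun_prop)
    · simp only [Set.setOf_forall]
      exact isClosed_iInter fun i => isClosed_iInter fun j =>
        isClosed_le (by fun_prop) (by fun_prop)
    · exact isClosed_le (by fun_prop) (by fun_prop)
  have hcomp : IsCompact K := by
    refine IsCompact.of_isClosed_subset
      (isCompact_Icc (a := ((fun _ => 0, fun _ => 0) : (N → ℝ) × (N → ℝ)))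
        (b := (fun _ => C, fun _ => C))) hclosed ?_
    rintro ⟨u, v⟩ ⟨h1, h2, h3, h4⟩
    simp only at h1 h2 h3 h4
    have a1 : 0 ≤ ∑ i, u i := Finset.sum_nonneg fun i _ => h1 i
    have a2 : 0 ≤ ∑ i, v i := Finset.sum_nonneg fun i _ => h2 i
    refine ⟨⟨h1, h2⟩, ⟨fun i => ?_, fun i => ?_⟩⟩
    · have := Finset.single_le_sum (fun i _ => h1 i) (Finset.mem_univ i)
      simp only at this ⊢
      linarith
    · have := Finset.single_le_sum (fun i _ => h2 i) (Finset.mem_univ i)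
      simp only at this ⊢
      linarith
  have hne : K.Nonempty := by
    refine ⟨(fun i => ∑ j, W i j, fun _ => 0), fun i => Finset.sum_nonneg fun j _ => hW i j,
      fun j => le_rfl, fun i j => ?_, by simp [hC]⟩
    have := Finset.single_le_sum (fun j _ => hW i j) (Finset.mem_univ j)
    simpa using this
  obtain ⟨⟨u, v⟩, ⟨h1, h2, h3, h4⟩, hmin⟩ := hcomp.exists_isMinOn hne
    (f := fun p => ∑ i, p.1 i + ∑ j, p.2 j) (by fun_prop)
  refine ⟨u, v, h1, h2, h3, fun u' v' g1 g2 g3 => ?_⟩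
  by_cases h : ∑ i, u' i + ∑ j, v' j ≤ C
  · exact hmin (a := (u', v')) ⟨g1, g2, g3, h⟩
  · exact h4.trans (not_le.mp h).le

theorem exists_min_dual' {N : Type*} [Fintype N] (W : N → N → ℝ) (hW : ∀ i j, 0 ≤ W i j) :
    ∃ u v : N → ℝ, (∀ i, 0 ≤ u i) ∧ (∀ j, 0 ≤ v j) ∧ (∀ i j, W i j ≤ u i + v j) ∧
      ∀ u' v' : N → ℝ, (∀ i j, W i j ≤ u' i + v' j) →
        ∑ i, u i + ∑ j, v j ≤ ∑ i, u' i + ∑ j, v' j := by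
  obtain ⟨u, v, h1, h2, h3, h4⟩ := exists_min_dual W hW
  refine ⟨u, v, h1, h2, h3, fun u' v' g => ?_⟩
  rcases isEmpty_or_nonempty N with hN | hN
  · simp
  obtain ⟨i0, hi0⟩ := Finite.exists_min u'
  have := h4 (fun i => u' i - u' i0) (fun j => v' j + u' i0)
    (fun i => sub_nonneg.mpr (hi0 i)) (fun j => by have := hW i0 j; have := g i0 j; linarith)
    (fun i j => by have := g i j; linarith)
  simp only [Finset.sum_sub_distrib, Finset.sum_add_distrib] at this
  linarith

theorem assignment_duality {N : Type*} [Fintype N] [DecidableEq N] (W : N → N → ℝ)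
    (hW : ∀ i j, 0 ≤ W i j) :
    ∃ (u v : N → ℝ) (σ : N → N), (∀ i, 0 ≤ u i) ∧ (∀ j, 0 ≤ v j) ∧
      (∀ i j, W i j ≤ u i + v j) ∧ Function.Injective σ ∧
      ∑ i, u i + ∑ j, v j = ∑ i, W i (σ i) := by
  classical
  obtain ⟨u, v, h1, h2, h3, h4⟩ := exists_min_dual' W hW
  let tight : N → Finset N := fun i => Finset.univ.filter fun j => u i + v j = W i j
  have hall : ∀ A : Finset N, A.card ≤ (A.biUnion tight).card := by
    intro A
    by_contra hlt
    rw [not_le] at hlt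
    have hε : ∃ ε : ℝ, 0 < ε ∧ ∀ i j, u i + v j ≠ W i j → ε ≤ u i + v j - W i j := by
      let P : Finset (N × N) := Finset.univ.filter fun p => u p.1 + v p.2 ≠ W p.1 p.2
      rcases P.eq_empty_or_nonempty with hP | hP
      · refine ⟨1, one_pos, fun i j hij => ?_⟩
        have : (i, j) ∈ P := by simp [P, hij]
        simp [hP] at this
      · obtain ⟨p, hp, hpm⟩ := P.exists_min_image (fun p => u p.1 + v p.2 - W p.1 p.2) hP
        refine ⟨_, ?_, fun i j hij => hpm (i, j) (by simp [P, hij])⟩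
        have hp' : u p.1 + v p.2 ≠ W p.1 p.2 := by simpa [P] using hp
        exact sub_pos.mpr (lt_of_le_of_ne (h3 _ _) (Ne.symm hp'))
    obtain ⟨ε, hε, hs⟩ := hε
    have key := h4 (fun i => u i - if i ∈ A then ε else 0)
      (fun j => v j + if j ∈ A.biUnion tight then ε else 0) (by
        intro i j
        have h := h3 i j
        by_cases hi : i ∈ A
        · by_cases hj : j ∈ A.biUnion tight
          · simp only [hi, hj, if_true]; linarith
          · simp only [hi, hj, if_true, if_false]
            have : u i + v j ≠ W i j := fun he =>
              hj (Finset.mem_biUnion.mpr ⟨i, hi, by simp [tight, he]⟩)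
            have := hs i j this
            linarith
        · simp only [hi, if_false]
          split_ifs <;> linarith)
    simp only [Finset.sum_sub_distrib, Finset.sum_add_distrib, Finset.sum_ite_mem,
      Finset.univ_inter, Finset.sum_const, nsmul_eq_mul] at key
    have hc : ((A.biUnion tight).card : ℝ) < A.card := by exact_mod_cast hlt
    nlinarith
  obtain ⟨σ, hσ, hσt⟩ := (Finset.all_card_le_biUnion_card_iff_exists_injective tight).mp hall
  refine ⟨u, v, σ, h1, h2, h3, hσ, ?_⟩
  have hb : Function.Bijective σ := Finite.injective_iff_bijective.mp hσ
  rw [← hb.sum_comp v, ← Finset.sum_add_distrib]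
  refine Finset.sum_congr rfl fun i _ => ?_
  have := hσt i
  simpa [tight] using this

theorem weak_duality [Fintype S] [Fintype T] (E : Finset (S × T)) (w : S × T → ℝ) (b : T → ℕ)
    (M : Finset (S × T)) (hME : M ⊆ E) (hS : ∀ s, degS M s ≤ 1) (hT : ∀ t, degT M t ≤ b t)
    (πS : S → ℝ) (πT : T → ℝ) (h1 : ∀ s, 0 ≤ πS s) (h2 : ∀ t, 0 ≤ πT t)
    (h3 : ∀ e ∈ E, w e ≤ πS e.1 + πT e.2) :
    ∑ e ∈ M, w e ≤ ∑ s, πS s + ∑ t, πT t * (b t : ℝ) := by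
  calc ∑ e ∈ M, w e ≤ ∑ e ∈ M, (πS e.1 + πT e.2) := Finset.sum_le_sum fun e he => h3 e (hME he)
    _ = ∑ e ∈ M, πS e.1 + ∑ e ∈ M, πT e.2 := Finset.sum_add_distrib
    _ ≤ _ := ?_
  refine add_le_add ?_ ?_
  · rw [← Finset.sum_fiberwise M Prod.fst]
    refine Finset.sum_le_sum fun s _ => ?_
    have : ∑ e ∈ M with e.1 = s, πS e.1 = (degS M s : ℝ) * πS s := by
      rw [degS, ← nsmul_eq_mul, ← Finset.sum_const]
      exact Finset.sum_congr rfl fun e he => by rw [(Finset.mem_filter.mp he).2]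
    rw [this]
    have h : (degS M s : ℝ) ≤ 1 := by exact_mod_cast hS s
    nlinarith [h1 s]
  · rw [← Finset.sum_fiberwise M Prod.snd]
    refine Finset.sum_le_sum fun t _ => ?_
    have : ∑ e ∈ M with e.2 = t, πT e.2 = (degT M t : ℝ) * πT t := by
      rw [degT, ← nsmul_eq_mul, ← Finset.sum_const]
      exact Finset.sum_congr rfl fun e he => by rw [(Finset.mem_filter.mp he).2]
    rw [this]
    have h : (degT M t : ℝ) ≤ b t := by exact_mod_cast hT t
    nlinarith [h2 t]

theorem strong_duality [Fintype S] [Fintype T]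
    (E : Finset (S × T)) (w : S × T → ℝ) (hw : ∀ e ∈ E, 0 ≤ w e)
    (b : T → ℕ) (hb : ∀ t, 0 < b t) :
    ∃ M ⊆ E, (∀ s, degS M s ≤ 1) ∧ (∀ t, degT M t ≤ b t) ∧
      ∃ (πS : S → ℝ) (πT : T → ℝ), (∀ s, 0 ≤ πS s) ∧ (∀ t, 0 ≤ πT t) ∧
        (∀ e ∈ E, w e ≤ πS e.1 + πT e.2) ∧
        ∑ s, πS s + ∑ t, πT t * (b t : ℝ) ≤ ∑ e ∈ M, w e := by
  classical
  let c : S → (S ⊕ (Σ t, Fin (b t))) → ℝ := fun s j =>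
    match j with
    | Sum.inl _ => 0
    | Sum.inr q => if (s, q.1) ∈ E then w (s, q.1) else 0
  let W : (S ⊕ (Σ t, Fin (b t))) → (S ⊕ (Σ t, Fin (b t))) → ℝ := fun i j =>
    match i with
    | Sum.inl s => c s j
    | Sum.inr _ => 0
  have hc : ∀ s j, 0 ≤ c s j := by
    rintro s (j | q)
    · exact le_rfl
    · simp only [c]
      split_ifs with h
      · exact hw _ h
      · exact le_rfl
  have hW : ∀ i j, 0 ≤ W i j := by
    rintro (s | q) j
    · exact hc s j
    · exact le_rfl
  obtain ⟨u, v, σ, h1, h2, h3, hσ, h4⟩ := assignment_duality W hW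
  let M : Finset (S × T) := E.filter fun e => ∃ k, σ (Sum.inl e.1) = Sum.inr ⟨e.2, k⟩
  have hMi : Set.InjOn Prod.fst (M : Set (S × T)) := by
    rintro ⟨s, t⟩ he ⟨s', t'⟩ he' h
    simp only [M, Finset.coe_filter, Set.mem_setOf_eq] at he he' h
    obtain ⟨-, k, hk⟩ := he
    obtain ⟨-, k', hk'⟩ := he'
    subst h
    rw [hk] at hk'
    have := congrArg Sigma.fst (Sum.inr_injective hk')
    simp only at this
    rw [this]
  refine ⟨M, Finset.filter_subset _ _, ?_, ?_, fun s => u (Sum.inl s),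
    fun t => (∑ k, v (Sum.inr ⟨t, k⟩)) / b t, fun s => h1 _, fun t => ?_, ?_, ?_⟩
  · intro s
    refine Finset.card_le_one.mpr fun e he e' he' => ?_
    rw [Finset.mem_filter] at he he'
    exact hMi he.1 he'.1 (he.2.trans he'.2.symm)
  · intro t
    have : ∀ e ∈ M.filter (fun e => e.2 = t), ∃ k : Fin (b t), σ (Sum.inl e.1) = Sum.inr ⟨t, k⟩ := by
      rintro ⟨s, t'⟩ he
      rw [Finset.mem_filter] at he
      obtain ⟨he, rfl⟩ := he
      exact (Finset.mem_filter.mp he).2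
    choose f hf using this
    rw [degT]
    calc _ = (M.filter (fun e => e.2 = t)).attach.card := Finset.card_attach.symm
      _ ≤ (Finset.univ : Finset (Fin (b t))).card := by
        refine Finset.card_le_card_of_injOn (fun e => f e.1 e.2) (fun _ _ => Finset.mem_coe.mpr (Finset.mem_univ _)) ?_
        intro e _ e' _ h
        simp only at h
        have a := hf e.1 e.2
        rw [h, ← hf e'.1 e'.2] at a
        have a := Sum.inl_injective (hσ a)
        exact Subtype.ext (hMi (Finset.mem_filter.mp e.2).1 (Finset.mem_filter.mp e'.2).1 a)
      _ = b t := by simp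
  · exact div_nonneg (Finset.sum_nonneg fun _ _ => h2 _) (Nat.cast_nonneg _)
  · rintro ⟨s, t⟩ he
    have hbt : (0 : ℝ) < b t := by exact_mod_cast hb t
    have : ∑ k : Fin (b t), (w (s, t) - u (Sum.inl s)) ≤ ∑ k : Fin (b t), v (Sum.inr ⟨t, k⟩) := by
      refine Finset.sum_le_sum fun k _ => ?_
      have := h3 (Sum.inl s) (Sum.inr ⟨t, k⟩)
      simp only [W, c, he, if_true] at this
      linarith
    simp only [Finset.sum_const, Finset.card_univ, Fintype.card_fin, nsmul_eq_mul] at this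
    have : w (s, t) - u (Sum.inl s) ≤ (∑ k, v (Sum.inr ⟨t, k⟩)) / b t := by
      rw [le_div_iff₀ hbt]; linarith
    simp only
    linarith
  · have e1 : ∀ t, (∑ k, v (Sum.inr ⟨t, k⟩)) / (b t : ℝ) * b t = ∑ k, v (Sum.inr ⟨t, k⟩) := fun t =>
      div_mul_cancel₀ _ (by exact_mod_cast (hb t).ne')
    simp only [e1]
    have e2 : ∑ s, c s (σ (Sum.inl s)) ≤ ∑ e ∈ M, w e := by
      have : ∑ e ∈ M, w e = ∑ e ∈ M, c e.1 (σ (Sum.inl e.1)) := by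
        refine Finset.sum_congr rfl fun e he => ?_
        obtain ⟨he, k, hk⟩ := Finset.mem_filter.mp he
        rw [hk]
        simp [c, he]
      rw [this, ← Finset.sum_image (f := fun s => c s (σ (Sum.inl s))) hMi]
      refine le_of_eq (Finset.sum_subset (Finset.subset_univ _) ?_).symm
      intro s _ hs
      rcases hq : σ (Sum.inl s) with j | ⟨t, k⟩
      · rfl
      · simp only [c]
        refine if_neg fun he => hs ?_
        exact Finset.mem_image.mpr ⟨(s, t), Finset.mem_filter.mpr ⟨he, k, hq⟩, rfl⟩
    have e3 : ∑ i, W i (σ i) = ∑ s, c s (σ (Sum.inl s)) := by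
      rw [Fintype.sum_sum_type]
      simp [W]
    rw [e3, Fintype.sum_sum_type, Fintype.sum_sum_type, Fintype.sum_sigma (fun q => v (Sum.inr q))] at h4
    have p1 : 0 ≤ ∑ x, u (Sum.inr x) := Finset.sum_nonneg fun _ _ => h1 _
    have p2 : 0 ≤ ∑ x, v (Sum.inl x) := Finset.sum_nonneg fun _ _ => h2 _
    linarith

/-- **Egerváry-type duality for `b`-matchings.** The maximum weight of a
`b`-matching equals the minimum total value of a nonnegative weighted covering. -/
theorem stmt1 [Fintype S] [Fintype T]
    (E : Finset (S × T)) (w : S × T → ℝ) (hw : ∀ e ∈ E, 0 ≤ w e)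
    (b : T → ℕ) (hb : ∀ t, 0 < b t) :
    sSup {x : ℝ | ∃ M ⊆ E, (∀ s, degS M s ≤ 1) ∧ (∀ t, degT M t ≤ b t) ∧
        x = ∑ e ∈ M, w e} =
      sInf {y : ℝ | ∃ (πS : S → ℝ) (πT : T → ℝ),
        (∀ s, 0 ≤ πS s) ∧ (∀ t, 0 ≤ πT t) ∧
        (∀ e ∈ E, w e ≤ πS e.1 + πT e.2) ∧
        y = ∑ s, πS s + ∑ t, πT t * (b t : ℝ)} := by
  obtain ⟨M, hM, hS, hT, πS, πT, h1, h2, h3, h4⟩ := strong_duality E w hw b hb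
  have heq := le_antisymm (weak_duality E w b M hM hS hT πS πT h1 h2 h3) h4
  have hg : IsGreatest {x : ℝ | ∃ M ⊆ E, (∀ s, degS M s ≤ 1) ∧ (∀ t, degT M t ≤ b t) ∧
        x = ∑ e ∈ M, w e} (∑ e ∈ M, w e) := by
    refine ⟨⟨M, hM, hS, hT, rfl⟩, ?_⟩
    rintro _ ⟨M', hM', hS', hT', rfl⟩
    rw [heq]
    exact weak_duality E w b M' hM' hS' hT' πS πT h1 h2 h3
  have hl : IsLeast {y : ℝ | ∃ (πS : S → ℝ) (πT : T → ℝ),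
        (∀ s, 0 ≤ πS s) ∧ (∀ t, 0 ≤ πT t) ∧
        (∀ e ∈ E, w e ≤ πS e.1 + πT e.2) ∧
        y = ∑ s, πS s + ∑ t, πT t * (b t : ℝ)} (∑ e ∈ M, w e) := by
    refine ⟨⟨πS, πT, h1, h2, h3, heq⟩, ?_⟩
    rintro _ ⟨πS', πT', h1', h2', h3', rfl⟩
    exact weak_duality E w b M hM hS hT πS' πT' h1' h2' h3'
  rw [hg.csSup_eq, hl.csInf_eq]
end

section
/- Let G=(S,T;E) be a finite bipartite graph, w: E → ℝ_+ a nonnegative weight function, and b: S∪T → ℤ_{>0} with b(s)=1 for every s∈S. Then there exists a nonnegative weighted covering π of w of minimum total value such that: (a) an edge st ∈ E is tight with respect to π if and only if st is legal (i.e., contained in some maximum-weight b-matching), and (b) for every vertex v ∈ S∪T, π(v)=0 if and only if there exists a maximum-weight b-matching M with d_M(v) < b(v). -/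
open Finset

variable {S T : Type*} [DecidableEq S] [DecidableEq T]

/-- `M` is a maximum-weight `b`-matching of the bipartite graph with edge set `E`
(items having demand `1`). -/
def IsMaxBMatching (E : Finset (S × T)) (w : S × T → ℝ) (b : T → ℕ)
    (M : Finset (S × T)) : Prop :=
  M ⊆ E ∧ (∀ s, degS M s ≤ 1) ∧ (∀ t, degT M t ≤ b t) ∧
    ∀ M' ⊆ E, (∀ s, degS M' s ≤ 1) → (∀ t, degT M' t ≤ b t) →
      ∑ e ∈ M', w e ≤ ∑ e ∈ M, w e

lemma assignment {n : Type*} [Fintype n] [DecidableEq n] (W : n → n → ℝ) (hW : ∀ i j, 0 ≤ W i j) :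
    ∃ (u v : n → ℝ) (σ : n → n), (∀ i, 0 ≤ u i) ∧ (∀ i, 0 ≤ v i) ∧
      (∀ i j, W i j ≤ u i + v j) ∧ Function.Injective σ ∧ (∀ i, u i + v (σ i) = W i (σ i)) := by
  classical
  let c : ℝ := ∑ i, ∑ j, W i j
  have hc : ∀ i j, W i j ≤ c := fun i j =>
    (Finset.single_le_sum (f := fun j => W i j) (fun j _ => hW i j) (Finset.mem_univ j)).trans
      (Finset.single_le_sum (f := fun i => ∑ j, W i j)
        (fun i _ => Finset.sum_nonneg fun j _ => hW i j) (Finset.mem_univ i))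
  have hc0 : 0 ≤ c := Finset.sum_nonneg fun i _ => Finset.sum_nonneg fun j _ => hW i j
  let C : ℝ := ∑ _i : n, c
  let K : Set ((n → ℝ) × (n → ℝ)) :=
    {p | (∀ i, 0 ≤ p.1 i) ∧ (∀ i, 0 ≤ p.2 i) ∧ (∀ i j, W i j ≤ p.1 i + p.2 j) ∧
      ∑ i, p.1 i + ∑ j, p.2 j ≤ C}
  have hKclosed : IsClosed K := by
    simp only [K, Set.ofPred_and, Set.ofPred_forall]
    refine IsClosed.inter (isClosed_iInter fun i => isClosed_le (by fun_prop) (by fun_prop)) ?_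
    refine IsClosed.inter (isClosed_iInter fun i => isClosed_le (by fun_prop) (by fun_prop)) ?_
    refine IsClosed.inter (isClosed_iInter fun i => isClosed_iInter fun j =>
      isClosed_le (by fun_prop) (by fun_prop)) ?_
    exact isClosed_le (by fun_prop) (by fun_prop)
  have hKc : IsCompact K := by
    refine IsCompact.of_isClosed_subset
      (isCompact_Icc (a := ((fun _ => 0, fun _ => 0) : (n → ℝ) × (n → ℝ)))
        (b := (fun _ => C, fun _ => C))) hKclosed ?_
    rintro ⟨u, v⟩ ⟨h1, h2, h3, h4⟩
    simp only at h1 h2 h3 h4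
    refine ⟨⟨h1, h2⟩, ?_, ?_⟩
    · intro i
      have := Finset.single_le_sum (f := u) (fun i _ => h1 i) (Finset.mem_univ i)
      have := Finset.sum_nonneg (s := Finset.univ) (fun i _ => h2 i)
      simp only; linarith
    · intro i
      have := Finset.single_le_sum (f := v) (fun i _ => h2 i) (Finset.mem_univ i)
      have := Finset.sum_nonneg (s := Finset.univ) (fun i _ => h1 i)
      simp only; linarith
  have hne : K.Nonempty := by
    refine ⟨(fun _ => c, fun _ => 0), fun _ => hc0, fun _ => le_rfl, fun i j => ?_, ?_⟩
    · simpa using hc i j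
    · simp [C]
  obtain ⟨⟨u, v⟩, ⟨h1, h2, h3, h4⟩, hmin⟩ := hKc.exists_isMinOn hne
    (f := fun p => ∑ i, p.1 i + ∑ j, p.2 j) (by fun_prop)
  simp only at h1 h2 h3 h4
  -- minimality
  have hmin' : ∀ u' v' : n → ℝ, (∀ i, 0 ≤ u' i) → (∀ i, 0 ≤ v' i) →
      (∀ i j, W i j ≤ u' i + v' j) → ∑ i, u i + ∑ j, v j ≤ ∑ i, u' i + ∑ j, v' j := by
    intro u' v' a1 a2 a3
    by_cases h : ∑ i, u' i + ∑ j, v' j ≤ C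
    · exact hmin (a := (u', v')) ⟨a1, a2, a3, h⟩
    · linarith
  -- minimality among arbitrary-sign u with v arbitrary sign
  have hmin2 : ∀ u' v' : n → ℝ, (∀ i, 0 ≤ v' i) →
      (∀ i j, W i j ≤ u' i + v' j) → ∑ i, u i + ∑ j, v j ≤ ∑ i, u' i + ∑ j, v' j := by
    intro u' v' a2 a3
    by_cases hneg : ∀ i, 0 ≤ u' i
    · exact hmin' u' v' hneg a2 a3
    push Not at hneg
    obtain ⟨i0, hi0⟩ := hneg
    obtain ⟨i1, -, hi1⟩ := Finset.exists_min_image Finset.univ u' ⟨i0, Finset.mem_univ _⟩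
    have := hmin' (fun i => u' i - u' i1) (fun j => v' j + u' i1)
      (fun i => sub_nonneg.2 (hi1 i (Finset.mem_univ _)))
      (fun j => by linarith [a3 i1 j, hW i1 j])
      (fun i j => by linarith [a3 i j])
    simp only [Finset.sum_sub_distrib, Finset.sum_add_distrib] at this
    linarith
  let N : n → Finset n := fun i => Finset.univ.filter fun j => u i + v j = W i j
  have hall : ∀ X : Finset n, X.card ≤ (X.biUnion N).card := by
    intro X
    by_contra hlt
    push Not at hlt
    -- slack
    have : ∃ ε > 0, ∀ p : n × n, u p.1 + v p.2 ≠ W p.1 p.2 → W p.1 p.2 + ε ≤ u p.1 + v p.2 := by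
      rcases (Finset.univ.filter fun p : n × n => u p.1 + v p.2 ≠ W p.1 p.2).eq_empty_or_nonempty
        with h | h
      · refine ⟨1, one_pos, fun p hp => ?_⟩
        have : p ∈ (Finset.univ.filter fun p : n × n => u p.1 + v p.2 ≠ W p.1 p.2) := by
          simpa using hp
        rw [h] at this
        simp at this
      · obtain ⟨p, hp, hpm⟩ := Finset.exists_min_image _
          (fun p : n × n => u p.1 + v p.2 - W p.1 p.2) h
        simp only [Finset.mem_filter, Finset.mem_univ, true_and] at hp hpm
        refine ⟨u p.1 + v p.2 - W p.1 p.2, ?_, fun q hq => ?_⟩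
        · have := lt_of_le_of_ne (h3 p.1 p.2) (Ne.symm hp)
          linarith
        · linarith [hpm q hq]
    obtain ⟨ε, hε, hgap⟩ := this
    have := hmin2 (fun i => u i - if i ∈ X then ε else 0)
      (fun j => v j + if j ∈ X.biUnion N then ε else 0)
      (fun j => by have := h2 j; split_ifs <;> linarith)
      (fun i j => by
        by_cases hi : i ∈ X
        · by_cases ht : u i + v j = W i j
          · have : j ∈ X.biUnion N := Finset.mem_biUnion.2 ⟨i, hi, by simpa [N] using ht⟩
            rw [if_pos hi, if_pos this]; linarith
          · have := hgap (i, j) ht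
            simp only at this
            rw [if_pos hi]
            split_ifs <;> linarith
        · rw [if_neg hi]
          have := h3 i j
          split_ifs <;> linarith)
    simp only [Finset.sum_sub_distrib, Finset.sum_add_distrib, Finset.sum_ite_mem,
      Finset.univ_inter, Finset.sum_const, nsmul_eq_mul] at this
    have h5 : ((X.biUnion N).card : ℝ) < X.card := by exact_mod_cast hlt
    nlinarith
  obtain ⟨σ, hσ, hσN⟩ := (Finset.all_card_le_biUnion_card_iff_exists_injective N).1 hall
  exact ⟨u, v, σ, h1, h2, h3, hσ, fun i => by simpa [N] using hσN i⟩

def Feas (E : Finset (S × T)) (b : T → ℕ) (M : Finset (S × T)) : Prop :=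
  M ⊆ E ∧ (∀ s, degS M s ≤ 1) ∧ (∀ t, degT M t ≤ b t)

def Cov (E : Finset (S × T)) (w : S × T → ℝ) (p : S → ℝ) (q : T → ℝ) : Prop :=
  (∀ s, 0 ≤ p s) ∧ (∀ t, 0 ≤ q t) ∧ ∀ e ∈ E, w e ≤ p e.1 + q e.2

lemma sum_deg [Fintype S] [Fintype T] (M : Finset (S × T)) (p : S → ℝ) (q : T → ℝ) :
    ∑ e ∈ M, (p e.1 + q e.2) = ∑ s, (degS M s : ℝ) * p s + ∑ t, (degT M t : ℝ) * q t := by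
  rw [Finset.sum_add_distrib]
  congr 1
  · rw [← Finset.sum_fiberwise M (fun e => e.1)]
    refine Finset.sum_congr rfl fun s _ => ?_
    rw [Finset.sum_congr rfl (g := fun _ => p s)]
    · simp [degS]
    · intro e he; rw [(Finset.mem_filter.1 he).2]
  · rw [← Finset.sum_fiberwise M (fun e => e.2)]
    refine Finset.sum_congr rfl fun t _ => ?_
    rw [Finset.sum_congr rfl (g := fun _ => q t)]
    · simp [degT]
    · intro e he; rw [(Finset.mem_filter.1 he).2]

lemma dual_exists [Fintype S] [Fintype T] (E : Finset (S × T)) (w : S × T → ℝ)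
    (b : T → ℕ) (hb : ∀ t, 0 < b t) :
    ∃ p q M, Cov E w p q ∧ Feas E b M ∧
      ∑ s, p s + ∑ t, q t * (b t : ℝ) ≤ ∑ e ∈ M, w e := by
  classical
  let f : S → T → ℝ := fun s t => if (s, t) ∈ E then max (w (s, t)) 0 else 0
  have hf : ∀ s t, 0 ≤ f s t := fun s t => by
    simp only [f]; split_ifs
    · exact le_max_right _ _
    · exact le_rfl
  let W : (S ⊕ (Σ t, Fin (b t))) → (S ⊕ (Σ t, Fin (b t))) → ℝ := fun i j =>
    match i, j with
    | Sum.inl s, Sum.inr t => f s t.1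
    | _, _ => 0
  have hW : ∀ i j, 0 ≤ W i j := by
    rintro (i | i) (j | j) <;> simp [W, hf]
  obtain ⟨u, v, σ, h1, h2, h3, hσ, ht⟩ := assignment W hW
  have hmin : ∀ t, ∃ i : Fin (b t), ∀ j : Fin (b t), v (Sum.inr ⟨t, i⟩) ≤ v (Sum.inr ⟨t, j⟩) := by
    intro t
    obtain ⟨i, -, hi⟩ := Finset.exists_min_image Finset.univ (fun i : Fin (b t) => v (Sum.inr ⟨t, i⟩))
      ⟨⟨0, hb t⟩, Finset.mem_univ _⟩
    exact ⟨i, fun j => hi j (Finset.mem_univ _)⟩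
  choose m hm using hmin
  let M : Finset (S × T) := E.filter fun e => (∃ i, σ (Sum.inl e.1) = Sum.inr ⟨e.2, i⟩) ∧ 0 < w e
  have hMS : ∀ s t t', (s, t) ∈ M → (s, t') ∈ M → t = t' := by
    intro s t t' h h'
    obtain ⟨i, hi⟩ := (Finset.mem_filter.1 h).2.1
    obtain ⟨i', hi'⟩ := (Finset.mem_filter.1 h').2.1
    simp only at hi hi'
    rw [hi] at hi'
    have := Sum.inr.inj hi'
    exact congrArg Sigma.fst this
  refine ⟨fun s => u (Sum.inl s), fun t => v (Sum.inr ⟨t, m t⟩), M,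
    ⟨fun s => h1 _, fun t => h2 _, ?_⟩, ⟨Finset.filter_subset _ _, ?_, ?_⟩, ?_⟩
  · rintro ⟨s, t⟩ he
    have := h3 (Sum.inl s) (Sum.inr ⟨t, m t⟩)
    simp only [W, f, if_pos he] at this
    exact (le_max_left _ _).trans this
  · intro s
    refine Finset.card_le_one.2 ?_
    rintro ⟨s1, t1⟩ ha ⟨s2, t2⟩ hb'
    simp only [Finset.mem_filter] at ha hb'
    obtain ⟨ha, rfl⟩ := ha
    obtain ⟨hb', rfl⟩ := hb'
    rw [hMS _ _ _ ha hb']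
  · intro t
    have key : ∀ e ∈ M.filter (fun e => e.2 = t), ∃ i : Fin (b t), σ (Sum.inl e.1) = Sum.inr ⟨t, i⟩ := by
      rintro ⟨s, t'⟩ he
      obtain ⟨hem, rfl⟩ := Finset.mem_filter.1 he
      exact (Finset.mem_filter.1 hem).2.1
    have hcard := Finset.card_le_card_of_injOn (s := M.filter (fun e => e.2 = t))
      (t := (Finset.univ : Finset (Fin (b t))))
      (fun e => if h : ∃ i : Fin (b t), σ (Sum.inl e.1) = Sum.inr ⟨t, i⟩ then h.choose else ⟨0, hb t⟩)
      (fun _ _ => Finset.mem_univ _) (by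
        rintro ⟨s1, t1⟩ he1 ⟨s2, t2⟩ he2 heq
        have k1 := key _ he1
        have k2 := key _ he2
        simp only [dif_pos k1, dif_pos k2] at heq
        have e1 := k1.choose_spec
        have e2 := k2.choose_spec
        rw [heq, ← e2] at e1
        have := Sum.inl.inj (hσ e1)
        simp only at this
        have a1 := (Finset.mem_filter.1 he1).2
        have a2 := (Finset.mem_filter.1 he2).2
        simp only at a1 a2
        rw [this, a1, a2])
    simpa [degT] using hcard
  · have hbij : Function.Bijective σ := Finite.injective_iff_bijective.1 hσ
    have e1 : ∑ i, u i + ∑ j, v j = ∑ i, W i (σ i) := by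
      rw [← hbij.sum_comp v, ← Finset.sum_add_distrib]
      exact Finset.sum_congr rfl fun i _ => ht i
    have e2 : ∑ i, W i (σ i) = ∑ s, W (Sum.inl s) (σ (Sum.inl s)) := by
      rw [Fintype.sum_sum_type]
      simp [W]
    have e3 : ∑ s, W (Sum.inl s) (σ (Sum.inl s)) = ∑ e ∈ M, w e := by
      rw [← Finset.sum_fiberwise M (fun e => e.1)]
      refine Finset.sum_congr rfl fun s _ => ?_
      rcases hs : σ (Sum.inl s) with s' | ⟨t, i⟩
      · rw [Finset.filter_false_of_mem]
        · simp [W]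
        · rintro ⟨s1, t1⟩ he rfl
          obtain ⟨i, hi⟩ := (Finset.mem_filter.1 he).2.1
          simp [hs] at hi
      · by_cases hM : (s, t) ∈ M
        · have : M.filter (fun e => e.1 = s) = {(s, t)} := by
            ext ⟨s1, t1⟩
            simp only [Finset.mem_filter, Finset.mem_singleton, Prod.mk.injEq]
            constructor
            · rintro ⟨h, rfl⟩
              exact ⟨rfl, hMS _ _ _ h hM⟩
            · rintro ⟨rfl, rfl⟩
              exact ⟨hM, rfl⟩
          rw [this, Finset.sum_singleton]
          have hM' := Finset.mem_filter.1 hM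
          simp only [W, f, if_pos hM'.1]
          exact max_eq_left hM'.2.2.le
        · rw [Finset.filter_false_of_mem]
          · simp only [W, f, Finset.sum_empty]
            split_ifs with hE
            · refine max_eq_right ?_
              by_contra hlt
              push Not at hlt
              exact hM (Finset.mem_filter.2 ⟨hE, ⟨i, hs⟩, hlt⟩)
            · rfl
          · rintro ⟨s1, t1⟩ he rfl
            obtain ⟨i', hi⟩ := (Finset.mem_filter.1 he).2.1
            simp only [hs] at hi
            have := congrArg Sigma.fst (Sum.inr.inj hi)
            simp only at this
            exact hM (this ▸ he)
    rw [← e3, ← e2, ← e1, Fintype.sum_sum_type, Fintype.sum_sum_type]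
    have g4 : ∑ x : (Σ t, Fin (b t)), v (Sum.inr x) = ∑ t, ∑ i, v (Sum.inr ⟨t, i⟩) :=
      Fintype.sum_sigma _
    have g1 : 0 ≤ ∑ x, u (Sum.inr x) := Finset.sum_nonneg fun i _ => h1 _
    have g2 : 0 ≤ ∑ x, v (Sum.inl x) := Finset.sum_nonneg fun i _ => h2 _
    have g3 : ∑ t, v (Sum.inr ⟨t, m t⟩) * (b t : ℝ) ≤ ∑ t, ∑ i, v (Sum.inr ⟨t, i⟩) := by
      refine Finset.sum_le_sum fun t _ => ?_
      calc v (Sum.inr ⟨t, m t⟩) * (b t : ℝ) = ∑ i : Fin (b t), v (Sum.inr ⟨t, m t⟩) := by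
            simp [mul_comm]
        _ ≤ _ := Finset.sum_le_sum fun i _ => hm t i
    beta_reduce
    linarith

/-- Weak duality, with the two kinds of slack made explicit. -/
lemma weak_eq [Fintype S] [Fintype T] (b : T → ℕ) (w : S × T → ℝ)
    (p : S → ℝ) (q : T → ℝ) (M : Finset (S × T)) :
    (∑ s, p s + ∑ t, q t * (b t : ℝ)) - ∑ e ∈ M, w e =
      ∑ e ∈ M, (p e.1 + q e.2 - w e) + ∑ s, (1 - (degS M s : ℝ)) * p s +
        ∑ t, ((b t : ℝ) - degT M t) * q t := by
  rw [Finset.sum_sub_distrib, sum_deg]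
  simp only [sub_mul, Finset.sum_sub_distrib, one_mul, mul_comm (q _)]
  ring

lemma slack_nonneg {E : Finset (S × T)} {w : S × T → ℝ} {b : T → ℕ} {p : S → ℝ} {q : T → ℝ}
    (hc : Cov E w p q) {M : Finset (S × T)} (hM : Feas E b M) :
    (∀ e ∈ M, 0 ≤ p e.1 + q e.2 - w e) ∧ (∀ s, 0 ≤ (1 - (degS M s : ℝ)) * p s) ∧
      (∀ t, 0 ≤ ((b t : ℝ) - degT M t) * q t) := by
  refine ⟨fun e he => sub_nonneg.2 (hc.2.2 e (hM.1 he)), fun s => mul_nonneg ?_ (hc.1 s),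
    fun t => mul_nonneg ?_ (hc.2.1 t)⟩
  · have : (degS M s : ℝ) ≤ 1 := by exact_mod_cast hM.2.1 s
    linarith
  · have : (degT M t : ℝ) ≤ b t := by exact_mod_cast hM.2.2 t
    linarith

lemma weak_dual [Fintype S] [Fintype T] {E : Finset (S × T)} {w : S × T → ℝ} {b : T → ℕ}
    {p : S → ℝ} {q : T → ℝ} (hc : Cov E w p q) {M : Finset (S × T)} (hM : Feas E b M) :
    ∑ e ∈ M, w e ≤ ∑ s, p s + ∑ t, q t * (b t : ℝ) := by
  have h := weak_eq b w p q M
  obtain ⟨h1, h2, h3⟩ := slack_nonneg hc hM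
  have := Finset.sum_nonneg h1
  have := Finset.sum_nonneg (s := Finset.univ) fun s _ => h2 s
  have := Finset.sum_nonneg (s := Finset.univ) fun s _ => h3 s
  linarith

lemma compl_slack [Fintype S] [Fintype T] {E : Finset (S × T)} {w : S × T → ℝ} {b : T → ℕ}
    {p : S → ℝ} {q : T → ℝ} (hc : Cov E w p q) {M : Finset (S × T)} (hM : Feas E b M)
    (heq : ∑ s, p s + ∑ t, q t * (b t : ℝ) ≤ ∑ e ∈ M, w e) :
    (∀ e ∈ M, p e.1 + q e.2 = w e) ∧ (∀ s, degS M s < 1 → p s = 0) ∧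
      (∀ t, degT M t < b t → q t = 0) := by
  have h := weak_eq b w p q M
  obtain ⟨h1, h2, h3⟩ := slack_nonneg hc hM
  have k1 := Finset.sum_nonneg h1
  have k2 := Finset.sum_nonneg (s := Finset.univ) fun s _ => h2 s
  have k3 := Finset.sum_nonneg (s := Finset.univ) fun s _ => h3 s
  refine ⟨fun e he => ?_, fun s hs => ?_, fun t ht => ?_⟩
  · have := (Finset.sum_eq_zero_iff_of_nonneg h1).1 (by linarith) e he
    linarith
  · have := (Finset.sum_eq_zero_iff_of_nonneg fun s _ => h2 s).1 (by linarith) s (Finset.mem_univ _)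
    have hs' : (degS M s : ℝ) < 1 := by exact_mod_cast hs
    rcases mul_eq_zero.1 this with h | h
    · linarith
    · exact h
  · have := (Finset.sum_eq_zero_iff_of_nonneg fun s _ => h3 s).1 (by linarith) t (Finset.mem_univ _)
    have hs' : (degT M t : ℝ) < b t := by exact_mod_cast ht
    rcases mul_eq_zero.1 this with h | h
    · linarith
    · exact h

lemma gap_exists (E : Finset (S × T)) (w : S × T → ℝ) (b : T → ℕ) (W : ℝ)
    (hW : ∀ M, Feas E b M → ∑ e ∈ M, w e ≤ W) :
    ∃ ε > 0, ∀ M, Feas E b M → ∑ e ∈ M, w e = W ∨ ∑ e ∈ M, w e ≤ W - ε := by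
  classical
  rcases (E.powerset.filter fun M => Feas E b M ∧ ∑ e ∈ M, w e ≠ W).eq_empty_or_nonempty with h | h
  · refine ⟨1, one_pos, fun M hM => Or.inl ?_⟩
    by_contra hne
    have : M ∈ (E.powerset.filter fun M => Feas E b M ∧ ∑ e ∈ M, w e ≠ W) :=
      Finset.mem_filter.2 ⟨Finset.mem_powerset.2 hM.1, hM, hne⟩
    rw [h] at this
    simp at this
  · obtain ⟨M0, hM0, hmax⟩ := Finset.exists_max_image _ (fun M => ∑ e ∈ M, w e) h
    obtain ⟨-, hf, hne⟩ := Finset.mem_filter.1 hM0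
    refine ⟨W - ∑ e ∈ M0, w e, sub_pos.2 (lt_of_le_of_ne (hW _ hf) hne), fun M hM => ?_⟩
    by_cases hw : ∑ e ∈ M, w e = W
    · exact Or.inl hw
    · right
      have := hmax M (Finset.mem_filter.2 ⟨Finset.mem_powerset.2 hM.1, hM, hw⟩)
      linarith

/-- There exists a nonnegative weighted covering of minimum total value
such that (a) an edge is tight iff it is legal, and (b) a vertex has zero value iff some
maximum-weight `b`-matching leaves some of its capacity unused. -/
theorem stmt4 [Fintype S] [Fintype T]
    (E : Finset (S × T)) (w : S × T → ℝ) (hw : ∀ e ∈ E, 0 ≤ w e)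
    (b : T → ℕ) (hb : ∀ t, 0 < b t) :
    ∃ (πS : S → ℝ) (πT : T → ℝ),
      (∀ s, 0 ≤ πS s) ∧ (∀ t, 0 ≤ πT t) ∧
      (∀ e ∈ E, w e ≤ πS e.1 + πT e.2) ∧
      (∀ (πS' : S → ℝ) (πT' : T → ℝ), (∀ s, 0 ≤ πS' s) → (∀ t, 0 ≤ πT' t) →
        (∀ e ∈ E, w e ≤ πS' e.1 + πT' e.2) →
        ∑ s, πS s + ∑ t, πT t * (b t : ℝ) ≤ ∑ s, πS' s + ∑ t, πT' t * (b t : ℝ)) ∧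
      (∀ e ∈ E, (πS e.1 + πT e.2 = w e ↔ ∃ M, IsMaxBMatching E w b M ∧ e ∈ M)) ∧
      (∀ s, (πS s = 0 ↔ ∃ M, IsMaxBMatching E w b M ∧ degS M s < 1)) ∧
      (∀ t, (πT t = 0 ↔ ∃ M, IsMaxBMatching E w b M ∧ degT M t < b t)) := by
  classical
  obtain ⟨p0, q0, M0, hc0, hM0, hv0⟩ := dual_exists E w b hb
  obtain ⟨W, hWdef⟩ : ∃ W, W = ∑ e ∈ M0, w e := ⟨_, rfl⟩
  rw [← hWdef] at hv0
  have hW : ∀ M, Feas E b M → ∑ e ∈ M, w e ≤ W := fun M hM => (weak_dual hc0 hM).trans hv0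
  have hopt : ∀ M, IsMaxBMatching E w b M ↔ Feas E b M ∧ ∑ e ∈ M, w e = W := by
    intro M
    constructor
    · rintro ⟨h1, h2, h3, h4⟩
      exact ⟨⟨h1, h2, h3⟩, le_antisymm (hW M ⟨h1, h2, h3⟩)
        (hWdef ▸ h4 M0 hM0.1 hM0.2.1 hM0.2.2)⟩
    · rintro ⟨⟨h1, h2, h3⟩, h4⟩
      exact ⟨h1, h2, h3, fun M' a1 a2 a3 => h4 ▸ hW M' ⟨a1, a2, a3⟩⟩
  obtain ⟨ε, hε, hgap⟩ := gap_exists E w b W hW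
  -- for each edge/vertex, a good cover
  have hE : ∀ e ∈ E, (¬ ∃ M, IsMaxBMatching E w b M ∧ e ∈ M) →
      ∃ p q, Cov E w p q ∧ ∑ s, p s + ∑ t, q t * (b t : ℝ) ≤ W ∧ w e < p e.1 + q e.2 := by
    intro e he hno
    obtain ⟨p, q, M, hc, hM, hv⟩ := dual_exists E (fun x => w x + if x = e then ε else 0) b hb
    refine ⟨p, q, ⟨hc.1, hc.2.1, fun x hx => ?_⟩, ?_, ?_⟩
    · have := hc.2.2 x hx
      simp only at this
      split_ifs at this <;> linarith
    · refine hv.trans ?_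
      rw [Finset.sum_add_distrib, Finset.sum_ite_eq']
      rcases hgap M hM with h | h
      · have : e ∉ M := fun hh => hno ⟨M, (hopt M).2 ⟨hM, h⟩, hh⟩
        rw [if_neg this]; linarith
      · split_ifs <;> linarith
    · have := hc.2.2 e he
      simp only [if_true] at this
      linarith
  have hS : ∀ s, (¬ ∃ M, IsMaxBMatching E w b M ∧ degS M s < 1) →
      ∃ p q, Cov E w p q ∧ ∑ s, p s + ∑ t, q t * (b t : ℝ) ≤ W ∧ 0 < p s := by
    intro s hno
    obtain ⟨p, q, M, hc, hM, hv⟩ := dual_exists E (fun x => w x - if x.1 = s then ε else 0) b hb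
    refine ⟨fun x => p x + if x = s then ε else 0, q, ⟨fun x => ?_, hc.2.1, fun x hx => ?_⟩, ?_, ?_⟩
    · have := hc.1 x
      beta_reduce
      split_ifs <;> linarith
    · have := hc.2.2 x hx
      simp only at this ⊢
      linarith
    · rw [Finset.sum_add_distrib, Finset.sum_ite_eq', if_pos (Finset.mem_univ _)]
      have h2 : ∑ x ∈ M, (w x - if x.1 = s then ε else 0) = ∑ x ∈ M, w x - degS M s * ε := by
        rw [Finset.sum_sub_distrib, ← Finset.sum_filter]
        simp [degS]
      rw [h2] at hv
      rcases hgap M hM with h | h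
      · have : ¬ degS M s < 1 := fun hh => hno ⟨M, (hopt M).2 ⟨hM, h⟩, hh⟩
        have h3 : degS M s = 1 := le_antisymm (hM.2.1 s) (not_lt.1 this)
        rw [h3] at hv
        push_cast at hv
        linarith
      · have : 0 ≤ (degS M s : ℝ) * ε := by positivity
        linarith
    · have := hc.1 s
      simp only [if_true]
      linarith
  have hT : ∀ t, (¬ ∃ M, IsMaxBMatching E w b M ∧ degT M t < b t) →
      ∃ p q, Cov E w p q ∧ ∑ s, p s + ∑ t, q t * (b t : ℝ) ≤ W ∧ 0 < q t := by
    intro t hno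
    have hbt : (0 : ℝ) < b t := by exact_mod_cast hb t
    obtain ⟨δ, hδ, hδε⟩ : ∃ δ > 0, δ * (b t : ℝ) = ε := ⟨ε / b t, by positivity, by field_simp⟩
    obtain ⟨p, q, M, hc, hM, hv⟩ := dual_exists E (fun x => w x - if x.2 = t then δ else 0) b hb
    refine ⟨p, fun x => q x + if x = t then δ else 0, ⟨hc.1, fun x => ?_, fun x hx => ?_⟩, ?_, ?_⟩
    · have := hc.2.1 x
      beta_reduce
      split_ifs <;> linarith
    · have := hc.2.2 x hx
      simp only at this ⊢
      linarith
    · simp only [add_mul, Finset.sum_add_distrib, ite_mul, zero_mul]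
      rw [Finset.sum_ite_eq', if_pos (Finset.mem_univ _)]
      have h2 : ∑ x ∈ M, (w x - if x.2 = t then δ else 0) = ∑ x ∈ M, w x - degT M t * δ := by
        rw [Finset.sum_sub_distrib, ← Finset.sum_filter]
        simp [degT]
      rw [h2] at hv
      rcases hgap M hM with h | h
      · have : ¬ degT M t < b t := fun hh => hno ⟨M, (hopt M).2 ⟨hM, h⟩, hh⟩
        have h3 : degT M t = b t := le_antisymm (hM.2.2 t) (not_lt.1 this)
        rw [h3] at hv
        linarith
      · have : 0 ≤ (degT M t : ℝ) * δ := by positivity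
        linarith
    · have := hc.2.1 t
      simp only [if_true]
      linarith
  -- choose one cover per condition
  have hk : ∀ k : Option ((S × T) ⊕ (S ⊕ T)), ∃ p q, (Cov E w p q ∧
      ∑ s, p s + ∑ t, q t * (b t : ℝ) ≤ W) ∧
      (∀ e ∈ E, k = some (Sum.inl e) → (¬ ∃ M, IsMaxBMatching E w b M ∧ e ∈ M) →
        w e < p e.1 + q e.2) ∧
      (∀ s, k = some (Sum.inr (Sum.inl s)) →
        (¬ ∃ M, IsMaxBMatching E w b M ∧ degS M s < 1) → 0 < p s) ∧
      (∀ t, k = some (Sum.inr (Sum.inr t)) →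
        (¬ ∃ M, IsMaxBMatching E w b M ∧ degT M t < b t) → 0 < q t) := by
    rintro (_ | e | s | t)
    · exact ⟨p0, q0, ⟨hc0, hv0⟩, by simp, by simp, by simp⟩
    · by_cases h : e ∈ E ∧ ¬ ∃ M, IsMaxBMatching E w b M ∧ e ∈ M
      · obtain ⟨p, q, h1, h2, h3⟩ := hE e h.1 h.2
        refine ⟨p, q, ⟨h1, h2⟩, ?_, by simp, by simp⟩
        intro e' _ he' _
        obtain rfl : e = e' := by simpa using he'
        exact h3
      · refine ⟨p0, q0, ⟨hc0, hv0⟩, ?_, by simp, by simp⟩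
        intro e' h1 he' h2
        obtain rfl : e = e' := by simpa using he'
        exact absurd ⟨h1, h2⟩ h
    · by_cases h : ¬ ∃ M, IsMaxBMatching E w b M ∧ degS M s < 1
      · obtain ⟨p, q, h1, h2, h3⟩ := hS s h
        refine ⟨p, q, ⟨h1, h2⟩, by simp, ?_, by simp⟩
        intro e' he' _
        obtain rfl : s = e' := by simpa using he'
        exact h3
      · refine ⟨p0, q0, ⟨hc0, hv0⟩, by simp, ?_, by simp⟩
        intro e' he' h2
        obtain rfl : s = e' := by simpa using he'
        exact absurd h2 h
    · by_cases h : ¬ ∃ M, IsMaxBMatching E w b M ∧ degT M t < b t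
      · obtain ⟨p, q, h1, h2, h3⟩ := hT t h
        refine ⟨p, q, ⟨h1, h2⟩, by simp, by simp, ?_⟩
        intro e' he' _
        obtain rfl : t = e' := by simpa using he'
        exact h3
      · refine ⟨p0, q0, ⟨hc0, hv0⟩, by simp, by simp, ?_⟩
        intro e' he' h2
        obtain rfl : t = e' := by simpa using he'
        exact absurd h2 h
  choose P Q hPQ hPE hPS hPT using hk
  obtain ⟨N, hN⟩ : ∃ N : ℝ, N = ∑ _k : Option ((S × T) ⊕ (S ⊕ T)), (1 : ℝ) := ⟨_, rfl⟩
  have hN0 : 0 < N := by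
    rw [hN]
    exact Finset.sum_pos (fun _ _ => one_pos) Finset.univ_nonempty
  have hNc : ∀ x : ℝ, ∑ _k : Option ((S × T) ⊕ (S ⊕ T)), x = x * N := by
    intro x
    rw [hN, Finset.mul_sum]
    simp
  have hcov : Cov E w (fun s => (∑ k, P k s) / N) (fun t => (∑ k, Q k t) / N) := by
    refine ⟨fun s => div_nonneg (Finset.sum_nonneg fun k _ => (hPQ k).1.1 s) hN0.le,
      fun t => div_nonneg (Finset.sum_nonneg fun k _ => (hPQ k).1.2.1 t) hN0.le, fun e he => ?_⟩
    simp only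
    rw [← add_div, le_div_iff₀ hN0, ← hNc, ← Finset.sum_add_distrib]
    exact Finset.sum_le_sum fun k _ => (hPQ k).1.2.2 e he
  have hval : ∑ s, (∑ k, P k s) / N + ∑ t, (∑ k, Q k t) / N * (b t : ℝ) ≤ W := by
    have : ∑ s, (∑ k, P k s) / N + ∑ t, (∑ k, Q k t) / N * (b t : ℝ)
        = (∑ k, (∑ s, P k s + ∑ t, Q k t * (b t : ℝ))) / N := by
      simp only [div_mul_eq_mul_div, ← Finset.sum_div, Finset.sum_mul, Finset.sum_add_distrib,
        ← add_div]
      rw [Finset.sum_comm, Finset.sum_comm (s := (Finset.univ : Finset T))]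
    rw [this, div_le_iff₀ hN0, ← hNc]
    exact Finset.sum_le_sum fun k _ => (hPQ k).2
  have hcs : ∀ M, IsMaxBMatching E w b M → _ := fun M hM =>
    compl_slack hcov ((hopt M).1 hM).1 (hval.trans ((hopt M).1 hM).2.ge)
  refine ⟨fun s => (∑ k, P k s) / N, fun t => (∑ k, Q k t) / N, hcov.1, hcov.2.1, hcov.2.2,
    ?_, ?_, ?_, ?_⟩
  · intro p' q' h1 h2 h3
    refine hval.trans ?_
    rw [hWdef]
    exact weak_dual ⟨h1, h2, h3⟩ hM0
  · intro e he
    constructor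
    · intro heq
      by_contra hno
      refine absurd heq (ne_of_gt ?_)
      rw [← add_div, lt_div_iff₀ hN0, ← hNc, ← Finset.sum_add_distrib]
      exact Finset.sum_lt_sum (fun k _ => (hPQ k).1.2.2 e he)
        ⟨some (Sum.inl e), Finset.mem_univ _, hPE _ e he rfl hno⟩
    · rintro ⟨M, hM, heM⟩
      exact (hcs M hM).1 e heM
  · intro s
    constructor
    · intro heq
      by_contra hno
      refine absurd heq (ne_of_gt (div_pos ?_ hN0))
      exact Finset.sum_pos' (fun k _ => (hPQ k).1.1 s)
        ⟨some (Sum.inr (Sum.inl s)), Finset.mem_univ _, hPS _ s rfl hno⟩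
    · rintro ⟨M, hM, h⟩
      exact (hcs M hM).2.1 s h
  · intro t
    constructor
    · intro heq
      by_contra hno
      refine absurd heq (ne_of_gt (div_pos ?_ hN0))
      exact Finset.sum_pos' (fun k _ => (hPQ k).1.2.1 t)
        ⟨some (Sum.inr (Sum.inr t)), Finset.mem_univ _, hPT _ t rfl hno⟩
    · rintro ⟨M, hM, h⟩
      exact (hcs M hM).2.2 t h
end

section
/- Let G=(S,T;E) be a finite bipartite graph, w: E → ℝ_+ a nonnegative weight function, and b: S∪T → ℤ_{>0} with b(s)=1 for every s∈S. Suppose that every maximum-weight b-matching M of G satisfies d_M(v) = b(v) for every vertex v ∈ S∪T. Then there exists a nonnegative weighted covering π of w of minimum total value such that π(v) > 0 for every vertex v ∈ S∪T and such that an edge st ∈ E is tight with respect to π if and only if st is legal. -/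
open Finset

variable {S T : Type*} [DecidableEq S] [DecidableEq T]

/-- A nonnegative circulation has nonpositive gain, by Birkhoff's theorem. -/
lemma aux_circ {V : Type*} [Fintype V] [DecidableEq V] (a : V → V → ℝ)
    (ha0 : ∀ i, a i i = 0) (ha : ∀ σ : Equiv.Perm V, ∑ i, a i (σ i) ≤ 0)
    (N : V → V → ℝ) (hN : ∀ i j, 0 ≤ N i j) (hc : ∀ i, ∑ j, N i j = ∑ j, N j i) :
    ∑ i, ∑ j, a i j * N i j ≤ 0 := by
  set D : ℝ := 1 + ∑ i, ∑ j, N i j with hD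
  have hrow : ∀ i, 0 ≤ ∑ j, N i j := fun i => Finset.sum_nonneg fun j _ => hN i j
  have hle : ∀ i, ∑ j, N i j ≤ ∑ i, ∑ j, N i j := fun i =>
    Finset.single_le_sum (f := fun i => ∑ j, N i j) (fun i _ => hrow i) (Finset.mem_univ i)
  have hDpos : 0 < D := by
    have : 0 ≤ ∑ i, ∑ j, N i j := Finset.sum_nonneg fun i _ => hrow i
    linarith
  let X : Matrix V V ℝ := Matrix.of fun i j =>
    D⁻¹ * (N i j + if i = j then D - ∑ k, N i k else 0)
  have hX : X ∈ doublyStochastic ℝ V := by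
    rw [mem_doublyStochastic_iff_sum]
    refine ⟨fun i j => ?_, fun i => ?_, fun j => ?_⟩
    · simp only [X, Matrix.of_apply]
      refine mul_nonneg (inv_nonneg.2 hDpos.le) (add_nonneg (hN i j) ?_)
      split_ifs
      · have := hle i; linarith
      · exact le_rfl
    · simp only [X, Matrix.of_apply]
      rw [← Finset.mul_sum, Finset.sum_add_distrib]
      simp
      field_simp
    · simp only [X, Matrix.of_apply]
      rw [← Finset.mul_sum, Finset.sum_add_distrib]
      simp
      rw [← hc j]
      field_simp
      ring
  let L : Matrix V V ℝ →ₗ[ℝ] ℝ :=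
    { toFun := fun Y => ∑ i, ∑ j, a i j * Y i j
      map_add' := by
        intro Y Z
        simp [mul_add, Finset.sum_add_distrib]
      map_smul' := by
        intro r Y
        simp only [Matrix.smul_apply, smul_eq_mul, RingHom.id_apply, Finset.mul_sum]
        refine Finset.sum_congr rfl fun i _ => Finset.sum_congr rfl fun j _ => ?_
        ring }
  have hL : L X ≤ 0 := by
    have hmem : X ∈ convexHull ℝ {x : Matrix V V ℝ | ∃ σ : Equiv.Perm V, σ.permMatrix ℝ = x} := by
      rw [← doublyStochastic_eq_convexHull_permMatrix]; exact hX
    have hsub : convexHull ℝ {x : Matrix V V ℝ | ∃ σ : Equiv.Perm V, σ.permMatrix ℝ = x}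
        ⊆ {Y | L Y ≤ 0} := by
      refine convexHull_min ?_ (convex_halfSpace_le L.isLinear 0)
      rintro _ ⟨σ, rfl⟩
      show ∑ i, ∑ j, a i j * (σ.permMatrix ℝ) i j ≤ 0
      refine le_trans (le_of_eq ?_) (ha σ)
      refine Finset.sum_congr rfl fun i _ => ?_
      simp [Equiv.Perm.permMatrix, PEquiv.toMatrix_apply, Equiv.toPEquiv_apply]
    exact hsub hmem
  have hLX : L X = D⁻¹ * ∑ i, ∑ j, a i j * N i j := by
    show ∑ i, ∑ j, a i j * X i j = _
    simp only [X, Matrix.of_apply, Finset.mul_sum]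
    refine Finset.sum_congr rfl fun i _ => Finset.sum_congr rfl fun j _ => ?_
    split_ifs with h
    · subst h; rw [ha0]; ring
    · ring
  rw [hLX] at hL
  by_contra hcon
  push Not at hcon
  have := mul_pos (inv_pos.2 hDpos) hcon
  linarith

/-- Existence of potentials. -/
lemma aux_pot {V : Type*} [Fintype V] [DecidableEq V] (a : V → V → ℝ)
    (ha0 : ∀ i, a i i = 0) (ha : ∀ σ : Equiv.Perm V, ∑ i, a i (σ i) ≤ 0) (r : V) :
    ∃ p : V → ℝ, ∀ j k, p j + a j k ≤ p k := by
  let e : V → V → V → V → ℝ := fun u v i j => if i = u ∧ j = v then 1 else 0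
  have he0 : ∀ u v i j, 0 ≤ e u v i j := by
    intro u v i j; simp only [e]; split_ifs <;> norm_num
  have he1 : ∀ u v i, ∑ j, e u v i j = if i = u then 1 else 0 := by
    intro u v i
    by_cases h : i = u <;> simp [e, h]
  have he2 : ∀ u v i, ∑ j, e u v j i = if i = v then 1 else 0 := by
    intro u v i
    by_cases h : i = v <;> simp [e, h]
  have he3 : ∀ u v, ∑ i, ∑ j, a i j * e u v i j = a u v := by
    intro u v
    simp only [e]
    rw [Finset.sum_eq_single u, Finset.sum_eq_single v] <;> simp +contextual
  let F : V → Set ℝ := fun j => {x | ∃ N : V → V → ℝ, (∀ i k, 0 ≤ N i k) ∧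
    (∀ i, ∑ k, N i k + (if i = j then 1 else 0) = ∑ k, N k i + (if i = r then 1 else 0)) ∧
    ∑ i, ∑ k, a i k * N i k = x}
  have hne : ∀ j, (F j).Nonempty := by
    intro j
    refine ⟨_, e r j, he0 r j, fun i => ?_, rfl⟩
    rw [he1, he2]; ring
  have hstep : ∀ j k x, x ∈ F j → x + a j k ∈ F k := by
    rintro j k x ⟨N, hN, hc, rfl⟩
    refine ⟨fun i l => N i l + e j k i l, fun i l => add_nonneg (hN i l) (he0 _ _ _ _), ?_, ?_⟩
    · intro i
      rw [Finset.sum_add_distrib, Finset.sum_add_distrib, he1, he2]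
      linarith [hc i]
    · simp only [mul_add, Finset.sum_add_distrib]
      rw [he3]
  have hbd : ∀ x ∈ F r, x ≤ 0 := by
    rintro x ⟨N, hN, hc, rfl⟩
    refine aux_circ a ha0 ha N hN fun i => ?_
    linarith [hc i]
  have hbdd : ∀ j, BddAbove (F j) := by
    intro j
    refine ⟨- a j r, fun x hx => ?_⟩
    have := hbd _ (hstep j r x hx)
    linarith
  refine ⟨fun j => sSup (F j), fun j k => ?_⟩
  have : sSup (F j) ≤ sSup (F k) - a j k := by
    refine csSup_le (hne j) fun x hx => ?_
    have := le_csSup (hbdd k) (hstep j k x hx)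
    linarith
  linarith

lemma aux_sumS [Fintype S] (M : Finset (S × T)) (g : S → ℝ) :
    ∑ e ∈ M, g e.1 = ∑ s, g s * (degS M s : ℝ) := by
  rw [← Finset.sum_fiberwise M (fun e => e.1) (fun e => g e.1)]
  refine Finset.sum_congr rfl fun s _ => ?_
  rw [Finset.sum_congr rfl (g := fun _ => g s)
    (fun e he => by rw [(Finset.mem_filter.1 he).2])]
  simp [degS, mul_comm]

lemma aux_sumT [Fintype T] (M : Finset (S × T)) (g : T → ℝ) :
    ∑ e ∈ M, g e.2 = ∑ t, g t * (degT M t : ℝ) := by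
  rw [← Finset.sum_fiberwise M (fun e => e.2) (fun e => g e.2)]
  refine Finset.sum_congr rfl fun t _ => ?_
  rw [Finset.sum_congr rfl (g := fun _ => g t)
    (fun e he => by rw [(Finset.mem_filter.1 he).2])]
  simp [degT, mul_comm]

/-- Complementary dual solution for a saturating maximum-weight matching. -/
lemma aux_dual [Fintype S] [Fintype T] (E : Finset (S × T)) (w : S × T → ℝ)
    (b : T → ℕ) (hb : ∀ t, 0 < b t) (M : Finset (S × T))
    (hM : IsMaxBMatching E w b M) (h1 : ∀ s, degS M s = 1) (h2 : ∀ t, degT M t = b t) :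
    ∃ (p : S → ℝ) (q : T → ℝ), (∀ s, 0 ≤ p s) ∧ (∀ t, 0 ≤ q t) ∧
      (∀ e ∈ E, w e ≤ p e.1 + q e.2) ∧ (∀ e ∈ M, p e.1 + q e.2 = w e) := by
  classical
  obtain ⟨hME, -, -, hmax⟩ := hM
  have hf : ∀ s, ∃ t, ∀ e, (e ∈ M ∧ e.1 = s) ↔ e = (s, t) := by
    intro s
    obtain ⟨⟨s', t⟩, he⟩ := Finset.card_eq_one.1 (h1 s)
    have hmem : ∀ e, (e ∈ M ∧ e.1 = s) ↔ e = (s', t) := by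
      intro e
      have h0 : e ∈ M.filter (fun e => e.1 = s) ↔ e ∈ ({(s', t)} : Finset (S × T)) := by rw [he]
      simpa only [Finset.mem_filter, Finset.mem_singleton] using h0
    have : s' = s := ((hmem (s', t)).2 rfl).2
    subst this
    exact ⟨t, hmem⟩
  choose f hf using hf
  have hfM : ∀ s, (s, f s) ∈ M := fun s => ((hf s _).2 rfl).1
  have hMf : ∀ e, e ∈ M → e.2 = f e.1 := by
    intro e he
    have := (hf e.1 e).1 ⟨he, rfl⟩
    rw [this]
  have hMeq : M = Finset.univ.image fun s => (s, f s) := by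
    ext e
    simp only [Finset.mem_image, Finset.mem_univ, true_and]
    constructor
    · intro he
      exact ⟨e.1, by rw [← hMf e he]⟩
    · rintro ⟨s, rfl⟩
      exact hfM s
  have hMsum : ∀ g : S × T → ℝ, ∑ e ∈ M, g e = ∑ s, g (s, f s) := by
    intro g
    rw [hMeq, Finset.sum_image]
    intro x _ y _ hxy
    exact (Prod.mk.inj hxy).1
  have hcard : ∀ t, (Finset.univ.filter fun s => f s = t).card = b t := by
    intro t
    rw [← h2 t, degT]
    refine Finset.card_bij (fun s _ => (s, f s)) ?_ ?_ ?_
    · intro s hs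
      simp only [Finset.mem_filter, Finset.mem_univ, true_and] at hs ⊢
      exact ⟨hfM s, hs⟩
    · intro x _ y _ hxy
      exact (Prod.mk.inj hxy).1
    · intro e he
      simp only [Finset.mem_filter] at he
      refine ⟨e.1, ?_, ?_⟩
      · simp [← hMf e he.1, he.2]
      · rw [← hMf e he.1]
  have hsurj : ∀ t, ∃ s, f s = t := by
    intro t
    have : 0 < (Finset.univ.filter fun s => f s = t).card := by rw [hcard]; exact hb t
    obtain ⟨s, hs⟩ := Finset.card_pos.1 this
    exact ⟨s, by simpa using hs⟩
  let w' : S × T → ℝ := fun e => if e ∈ E then w e else 0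
  let W : Option S → Option S → ℝ := fun i j =>
    match i, j with
    | some s, some s' => w' (s, f s')
    | _, _ => 0
  have hW : ∀ σ : Equiv.Perm (Option S), ∑ i, W i (σ i) ≤ ∑ i, W i i := by
    intro σ
    let M' := E.filter fun e => ∃ s', σ (some e.1) = some s' ∧ f s' = e.2
    have hd1 : ∀ s, degS M' s ≤ 1 := by
      intro s
      refine Finset.card_le_one.2 ?_
      rintro ⟨s1, t1⟩ ha ⟨s2, t2⟩ hb
      simp only [M', Finset.mem_filter] at ha hb
      obtain ⟨⟨-, x, hx, hx'⟩, hs⟩ := ha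
      obtain ⟨⟨-, y, hy, hy'⟩, hs'⟩ := hb
      subst hs hs'
      rw [hx] at hy
      cases hy
      rw [← hx', ← hy']
    have hd2 : ∀ t, degT M' t ≤ b t := by
      intro t
      rw [← hcard t, ← Finset.card_map Function.Embedding.some, degT]
      refine Finset.card_le_card_of_injOn (fun e => σ (some e.1)) ?_ ?_
      · intro e he
        simp only [M', Finset.coe_filter, Finset.mem_filter, Set.mem_ofPred_eq] at he
        obtain ⟨⟨-, x, hx, hx'⟩, hs⟩ := he
        simp only [Finset.coe_map, Set.mem_image, Finset.coe_filter, Finset.mem_univ, true_and,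
          Set.mem_ofPred_eq]
        exact ⟨x, by rw [hx', hs], hx.symm⟩
      · intro e he e' he' hee
        simp only [M', Finset.coe_filter, Finset.mem_filter, Set.mem_ofPred_eq] at he he'
        have h := Option.some.inj (σ.injective hee)
        exact Prod.ext h (he.2.trans he'.2.symm)
    have key := hmax M' (fun e he => by simp only [M', Finset.mem_filter] at he; exact he.1) hd1 hd2
    have hR : ∑ i, W i i = ∑ e ∈ M, w e := by
      rw [hMsum, Fintype.sum_option]
      simp [W, w', hME (hfM _)]
    have hLs : ∑ i, W i (σ i) = ∑ e ∈ M', w e := by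
      rw [Fintype.sum_option]
      have : ∑ e ∈ M', w e = ∑ s, ∑ t,
          if (∃ s', σ (some s) = some s' ∧ f s' = t) then w' (s, t) else 0 := by
        rw [← Fintype.sum_prod_type' (f := fun s t =>
          if (∃ s', σ (some s) = some s' ∧ f s' = t) then w' (s, t) else 0)]
        rw [← Finset.sum_filter]
        simp only [w']
        rw [← Finset.sum_filter, Finset.filter_filter]
        refine Finset.sum_congr ?_ fun _ _ => rfl
        ext e
        simp [M', and_comm]
      rw [this]
      simp only [W, zero_add]
      refine Finset.sum_congr rfl fun s _ => ?_
      rcases h : σ (some s) with _ | s'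
      · simp
      · simp
    rw [hR, hLs]
    exact key
  obtain ⟨p, hp⟩ := aux_pot (fun i j => W i j - W i i) (fun i => sub_self _)
    (fun σ => by rw [Finset.sum_sub_distrib]; linarith [hW σ]) none
  have hpf : ∀ s s', f s = f s' → p (some s) = p (some s') := by
    intro s s' h
    have e1 := hp (some s) (some s')
    have e2 := hp (some s') (some s)
    simp only [W, h] at e1 e2
    linarith
  choose g hg using hsurj
  refine ⟨fun s => w' (s, f s) - (p (some s) - p none), fun t => p (some (g t)) - p none,
    ?_, ?_, ?_, ?_⟩
  · intro s
    have := hp (some s) none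
    simp only [W] at this
    linarith
  · intro t
    have := hp none (some (g t))
    simp only [W] at this
    linarith
  · rintro ⟨s, t⟩ he
    have := hp (some s) (some (g t))
    simp only [W, hg] at this
    have h3 : w' (s, t) = w (s, t) := by simp [w', he]
    dsimp only
    linarith
  · intro e he
    have h3 : (e.1, f e.1) = e := by rw [← hMf e he]
    have h4 : p (some (g e.2)) = p (some e.1) := hpf _ _ (by rw [hg, hMf e he])
    have h5 : w' e = w e := by simp [w', hME he]
    dsimp only
    rw [h3, h4, h5]
    ring

theorem stmt5 [Fintype S] [Fintype T]
    (E : Finset (S × T)) (w : S × T → ℝ) (hw : ∀ e ∈ E, 0 ≤ w e)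
    (b : T → ℕ) (hb : ∀ t, 0 < b t)
    (hsat : ∀ M, IsMaxBMatching E w b M →
      (∀ s, degS M s = 1) ∧ ∀ t, degT M t = b t) :
    ∃ (πS : S → ℝ) (πT : T → ℝ),
      (∀ s, 0 < πS s) ∧ (∀ t, 0 < πT t) ∧
      (∀ e ∈ E, w e ≤ πS e.1 + πT e.2) ∧
      (∀ (πS' : S → ℝ) (πT' : T → ℝ), (∀ s, 0 ≤ πS' s) → (∀ t, 0 ≤ πT' t) →
        (∀ e ∈ E, w e ≤ πS' e.1 + πT' e.2) →
        ∑ s, πS s + ∑ t, πT t * (b t : ℝ) ≤ ∑ s, πS' s + ∑ t, πT' t * (b t : ℝ)) ∧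
      (∀ e ∈ E, (πS e.1 + πT e.2 = w e ↔ ∃ M, IsMaxBMatching E w b M ∧ e ∈ M)) := by
  classical
  -- the feasible b-matchings
  let B : Finset (Finset (S × T)) :=
    E.powerset.filter fun M => (∀ s, degS M s ≤ 1) ∧ ∀ t, degT M t ≤ b t
  have hBmem : ∀ M, M ∈ B ↔ M ⊆ E ∧ (∀ s, degS M s ≤ 1) ∧ ∀ t, degT M t ≤ b t := by
    intro M; simp [B]
  have hBne : B.Nonempty := ⟨∅, by simp [hBmem, degS, degT]⟩
  obtain ⟨M, hMB, hMmax⟩ := Finset.exists_max_image B (fun M => ∑ e ∈ M, w e) hBne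
  have hM : IsMaxBMatching E w b M := by
    obtain ⟨a1, a2, a3⟩ := (hBmem M).1 hMB
    exact ⟨a1, a2, a3, fun M' c1 c2 c3 => hMmax M' ((hBmem M').2 ⟨c1, c2, c3⟩)⟩
  have hmaxeq : ∀ M', IsMaxBMatching E w b M' → ∑ e ∈ M', w e = ∑ e ∈ M, w e := by
    intro M' h'
    exact le_antisymm (hM.2.2.2 M' h'.1 h'.2.1 h'.2.2.1) (h'.2.2.2 M hM.1 hM.2.1 hM.2.2.1)
  have hval : ∀ M', IsMaxBMatching E w b M' → ∀ (p : S → ℝ) (q : T → ℝ),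
      ∑ e ∈ M', (p e.1 + q e.2) = ∑ s, p s + ∑ t, q t * (b t : ℝ) := by
    intro M' h' p q
    obtain ⟨c1, c2⟩ := hsat M' h'
    rw [Finset.sum_add_distrib, aux_sumS, aux_sumT]
    simp [c1, c2]
  have hcardM : ∀ M', IsMaxBMatching E w b M' → (M'.card : ℝ) = M.card := by
    intro M' h'
    have e1 := hval M' h' (fun _ => 1) (fun _ => 0)
    have e2 := hval M hM (fun _ => 1) (fun _ => 0)
    rw [← e2] at e1
    simpa using e1
  -- the gap
  obtain ⟨ε, hε, hgap⟩ : ∃ ε : ℝ, 0 < ε ∧ ∀ M' ∈ B, ¬ IsMaxBMatching E w b M' →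
      ∑ e ∈ M', w e + 2 * ε * M.card ≤ ∑ e ∈ M, w e := by
    let B' := B.filter fun M' => ¬ IsMaxBMatching E w b M'
    have hlt : ∀ M' ∈ B', ∑ e ∈ M', w e < ∑ e ∈ M, w e := by
      intro M' h'
      obtain ⟨c1, c2⟩ := Finset.mem_filter.1 h'
      by_contra hcon
      push Not at hcon
      obtain ⟨a1, a2, a3⟩ := (hBmem M').1 c1
      exact c2 ⟨a1, a2, a3, fun M'' d1 d2 d3 => (hM.2.2.2 M'' d1 d2 d3).trans hcon⟩
    by_cases hne : B'.Nonempty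
    · obtain ⟨N, hN, hNmax⟩ := Finset.exists_max_image B' (fun M => ∑ e ∈ M, w e) hne
      have hpos := hlt N hN
      have hc : (0 : ℝ) < 2 * M.card + 1 := by positivity
      refine ⟨(∑ e ∈ M, w e - ∑ e ∈ N, w e) / (2 * M.card + 1),
        div_pos (by linarith) hc, fun M' h1 h2 => ?_⟩
      have h3 := hNmax M' (Finset.mem_filter.2 ⟨h1, h2⟩)
      have h4 : 2 * ((∑ e ∈ M, w e - ∑ e ∈ N, w e) / (2 * M.card + 1)) * (M.card : ℝ)
          ≤ ∑ e ∈ M, w e - ∑ e ∈ N, w e := by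
        rw [mul_div_assoc', div_mul_eq_mul_div, div_le_iff₀ hc]
        nlinarith
      linarith
    · refine ⟨1, one_pos, fun M' h1 h2 => ?_⟩
      exact absurd ⟨M', Finset.mem_filter.2 ⟨h1, h2⟩⟩ hne
  let legal : S × T → Prop := fun e => ∃ M, IsMaxBMatching E w b M ∧ e ∈ M
  let w' : S × T → ℝ := fun e => w e - 2 * ε + if legal e then 0 else ε
  have hw'max : ∀ M', IsMaxBMatching E w b M' →
      ∑ e ∈ M', w' e = ∑ e ∈ M, w e - 2 * ε * M.card := by
    intro M' h'
    rw [← hmaxeq M' h', ← hcardM M' h']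
    rw [Finset.sum_congr rfl (g := fun e => w e - 2 * ε)
      (fun e he => by simp [w', show legal e from ⟨M', h', he⟩])]
    rw [Finset.sum_sub_distrib]
    simp
    ring
  have hM' : IsMaxBMatching E w' b M := by
    refine ⟨hM.1, hM.2.1, hM.2.2.1, fun M' c1 c2 c3 => ?_⟩
    rw [hw'max M hM]
    by_cases h' : IsMaxBMatching E w b M'
    · rw [hw'max M' h']
    · have h3 := hgap M' ((hBmem M').2 ⟨c1, c2, c3⟩) h'
      have h4 : ∑ e ∈ M', w' e ≤ ∑ e ∈ M', w e := by
        refine Finset.sum_le_sum fun e _ => ?_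
        simp only [w']
        split_ifs <;> linarith
      linarith
  obtain ⟨p, q, hp, hq, hcov, htight⟩ := aux_dual E w' b hb M hM' (hsat M hM).1 (hsat M hM).2
  have hcov' : ∀ e ∈ E, w e ≤ (p e.1 + ε) + (q e.2 + ε) := by
    intro e he
    have := hcov e he
    simp only [w'] at this
    split_ifs at this <;> linarith
  have hsum : ∑ e ∈ M, ((p e.1 + ε) + (q e.2 + ε)) = ∑ e ∈ M, w e := by
    refine Finset.sum_congr rfl fun e he => ?_
    have h3 := htight e he
    simp only [w', show legal e from ⟨M, hM, he⟩, if_true] at h3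
    linarith
  have hv := fun M' h' => hval M' h' (fun s => p s + ε) (fun t => q t + ε)
  refine ⟨fun s => p s + ε, fun t => q t + ε, fun s => by linarith [hp s],
    fun t => by linarith [hq t], hcov', ?_, ?_⟩
  · intro p' q' _ _ hc
    rw [← hv M hM, ← hval M hM p' q', hsum]
    exact Finset.sum_le_sum fun e he => hc e (hM.1 he)
  · intro e he
    constructor
    · intro heq
      by_contra hcon
      have h3 := hcov e he
      simp only [w', show ¬ legal e from hcon, if_false] at h3
      dsimp only at heq
      linarith
    · rintro ⟨M', h', heM⟩
      have h3 : ∑ e ∈ M', w e = ∑ e ∈ M', ((p e.1 + ε) + (q e.2 + ε)) := by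
        rw [hmaxeq M' h', hv M' h', ← hv M hM, hsum]
      exact ((Finset.sum_eq_sum_iff_of_le fun e he => hcov' e (h'.1 he)).1 h3 e heM).symm
end

section
/- Let G=(S,T;E) be a finite complete bipartite graph, w: E → ℝ_+ a nonnegative weight function, and b: S∪T → ℤ_{>0} with b(s)=1 for every s∈S. Suppose every maximum-weight b-matching of G is a b-factor. Let π be a nonnegative weighted covering of w of minimum total value such that an edge is tight with respect to π if and only if it is legal, and π(v) > 0 for every vertex v. Let G_π be the subgraph of edges tight with respect to π, let σ: S → {1,…,|S|} be an adequate ordering for G_π, let Δ(π) = min( min{π(s)+π(t)−w(st) : st ∈ E not tight}, min{π(v) : v ∈ S∪T, π(v)>0} ) (with min over the empty set equal to +∞), let δ = Δ(π)/(|S|+1), and set p(s) = π(s) + δ·σ(s) for each s ∈ S. Then for every buyer t ∈ T, the set F_t consisting of the b(t) neighbors s of t in G_π with smallest σ(s) is the unique maximizer of ∑_{s∈X}(w(st) − p(s)) over all subsets X ⊆ S with |X| ≤ b(t); moreover, there exists a maximum-weight b-matching M of G with N_M(t) = F_t. -/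
open Finset

variable {S T : Type*} [DecidableEq S] [DecidableEq T]

/-- `σ` is an adequate ordering of the items for the bipartite graph with edge set `H`
and demands `b` (items having demand `1`): for every buyer `t` there exists a
`b`-factor `M` of `H` matching `t` exactly to the set of its `b t` neighbors in `H`
that come first in the ordering `σ`. -/
def Adequate [Fintype S] (σ : S ≃ Fin (Fintype.card S)) (H : Finset (S × T))
    (b : T → ℕ) : Prop :=
  ∀ t : T, ∃ M ⊆ H, (∀ s, degS M s = 1) ∧ (∀ t', degT M t' = b t') ∧
    ∀ s ∈ nbhd M {t}, ∀ s' ∈ nbhd H {t} \ nbhd M {t}, σ s < σ s'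

lemma aux_sum_weights [Fintype S] [Fintype T] (M : Finset (S × T)) (f : S → ℝ) (g : T → ℝ) :
    ∑ e ∈ M, (f e.1 + g e.2) = ∑ s, (degS M s : ℝ) * f s + ∑ t, (degT M t : ℝ) * g t := by
  rw [Finset.sum_add_distrib]
  congr 1
  · rw [← Finset.sum_fiberwise M (fun e => e.1)]
    refine Finset.sum_congr rfl fun s _ => ?_
    rw [Finset.sum_congr rfl (g := fun _ => f s)]
    · simp [degS]
    · intro e he
      rw [(Finset.mem_filter.1 he).2]
  · rw [← Finset.sum_fiberwise M (fun e => e.2)]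
    refine Finset.sum_congr rfl fun s _ => ?_
    rw [Finset.sum_congr rfl (g := fun _ => g s)]
    · simp [degT]
    · intro e he
      rw [(Finset.mem_filter.1 he).2]

lemma aux_mem_nbhd (E : Finset (S × T)) (t : T) (s : S) : s ∈ nbhd E {t} ↔ (s, t) ∈ E := by
  simp [nbhd]

lemma aux_card_nbhd (E : Finset (S × T)) (t : T) : (nbhd E {t}).card = degT E t := by
  unfold nbhd degT
  rw [Finset.card_image_of_injOn]
  · simp
  · rintro ⟨a, b⟩ h ⟨c, d⟩ h' hh
    simp at h h' hh
    simp [h.2, h'.2, hh]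

lemma aux_unique (f : S → ℝ) (F X : Finset S) (hpos : ∀ s ∈ F, 0 < f s)
    (hlt : ∀ s ∈ F, ∀ s', s' ∉ F → f s' < f s) (hc : X.card ≤ F.card) (hne : X ≠ F) :
    ∑ s ∈ X, f s < ∑ s ∈ F, f s := by
  have h1 := Finset.card_sdiff_add_card_inter X F
  have h2 := Finset.card_sdiff_add_card_inter F X
  rw [Finset.inter_comm F X] at h2
  rw [← Finset.sum_sdiff_lt_sum_sdiff]
  have hn : (F \ X).Nonempty := by
    rw [Finset.nonempty_iff_ne_empty]
    intro h
    exact hne (Finset.eq_of_subset_of_card_le (Finset.sdiff_eq_empty_iff_subset.1 h) hc).symm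
  obtain ⟨m, hm, hmin⟩ := Finset.exists_min_image (F \ X) f hn
  have hmF := (Finset.mem_sdiff.1 hm).1
  have hm0 := hpos m hmF
  have hF : ((F \ X).card : ℝ) * f m ≤ ∑ s ∈ F \ X, f s := by
    rw [← nsmul_eq_mul]
    exact Finset.card_nsmul_le_sum _ _ _ hmin
  rcases (X \ F).eq_empty_or_nonempty with h | h
  · rw [h, Finset.sum_empty]
    exact Finset.sum_pos (fun s hs => hpos s (Finset.mem_sdiff.1 hs).1) hn
  · have hX : ∑ s ∈ X \ F, f s < ((X \ F).card : ℝ) * f m := by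
      rw [← nsmul_eq_mul, ← Finset.sum_const]
      exact Finset.sum_lt_sum_of_nonempty h
        fun s hs => hlt m hmF s (Finset.mem_sdiff.1 hs).2
    have hcc : ((X \ F).card : ℝ) ≤ (F \ X).card := by
      exact_mod_cast (by omega : (X \ F).card ≤ (F \ X).card)
    nlinarith

/-- **Lemma 3.4.** In a complete bipartite market in which every
maximum-weight `b`-matching is a `b`-factor, take an optimal nonnegative weighted
covering `π` that is strictly positive everywhere and in which tightness characterizes
legality, an adequate ordering `σ` for the tight subgraph `G_π`, the slack `Δ` of `π`,
`δ = Δ/(|S|+1)`, and prices `p s = π s + δ·σ s`. Then for every buyer `t`, the set `F`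
of the `b t` tight neighbors of `t` coming first in `σ` is the unique maximizer of the
utility `∑_{s ∈ X} (w (s,t) − p s)` over all `X ⊆ S` with `|X| ≤ b t`, and some
maximum-weight `b`-matching matches `t` exactly to `F`. -/
theorem stmt6 [Fintype S] [Fintype T]
    (w : S × T → ℝ) (hw : ∀ e : S × T, 0 ≤ w e)
    (b : T → ℕ) (hb : ∀ t, 0 < b t)
    (hsat : ∀ M, IsMaxBMatching univ w b M →
      (∀ s, degS M s = 1) ∧ ∀ t, degT M t = b t)
    (πS : S → ℝ) (πT : T → ℝ)
    (hposS : ∀ s, 0 < πS s) (hposT : ∀ t, 0 < πT t)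
    (hcov : ∀ e : S × T, w e ≤ πS e.1 + πT e.2)
    (hopt : ∀ (πS' : S → ℝ) (πT' : T → ℝ), (∀ s, 0 ≤ πS' s) → (∀ t, 0 ≤ πT' t) →
      (∀ e : S × T, w e ≤ πS' e.1 + πT' e.2) →
      ∑ s, πS s + ∑ t, πT t * (b t : ℝ) ≤ ∑ s, πS' s + ∑ t, πT' t * (b t : ℝ))
    (htight : ∀ e : S × T, (πS e.1 + πT e.2 = w e ↔
      ∃ M, IsMaxBMatching univ w b M ∧ e ∈ M))
    (Gπ : Finset (S × T)) (hGπ : Gπ = univ.filter fun e => πS e.1 + πT e.2 = w e)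
    (σ : S ≃ Fin (Fintype.card S)) (hσ : Adequate σ Gπ b)
    (Δ : ℝ)
    (hΔ : IsLeast ({x : ℝ | ∃ e : S × T, πS e.1 + πT e.2 ≠ w e ∧
        x = πS e.1 + πT e.2 - w e} ∪
      {x : ℝ | ∃ s, 0 < πS s ∧ x = πS s} ∪ {x : ℝ | ∃ t, 0 < πT t ∧ x = πT t}) Δ)
    (p : S → ℝ)
    (hp : ∀ s, p s = πS s + Δ / (Fintype.card S + 1) * ((σ s : ℕ) + 1)) :
    ∀ t : T, ∀ F ⊆ nbhd Gπ {t}, F.card = b t →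
      (∀ s ∈ F, ∀ s' ∈ nbhd Gπ {t} \ F, σ s < σ s') →
      ((∀ X : Finset S, X.card ≤ b t → X ≠ F →
          ∑ s ∈ X, (w (s, t) - p s) < ∑ s ∈ F, (w (s, t) - p s)) ∧
        ∃ M, IsMaxBMatching univ w b M ∧ nbhd M {t} = F) := by
  intro t F hF hcard hord
  have hΔ0 : 0 < Δ := by
    rcases hΔ.1 with (⟨e, he, rfl⟩ | ⟨s, hs, rfl⟩) | ⟨t, ht, rfl⟩
    · exact sub_pos.2 (lt_of_le_of_ne (hcov e) (Ne.symm he))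
    · exact hs
    · exact ht
  have hΔt : Δ ≤ πT t := hΔ.2 (Or.inr ⟨t, hposT t, rfl⟩)
  have hΔe : ∀ s, (s, t) ∉ Gπ → Δ ≤ πS s + πT t - w (s, t) := by
    intro s hs
    refine hΔ.2 (Or.inl (Or.inl ⟨(s, t), ?_, rfl⟩))
    simpa [hGπ] using hs
  have hGe : ∀ e ∈ Gπ, πS e.1 + πT e.2 = w e := by
    intro e he
    simpa [hGπ] using he
  set δ : ℝ := Δ / (Fintype.card S + 1) with hδ
  have hn0 : (0 : ℝ) < Fintype.card S + 1 := by positivity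
  have hδ0 : 0 < δ := div_pos hΔ0 hn0
  have hδΔ : δ * (Fintype.card S + 1) = Δ := div_mul_cancel₀ _ hn0.ne'
  have hk : ∀ s, δ * ((σ s : ℕ) + 1) < Δ := by
    intro s
    have h : ((σ s : ℕ) : ℝ) < Fintype.card S := by exact_mod_cast (σ s).2
    rw [← hδΔ]
    exact mul_lt_mul_of_pos_left (by linarith) hδ0
  have hk0 : ∀ s, 0 < δ * (((σ s : ℕ) : ℝ) + 1) := fun s => by positivity
  have hFG : ∀ s ∈ F, (s, t) ∈ Gπ := fun s hs => (aux_mem_nbhd _ _ _).1 (hF hs)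
  constructor
  · intro X hX hne
    refine aux_unique (fun s => w (s, t) - p s) F X ?_ ?_ (hcard ▸ hX) hne
    · intro s hs
      have h1 := hGe _ (hFG s hs)
      have h2 := hk s
      have h3 := hp s
      simp only at h1 ⊢
      linarith
    · intro s hs s' hs'
      have h1 := hGe _ (hFG s hs)
      have h2 := hk s
      have h3 := hp s
      have h4 := hp s'
      simp only at h1 ⊢
      by_cases hG : (s', t) ∈ Gπ
      · have h5 := hGe _ hG
        have h6 := hord s hs s' (Finset.mem_sdiff.2 ⟨(aux_mem_nbhd _ _ _).2 hG, hs'⟩)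
        have h7 : ((σ s : ℕ) : ℝ) < ((σ s' : ℕ) : ℝ) := by exact_mod_cast h6
        have h8 := mul_lt_mul_of_pos_left h7 hδ0
        simp only at h5
        linarith
      · have h5 := hΔe s' hG
        have h6 := hk0 s'
        linarith
  · obtain ⟨M, hMG, hMS, hMT, hMo⟩ := hσ t
    refine ⟨M, ⟨Finset.subset_univ _, fun s => (hMS s).le, fun t => (hMT t).le, ?_⟩, ?_⟩
    · intro M' _ hS' hT'
      calc ∑ e ∈ M', w e ≤ ∑ e ∈ M', (πS e.1 + πT e.2) :=
            Finset.sum_le_sum fun e _ => hcov e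
        _ ≤ ∑ e ∈ M, (πS e.1 + πT e.2) := by
            rw [aux_sum_weights, aux_sum_weights]
            refine add_le_add (Finset.sum_le_sum fun s _ => ?_)
              (Finset.sum_le_sum fun t _ => ?_)
            · refine mul_le_mul_of_nonneg_right ?_ (hposS s).le
              rw [hMS s]
              exact_mod_cast hS' s
            · refine mul_le_mul_of_nonneg_right ?_ (hposT t).le
              rw [hMT t]
              exact_mod_cast hT' t
        _ = ∑ e ∈ M, w e := Finset.sum_congr rfl fun e he => hGe e (hMG he)
    · have hc : (nbhd M {t}).card = F.card := by rw [aux_card_nbhd, hMT, hcard]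
      by_contra hne
      have h1 : ¬ nbhd M {t} ⊆ F := fun h => hne (Finset.eq_of_subset_of_card_le h hc.ge)
      have h2 : ¬ F ⊆ nbhd M {t} := fun h => hne (Finset.eq_of_subset_of_card_le h hc.le).symm
      obtain ⟨x, hx, hxF⟩ := Finset.not_subset.1 h1
      obtain ⟨y, hy, hyM⟩ := Finset.not_subset.1 h2
      have h3 := hMo x hx y (Finset.mem_sdiff.2 ⟨hF hy, hyM⟩)
      have h4 := hord y hy x (Finset.mem_sdiff.2
        ⟨(aux_mem_nbhd _ _ _).2 (hMG ((aux_mem_nbhd _ _ _).1 hx)), hxF⟩)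
      exact lt_asymm h3 h4
end

section
/- Let G=(S,T;E) be a finite bipartite graph admitting a b-factor, where b: S∪T → ℤ_{>0} satisfies b(s)=1 for every s∈S, and let w be the weight function identically equal to 1 on E. Let π be a nonnegative weighted covering of w of minimum total value such that an edge is tight with respect to π if and only if it is legal, and let G_π be the subgraph of tight edges. Let σ be an adequate ordering for G_π, and let σ' be the combination π∘σ, i.e., the ordering of S such that σ'(s) < σ'(s') whenever π(s) < π(s'), and, for items with π(s) = π(s'), σ'(s) < σ'(s') if and only if σ(s) < σ(s'). Then σ' is an adequate ordering for G. -/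
open Finset

variable {S T : Type*} [DecidableEq S] [DecidableEq T]

/-- **Lemma 3.5.** Let all edge weights equal `1`, let `π` be an optimal
nonnegative weighted covering in which tightness characterizes legality, let `σ` be
adequate for the subgraph `G_π` of tight edges, and let `σ'` be the combination `π ∘ σ`.
Then `σ'` is adequate for `G`. -/
theorem stmt7 [Fintype S] [Fintype T]
    (E : Finset (S × T)) (b : T → ℕ) (hb : ∀ t, 0 < b t)
    (hfac : ∃ M ⊆ E, (∀ s, degS M s = 1) ∧ ∀ t, degT M t = b t)
    (w : S × T → ℝ) (hw : ∀ e ∈ E, w e = 1)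
    (πS : S → ℝ) (πT : T → ℝ)
    (hnnS : ∀ s, 0 ≤ πS s) (hnnT : ∀ t, 0 ≤ πT t)
    (hcov : ∀ e ∈ E, w e ≤ πS e.1 + πT e.2)
    (hopt : ∀ (πS' : S → ℝ) (πT' : T → ℝ), (∀ s, 0 ≤ πS' s) → (∀ t, 0 ≤ πT' t) →
      (∀ e ∈ E, w e ≤ πS' e.1 + πT' e.2) →
      ∑ s, πS s + ∑ t, πT t * (b t : ℝ) ≤ ∑ s, πS' s + ∑ t, πT' t * (b t : ℝ))
    (htight : ∀ e ∈ E, (πS e.1 + πT e.2 = w e ↔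
      ∃ M ⊆ E, (∀ s, degS M s ≤ 1) ∧ (∀ t, degT M t ≤ b t) ∧
        (∀ M' ⊆ E, (∀ s, degS M' s ≤ 1) → (∀ t, degT M' t ≤ b t) →
          ∑ e' ∈ M', w e' ≤ ∑ e' ∈ M, w e') ∧ e ∈ M))
    (Gπ : Finset (S × T)) (hGπ : Gπ = E.filter fun e => πS e.1 + πT e.2 = w e)
    (σ σ' : S ≃ Fin (Fintype.card S))
    (hσ : Adequate σ Gπ b)
    (hcomb : ∀ s s' : S, (πS s < πS s' → σ' s < σ' s') ∧
      (πS s = πS s' → (σ' s < σ' s' ↔ σ s < σ s'))) :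
    Adequate σ' E b := by
  intro t
  obtain ⟨M, hM, h1, h2, h3⟩ := hσ t
  have hmem : ∀ (H : Finset (S × T)) (s : S), s ∈ nbhd H {t} ↔ (s, t) ∈ H := by
    intro H s
    simp [nbhd]
  have hG : ∀ s, (s, t) ∈ Gπ ↔ (s, t) ∈ E ∧ πS s + πT t = w (s, t) := by
    intro s
    simp [hGπ]
  refine ⟨M, fun e he => ?_, h1, h2, ?_⟩
  · have := hM he
    rw [hGπ] at this
    exact (Finset.mem_filter.1 this).1
  · intro s hs s' hs'
    have h4 := h3 s hs s'
    rw [Finset.mem_sdiff, hmem, hmem] at hs' h4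
    rw [hmem] at hs
    obtain ⟨hsE, hst⟩ := (hG s).1 (hM hs)
    rw [hw _ hsE] at hst
    have hc : w (s', t) ≤ πS s' + πT t := hcov _ hs'.1
    have hw' := hw _ hs'.1
    by_cases ht : πS s' + πT t = w (s', t)
    · have heq : πS s = πS s' := by linarith
      exact ((hcomb s s').2 heq).2 (h4 ⟨(hG s').2 ⟨hs'.1, ht⟩, hs'.2⟩)
    · have hlt := lt_of_le_of_ne hc (Ne.symm ht)
      exact (hcomb s s').1 (by linarith)
end

section
/- Let G=(S,T;E) be a finite bipartite graph, w: E → ℝ_+ a nonnegative weight function, and suppose b(v)=1 for every vertex v ∈ S∪T (the unit-demand case, where b-matchings are matchings). Let π be a nonnegative weighted covering of w of minimum total value such that an edge is tight with respect to π if and only if it is legal, and π(v)=0 if and only if some maximum-weight matching leaves v unmatched. Set p(s)=π(s) for each item s. Then for every buyer t ∈ T and every set X ⊆ S with |X| ≤ 1 that maximizes ∑_{s∈X}(w(st) − p(s)) over all subsets of S of size at most 1, there exists a maximum-weight matching M of G in which the set of items matched to t is exactly X. -/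
open Finset

variable {S T : Type*} [DecidableEq S] [DecidableEq T]

/-- `M` is a maximum-weight matching of the bipartite graph with edge set `E`. -/
def IsMaxMatching (E : Finset (S × T)) (w : S × T → ℝ) (M : Finset (S × T)) : Prop :=
  M ⊆ E ∧ (∀ s, degS M s ≤ 1) ∧ (∀ t, degT M t ≤ 1) ∧
    ∀ M' ⊆ E, (∀ s, degS M' s ≤ 1) → (∀ t, degT M' t ≤ 1) →
      ∑ e ∈ M', w e ≤ ∑ e ∈ M, w e

theorem exists_isMaxMatching (E : Finset (S × T)) (w : S × T → ℝ) :
    ∃ M, IsMaxMatching E w M := by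
  classical
  obtain ⟨M, hM, hmax⟩ := Finset.exists_max_image
    (E.powerset.filter fun M => (∀ s, degS M s ≤ 1) ∧ (∀ t, degT M t ≤ 1))
    (fun M => ∑ e ∈ M, w e) ⟨∅, Finset.mem_filter.2 ⟨by simp, by simp [degS], by simp [degT]⟩⟩
  simp only [Finset.mem_filter, Finset.mem_powerset] at hM hmax
  exact ⟨M, hM.1, hM.2.1, hM.2.2, fun M' h1 h2 h3 => hmax M' ⟨h1, h2, h3⟩⟩

theorem nbhd_eq_of_mem {M : Finset (S × T)} {s : S} {t : T} (h : degT M t ≤ 1)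
    (hs : (s, t) ∈ M) : nbhd M {t} = {s} := by
  unfold degT at h
  rw [Finset.card_le_one] at h
  ext s'
  simp only [nbhd, Finset.mem_image, Finset.mem_filter, Finset.mem_singleton]
  constructor
  · rintro ⟨e, ⟨he, het⟩, rfl⟩
    have := h e (by simp [he, het]) (s, t) (by simp [hs])
    rw [this]
  · rintro rfl
    exact ⟨(s', t), ⟨hs, rfl⟩, rfl⟩

theorem nbhd_eq_empty {M : Finset (S × T)} {t : T} (h : degT M t = 0) :
    nbhd M {t} = ∅ := by
  simpa [nbhd, degT] using h

/-- **unit-demand markets.** With an optimal nonnegative weighted covering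
`π` in which tightness characterizes legality and zero values characterize exposable
vertices, pricing each item `s` at `π s` guarantees: any utility-maximizing bundle of
size at most one chosen by a buyer `t` extends to a maximum-weight matching. -/
theorem stmt8 [Fintype S] [Fintype T]
    (E : Finset (S × T)) (w : S × T → ℝ) (hw : ∀ e ∈ E, 0 ≤ w e)
    (πS : S → ℝ) (πT : T → ℝ)
    (hnnS : ∀ s, 0 ≤ πS s) (hnnT : ∀ t, 0 ≤ πT t)
    (hcov : ∀ e ∈ E, w e ≤ πS e.1 + πT e.2)
    (hopt : ∀ (πS' : S → ℝ) (πT' : T → ℝ), (∀ s, 0 ≤ πS' s) → (∀ t, 0 ≤ πT' t) →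
      (∀ e ∈ E, w e ≤ πS' e.1 + πT' e.2) →
      ∑ s, πS s + ∑ t, πT t ≤ ∑ s, πS' s + ∑ t, πT' t)
    (htight : ∀ e ∈ E, (πS e.1 + πT e.2 = w e ↔ ∃ M, IsMaxMatching E w M ∧ e ∈ M))
    (hzS : ∀ s, (πS s = 0 ↔ ∃ M, IsMaxMatching E w M ∧ degS M s = 0))
    (hzT : ∀ t, (πT t = 0 ↔ ∃ M, IsMaxMatching E w M ∧ degT M t = 0)) :
    ∀ t : T, ∀ X ⊆ nbhd E {t}, X.card ≤ 1 →
      (∀ X' ⊆ nbhd E {t}, X'.card ≤ 1 →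
        ∑ s ∈ X', (w (s, t) - πS s) ≤ ∑ s ∈ X, (w (s, t) - πS s)) →
      ∃ M, IsMaxMatching E w M ∧ nbhd M {t} = X := by
  intro t X hX hcard hmaxX
  have key : 0 < πT t → πT t ≤ ∑ s ∈ X, (w (s, t) - πS s) := by
    intro hpos
    obtain ⟨M, hM⟩ := exists_isMaxMatching E w
    have hd : degT M t ≠ 0 := fun h => hpos.ne' ((hzT t).2 ⟨M, hM, h⟩)
    obtain ⟨⟨s, t'⟩, he⟩ := Finset.card_ne_zero.1 hd
    simp only [Finset.mem_filter] at he
    obtain ⟨he, rfl⟩ := he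
    have htt := (htight _ (hM.1 he)).2 ⟨M, hM, he⟩
    have := hmaxX {s} (by
      rw [Finset.singleton_subset_iff]
      simp only [nbhd, Finset.mem_image, Finset.mem_filter, Finset.mem_singleton]
      exact ⟨(s, t'), ⟨hM.1 he, rfl⟩, rfl⟩) (by simp)
    simp only [Finset.sum_singleton] at this
    simp only at htt
    linarith
  have h0 := hmaxX ∅ (by simp) (by simp)
  rw [Finset.sum_empty] at h0
  have key2 : πT t ≤ ∑ s ∈ X, (w (s, t) - πS s) := by
    rcases (hnnT t).eq_or_lt with h | h
    · rw [← h]; exact h0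
    · exact key h
  rcases Nat.le_one_iff_eq_zero_or_eq_one.1 hcard with hc | hc
  · rw [Finset.card_eq_zero] at hc
    subst hc
    rw [Finset.sum_empty] at key2
    obtain ⟨M, hM, hd⟩ := (hzT t).1 (le_antisymm key2 (hnnT t))
    exact ⟨M, hM, nbhd_eq_empty hd⟩
  · obtain ⟨s, rfl⟩ := Finset.card_eq_one.1 hc
    rw [Finset.sum_singleton] at key2
    have hE : (s, t) ∈ E := by
      rw [Finset.singleton_subset_iff] at hX
      simp only [nbhd, Finset.mem_image, Finset.mem_filter, Finset.mem_singleton] at hX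
      obtain ⟨⟨a, b⟩, ⟨h, rfl⟩, rfl⟩ := hX
      exact h
    have hc' := hcov _ hE
    obtain ⟨M, hM, hmem⟩ := (htight _ hE).1 (by simp only at hc' ⊢; linarith)
    exact ⟨M, hM, nbhd_eq_of_mem (hM.2.2.1 t) hmem⟩
end

section
/- Let G=(S,T;E) be a finite bipartite graph with T = {t_1, t_2, t_3}, let b_1, b_2, b_3 be positive integers with |S| = b_1 + b_2 + b_3, and suppose every item s ∈ S is adjacent to at least two of the three buyers. Then for each i ∈ {1,2,3}, a set F ⊆ N(t_i) is feasible for t_i — i.e., there exists a b-factor M of G (with b(t_i)=b_i and b(s)=1 for all items) such that N_M(t_i) = F — if and only if |F| = b_i and |N(t_j) − F| ≥ b_j for both j ≠ i. -/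
open Finset

variable {S T : Type*} [DecidableEq S] [DecidableEq T]

lemma mem_nbhd_single {S : Type*} [DecidableEq S] (E : Finset (S × Fin 3)) (i : Fin 3) (s : S) :
    s ∈ nbhd E {i} ↔ (s, i) ∈ E := by
  simp [nbhd]

lemma card_nbhd_single {S : Type*} [DecidableEq S] (E : Finset (S × Fin 3)) (i : Fin 3) :
    (nbhd E {i}).card = degT E i := by
  unfold nbhd degT
  rw [Finset.card_image_of_injOn]
  · simp
  · rintro ⟨a, x⟩ hx ⟨c, y⟩ hy h
    simp at hx hy h
    simp [h, hx.2, hy.2]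

theorem stmt9 {S : Type*} [Fintype S] [DecidableEq S]
    (E : Finset (S × Fin 3)) (b : Fin 3 → ℕ) (hb : ∀ i, 0 < b i)
    (hcard : Fintype.card S = b 0 + b 1 + b 2)
    (hadj : ∀ s : S, 2 ≤ (univ.filter fun i : Fin 3 => (s, i) ∈ E).card) :
    ∀ i : Fin 3, ∀ F ⊆ nbhd E {i},
      ((∃ M ⊆ E, (∀ s, degS M s = 1) ∧ (∀ j, degT M j = b j) ∧ nbhd M {i} = F) ↔
        (F.card = b i ∧ ∀ j, j ≠ i → b j ≤ (nbhd E {j} \ F).card)) := by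
  intro i F hF
  constructor
  · rintro ⟨M, hME, hS, hT, rfl⟩
    refine ⟨by rw [card_nbhd_single, hT], fun j hj => ?_⟩
    rw [← hT j, ← card_nbhd_single]
    apply Finset.card_le_card
    intro s hs
    rw [mem_sdiff, mem_nbhd_single, mem_nbhd_single]
    rw [mem_nbhd_single] at hs
    refine ⟨hME hs, fun hi => hj ?_⟩
    have h1 := Finset.card_le_one.1 (hS s).le (s, j) (by simp [hs]) (s, i) (by simp [hi])
    simpa using h1
  · rintro ⟨hFc, hN⟩
    obtain ⟨j, k, hji, hki, hjk, hall, hsum⟩ : ∃ j k : Fin 3, j ≠ i ∧ k ≠ i ∧ j ≠ k ∧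
        (∀ t, t = i ∨ t = j ∨ t = k) ∧ b 0 + b 1 + b 2 = b i + b j + b k := by
      fin_cases i
      · exact ⟨1, 2, by decide, by decide, by decide, by decide, rfl⟩
      · exact ⟨0, 2, by decide, by decide, by decide, by decide, by simp; omega⟩
      · exact ⟨0, 1, by decide, by decide, by decide, by decide, by simp; omega⟩
    have hcov : ∀ s, (s, j) ∉ E → (s, k) ∈ E := by
      intro s hj
      by_contra hk
      have : (univ.filter fun i : Fin 3 => (s, i) ∈ E) ⊆ {i} := by
        intro t ht
        simp only [mem_filter, mem_univ, true_and] at ht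
        rcases hall t with rfl | rfl | rfl
        · simp
        · exact absurd ht hj
        · exact absurd ht hk
      have := (hadj s).trans (Finset.card_le_card this)
      simp at this
    have hU : (univ \ F).card = b j + b k := by
      rw [Finset.card_sdiff_of_subset (subset_univ _), Finset.card_univ]; omega
    have hB : ((univ \ F) \ (nbhd E {k} \ F)).card ≤ b j := by
      rw [Finset.card_sdiff_of_subset (sdiff_subset_sdiff (subset_univ _) le_rfl)]
      have := hN k hki
      omega
    obtain ⟨P, hP1, hP2, hPc⟩ := Finset.exists_subsuperset_card_eq
      (s := (univ \ F) \ (nbhd E {k} \ F)) (t := nbhd E {j} \ F) (n := b j) (by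
        intro s hs
        simp only [mem_sdiff, mem_univ, true_and, mem_nbhd_single] at hs ⊢
        have := hcov s
        tauto) hB (hN j hji)
    have hPj : ∀ s ∈ P, (s, j) ∈ E ∧ s ∉ F := by
      intro s hs
      have := hP2 hs
      simpa [mem_nbhd_single] using this
    have hPk : ∀ s, s ∉ F → s ∉ P → (s, k) ∈ E := by
      intro s h1 h2
      by_contra h3
      exact h2 (hP1 (by simp [mem_nbhd_single, h1, h3]))
    let f : S → Fin 3 := fun s => if s ∈ F then i else if s ∈ P then j else k
    have hfE : ∀ s, (s, f s) ∈ E := by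
      intro s
      by_cases h1 : s ∈ F
      · simpa [f, h1, mem_nbhd_single] using hF h1
      · by_cases h2 : s ∈ P
        · simpa [f, h1, h2] using (hPj s h2).1
        · simpa [f, h1, h2] using hPk s h1 h2
    have hmem : ∀ s t, (s, t) ∈ univ.image (fun s => (s, f s)) ↔ f s = t := by
      intro s t; simp
    have hni : nbhd (univ.image (fun s => (s, f s))) {i} = F := by
      ext s
      rw [mem_nbhd_single, hmem]
      simp only [f]
      split_ifs <;> simp_all
    have hnj : nbhd (univ.image (fun s => (s, f s))) {j} = P := by
      ext s
      rw [mem_nbhd_single, hmem]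
      have := hPj s
      by_cases h1 : s ∈ F <;> by_cases h2 : s ∈ P <;> simp [f, h1, h2, hji.symm, hjk.symm]
      exact (this h2).2 h1
    have hnk : nbhd (univ.image (fun s => (s, f s))) {k} = (univ \ F) \ P := by
      ext s
      rw [mem_nbhd_single, hmem]
      by_cases h1 : s ∈ F <;> by_cases h2 : s ∈ P <;> simp [f, h1, h2, hki.symm, hjk]
    refine ⟨univ.image (fun s => (s, f s)), ?_, ?_, ?_, hni⟩
    · intro e he
      obtain ⟨s, -, rfl⟩ := Finset.mem_image.1 he
      exact hfE s
    · intro s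
      unfold degS
      rw [Finset.card_eq_one]
      refine ⟨(s, f s), ?_⟩
      ext ⟨a, t⟩
      rw [mem_filter, hmem]
      simp only [mem_singleton, Prod.mk.injEq]
      constructor
      · rintro ⟨h1, rfl⟩; exact ⟨rfl, h1.symm⟩
      · rintro ⟨rfl, h⟩; exact ⟨h.symm, rfl⟩
    · intro t
      rw [← card_nbhd_single]
      rcases hall t with rfl | rfl | rfl
      · rw [hni, hFc]
      · rw [hnj, hPc]
      · rw [hnk, Finset.card_sdiff_of_subset (fun s hs => by simp [(hPj s hs).2])]
        omega
end

section
/- Let G=(S,T;E) be a finite bipartite graph with |T| ≤ 3, let b: S∪T → ℤ_{>0} satisfy b(s)=1 for every s ∈ S, and suppose G admits a b-factor. Then there exists an adequate ordering of S for G, i.e., a bijection σ: S → {1,…,|S|} such that for every buyer t ∈ T there exists a b-factor M of G with N_M(t) equal to the set of the b(t) neighbors s of t with smallest σ(s). -/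
open Finset

variable {S T : Type*} [DecidableEq S] [DecidableEq T]

namespace Adq

lemma exists_initial {S : Type*} [DecidableEq S] {m : ℕ} (σ : S ≃ Fin m) (A : Finset S) (n : ℕ)
    (hn : n ≤ A.card) :
    ∃ F ⊆ A, F.card = n ∧ ∀ s ∈ F, ∀ s' ∈ A \ F, σ s < σ s' := by
  induction n with
  | zero => exact ⟨∅, by simp, by simp, by simp⟩
  | succ n ih =>
    obtain ⟨F, hFA, hc, hF⟩ := ih (by omega)
    have hne : (A \ F).Nonempty := by
      rw [← Finset.card_pos, Finset.card_sdiff_of_subset hFA]; omega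
    obtain ⟨x, hx, hmin⟩ := Finset.exists_min_image (A \ F) σ hne
    have hxA := (Finset.mem_sdiff.1 hx).1
    have hxF := (Finset.mem_sdiff.1 hx).2
    refine ⟨insert x F, Finset.insert_subset hxA hFA, by
      rw [Finset.card_insert_of_notMem hxF, hc], ?_⟩
    intro s hs s' hs'
    rw [Finset.mem_sdiff, Finset.mem_insert, not_or] at hs'
    have h' : s' ∈ A \ F := Finset.mem_sdiff.2 ⟨hs'.1, hs'.2.2⟩
    rcases Finset.mem_insert.1 hs with rfl | hs
    · exact lt_of_le_of_ne (hmin s' h') (fun h => hs'.2.1 (σ.injective h).symm)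
    · exact hF s hs s' h'

lemma exists_order {S : Type*} [DecidableEq S] [Fintype S] (l : S → ℕ) :
    ∃ σ : S ≃ Fin (Fintype.card S), ∀ s s', l s < l s' → σ s < σ s' := by
  let e := Fintype.equivFin S
  let g : S → ℕ ×ₗ Fin (Fintype.card S) := fun s => toLex (l s, e s)
  have hg : Function.Injective g := by
    intro a b h
    have : (l a, e a) = (l b, e b) := h
    exact e.injective (Prod.ext_iff.1 this).2
  let _ : LinearOrder S := LinearOrder.lift' g hg
  let o := (Fintype.orderIsoFinOfCardEq S rfl).symm
  refine ⟨o.toEquiv, fun s s' h => ?_⟩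
  change o s < o s'
  rw [o.lt_iff_lt]
  change g s < g s'
  exact Prod.Lex.toLex_lt_toLex.2 (Or.inl h)

/-- Completing an initial choice for buyer `i`. -/
lemma buyer {S U : Type*} [DecidableEq S] [DecidableEq U] [Fintype S] {m : ℕ}
    (σ : S ≃ Fin m) (N : S → Finset U) (b : U → ℕ) (i j k : U)
    (hij : i ≠ j) (hik : i ≠ k) (hjk : j ≠ k) (hall : ∀ u, u = i ∨ u = j ∨ u = k)
    (hne : ∀ s, ∃ u, u ∈ N s)
    (hsum : b i + b j + b k = Fintype.card S)
    (hNi : b i ≤ (univ.filter fun s => i ∈ N s).card)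
    (L : Finset S) (hLc : L.card ≤ b i)
    (hLN : ∀ s ∈ L, i ∈ N s)
    (hLi : ∀ s ∈ L, ∀ s', i ∈ N s' → s' ∉ L → σ s < σ s')
    (hP : ∀ s, i ∈ N s → j ∉ N s → k ∉ N s → s ∈ L)
    (C B : Finset S) (hC : C ⊆ L) (hB : B ⊆ L)
    (hC' : ∀ s ∈ C, i ∈ N s ∧ j ∈ N s ∧ k ∉ N s)
    (hB' : ∀ s ∈ B, i ∈ N s ∧ k ∈ N s ∧ j ∉ N s)
    (hCc : (univ.filter fun s => i ∈ N s ∧ j ∈ N s ∧ k ∉ N s).card +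
      (univ.filter fun s => j ∈ N s ∧ i ∉ N s ∧ k ∉ N s).card ≤ C.card + b j)
    (hBc : (univ.filter fun s => i ∈ N s ∧ k ∈ N s ∧ j ∉ N s).card +
      (univ.filter fun s => k ∈ N s ∧ i ∉ N s ∧ j ∉ N s).card ≤ B.card + b k) :
    ∃ f : S → U, (∀ s, f s ∈ N s) ∧ (∀ u, (univ.filter fun s => f s = u).card = b u) ∧
      ∀ s s', f s = i → f s' ≠ i → i ∈ N s' → σ s < σ s' := by
  obtain ⟨F, hFA, hFc, hF⟩ := exists_initial σ _ _ hNi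
  have hLF : L ⊆ F := by
    intro s hs
    by_contra hsF
    have hsub : F ⊆ L := by
      intro x hx
      by_contra hxL
      have hxN : i ∈ N x := by simpa using hFA hx
      have h1 := hLi s hs x hxN hxL
      have hsN := hLN s hs
      have h2 := hF x hx s (by simp [hsN, hsF])
      exact absurd h1 (not_lt.2 h2.le)
    have := Finset.card_lt_card (Finset.ssubset_iff_subset_ne.2 ⟨hsub, fun h => hsF (h ▸ hs)⟩)
    omega
  have key : ∀ (j k : U), j ≠ k → (∀ u, u = i ∨ u = j ∨ u = k) → ∀ C ⊆ L,
      (∀ s ∈ C, i ∈ N s ∧ j ∈ N s ∧ k ∉ N s) →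
      (∀ s, i ∈ N s → j ∉ N s → k ∉ N s → s ∈ L) →
      (univ.filter fun s => i ∈ N s ∧ j ∈ N s ∧ k ∉ N s).card +
      (univ.filter fun s => j ∈ N s ∧ i ∉ N s ∧ k ∉ N s).card ≤ C.card + b j →
      (univ.filter fun s => s ∉ F ∧ k ∉ N s).card ≤ b j := by
    intro j k hjk hall C hC hC' hP hCc
    have h1 : (univ.filter fun s => s ∉ F ∧ k ∉ N s) ⊆
      ((univ.filter fun s => i ∈ N s ∧ j ∈ N s ∧ k ∉ N s) \ C) ∪
       (univ.filter fun s => j ∈ N s ∧ i ∉ N s ∧ k ∉ N s) := by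
      intro s hs
      simp only [mem_filter, mem_univ, true_and, mem_union, mem_sdiff] at hs ⊢
      have h2 : s ∉ L := fun h => hs.1 (hLF h)
      have h3 : s ∉ C := fun h => h2 (hC h)
      have h4 := hP s
      obtain ⟨u, hu⟩ := hne s
      rcases hall u with rfl | rfl | rfl <;> tauto
    have h2 := (Finset.card_le_card h1).trans (Finset.card_union_le _ _)
    rw [Finset.card_sdiff_of_subset (by
      intro s hs
      simpa using hC' s hs)] at h2
    have h3 : C.card ≤ (univ.filter fun s => i ∈ N s ∧ j ∈ N s ∧ k ∉ N s).card :=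
      Finset.card_le_card (by
        intro s hs
        simpa using hC' s hs)
    omega
  have hJ := key j k hjk hall C hC hC' hP hCc
  have hK := key k j hjk.symm (fun u => by have := hall u; tauto) B hB hB'
    (fun s h1 h2 h3 => hP s h1 h3 h2) hBc
  have hJK : (univ.filter fun s => s ∉ F ∧ k ∉ N s) ⊆
      univ \ (F ∪ (univ.filter fun s => s ∉ F ∧ j ∉ N s)) := by
    intro s hs
    simp only [mem_filter, mem_univ, true_and, mem_union, mem_sdiff] at hs ⊢
    have h2 : s ∉ L := fun h => hs.1 (hLF h)
    have h4 := hP s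
    obtain ⟨u, hu⟩ := hne s
    rcases hall u with rfl | rfl | rfl <;> tauto
  have hcard : b j ≤ (univ \ (F ∪ (univ.filter fun s => s ∉ F ∧ j ∉ N s))).card := by
    rw [Finset.card_sdiff_of_subset (Finset.subset_univ _), Finset.card_univ]
    have := Finset.card_union_le F (univ.filter fun s => s ∉ F ∧ j ∉ N s)
    omega
  obtain ⟨G, hG1, hG2, hGc⟩ := Finset.exists_subsuperset_card_eq hJK hJ hcard
  have hGF : ∀ s ∈ G, s ∉ F ∧ j ∈ N s := by
    intro s hs
    have := hG2 hs
    simp only [mem_filter, mem_univ, true_and, mem_union, mem_sdiff] at this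
    tauto
  have hGk : ∀ s, s ∉ F → s ∉ G → k ∈ N s := by
    intro s hs hs'
    by_contra h
    exact hs' (hG1 (by simp [hs, h]))
  let f : S → U := fun s => if s ∈ F then i else if s ∈ G then j else k
  have hfi : ∀ s, f s = i ↔ s ∈ F := by
    intro s; simp only [f]; split_ifs with h1 h2
    · simp [h1]
    · simp [h1, hij.symm]
    · simp [h1, hik.symm]
  have hfj : ∀ s, f s = j ↔ s ∈ G := by
    intro s; simp only [f]; split_ifs with h1 h2
    · simp only [hij, false_iff]; exact fun h => (hGF s h).1 h1
    · simp [h2]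
    · simp [h2, hjk.symm]
  have hfk : ∀ s, f s = k ↔ s ∉ F ∪ G := by
    intro s; simp only [f]; split_ifs with h1 h2
    · simp [h1, hik]
    · simp [h2, hjk]
    · simp [h1, h2]
  have hdis : Disjoint F G := Finset.disjoint_left.2 (fun s h h' => (hGF s h').1 h)
  refine ⟨f, ?_, ?_, ?_⟩
  · intro s
    simp only [f]; split_ifs with h1 h2
    · simpa using hFA h1
    · exact (hGF s h2).2
    · exact hGk s h1 h2
  · intro u
    rcases hall u with rfl | rfl | rfl
    · simp [hfi, hFc]
    · simp [hfj, hGc]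
    · simp only [hfk]
      have : (univ.filter fun s => s ∉ F ∪ G) = univ \ (F ∪ G) := by ext; simp
      rw [this, Finset.card_sdiff_of_subset (Finset.subset_univ _), Finset.card_univ,
        Finset.card_union_of_disjoint hdis]
      omega
  · intro s s' hs hs' hN
    rw [hfi] at hs
    rw [Ne, hfi] at hs'
    exact hF s hs s' (by simp [hN, hs'])

lemma lev (p q r t : Prop) [Decidable p] [Decidable q] [Decidable r] [Decidable t] :
    ((if p then 0 else if q then 1 else if r then 2 else if t then 3 else 4 : ℕ) ≤ 1 ↔ p ∨ q) ∧
    ((if p then 0 else if q then 1 else if r then 2 else if t then 3 else 4 : ℕ) ≤ 2 ↔ p ∨ q ∨ r) ∧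
    ((if p then 0 else if q then 1 else if r then 2 else if t then 3 else 4 : ℕ) ≤ 3 ↔
      p ∨ q ∨ r ∨ t) := by
  split_ifs <;> simp [*]

set_option maxHeartbeats 2000000 in
lemma core {S U : Type*} [DecidableEq S] [DecidableEq U] [Fintype S]
    (N : S → Finset U) (b : U → ℕ) (i j k : U)
    (hij : i ≠ j) (hik : i ≠ k) (hjk : j ≠ k) (hall : ∀ u, u = i ∨ u = j ∨ u = k)
    (f : S → U) (hf : ∀ s, f s ∈ N s) (hfb : ∀ u, (univ.filter fun s => f s = u).card = b u)
    (h1 : b i + (univ.filter fun s => N s = {j}).card ≤ b j + (univ.filter fun s => N s = {i}).card)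
    (h2 : b j + (univ.filter fun s => N s = {k}).card ≤ b k + (univ.filter fun s => N s = {j}).card)
    : ∃ σ : S ≃ Fin (Fintype.card S), ∀ u, ∃ f : S → U, (∀ s, f s ∈ N s) ∧
      (∀ u, (univ.filter fun s => f s = u).card = b u) ∧
      ∀ s s', f s = u → f s' ≠ u → u ∈ N s' → σ s < σ s' := by
  have hne : ∀ s, ∃ u, u ∈ N s := fun s => ⟨_, hf s⟩
  have hsum : b i + b j + b k = Fintype.card S := by
    rw [← Finset.card_univ, ← hfb i, ← hfb j, ← hfb k, ← Finset.card_union_of_disjoint,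
      ← Finset.card_union_of_disjoint]
    · congr 1
      ext s
      simpa [or_assoc] using hall (f s)
    · rw [Finset.disjoint_left]; intro s; simp; grind
    · rw [Finset.disjoint_left]; intro s; simp; grind
  have hNb : ∀ u, b u ≤ (univ.filter fun s => u ∈ N s).card := by
    intro u
    rw [← hfb u]
    apply Finset.card_le_card
    intro s
    simp only [mem_filter, mem_univ, true_and]
    rintro rfl
    exact hf s
  -- the classes of items
  obtain ⟨Pi, hPi⟩ : ∃ P : Finset S, P = univ.filter fun s => i ∈ N s ∧ j ∉ N s ∧ k ∉ N s := ⟨_, rfl⟩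
  obtain ⟨Pj, hPj⟩ : ∃ P : Finset S, P = univ.filter fun s => j ∈ N s ∧ i ∉ N s ∧ k ∉ N s := ⟨_, rfl⟩
  obtain ⟨Pk, hPk⟩ : ∃ P : Finset S, P = univ.filter fun s => k ∈ N s ∧ i ∉ N s ∧ j ∉ N s := ⟨_, rfl⟩
  obtain ⟨C, hC⟩ : ∃ P : Finset S, P = univ.filter fun s => i ∈ N s ∧ j ∈ N s ∧ k ∉ N s := ⟨_, rfl⟩
  obtain ⟨B, hB⟩ : ∃ P : Finset S, P = univ.filter fun s => i ∈ N s ∧ k ∈ N s ∧ j ∉ N s := ⟨_, rfl⟩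
  obtain ⟨A, hA⟩ : ∃ P : Finset S, P = univ.filter fun s => j ∈ N s ∧ k ∈ N s ∧ i ∉ N s := ⟨_, rfl⟩
  have eNi : (univ.filter fun s => N s = {i}) = Pi := by
    rw [hPi]; ext s; simp only [mem_filter, mem_univ, true_and, Finset.ext_iff, mem_singleton]
    constructor
    · intro h; simp [h, hij.symm, hik.symm]
    · rintro ⟨ha, hb, hc⟩ u
      rcases hall u with rfl | rfl | rfl <;> simp_all [eq_comm]
  have eNj : (univ.filter fun s => N s = {j}) = Pj := by
    rw [hPj]; ext s; simp only [mem_filter, mem_univ, true_and, Finset.ext_iff, mem_singleton]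
    constructor
    · intro h; simp [h, hij, hjk.symm]
    · rintro ⟨ha, hb, hc⟩ u
      rcases hall u with rfl | rfl | rfl <;> simp_all [eq_comm]
  have eNk : (univ.filter fun s => N s = {k}) = Pk := by
    rw [hPk]; ext s; simp only [mem_filter, mem_univ, true_and, Finset.ext_iff, mem_singleton]
    constructor
    · intro h; simp [h, hik, hjk]
    · rintro ⟨ha, hb, hc⟩ u
      rcases hall u with rfl | rfl | rfl <;> simp_all [eq_comm]
  rw [eNi, eNj] at h1
  rw [eNj, eNk] at h2
  have mPi : ∀ s, s ∈ Pi ↔ i ∈ N s ∧ j ∉ N s ∧ k ∉ N s := by intro s; simp [hPi]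
  have mPj : ∀ s, s ∈ Pj ↔ j ∈ N s ∧ i ∉ N s ∧ k ∉ N s := by intro s; simp [hPj]
  have mPk : ∀ s, s ∈ Pk ↔ k ∈ N s ∧ i ∉ N s ∧ j ∉ N s := by intro s; simp [hPk]
  have mC : ∀ s, s ∈ C ↔ i ∈ N s ∧ j ∈ N s ∧ k ∉ N s := by intro s; simp [hC]
  have mB : ∀ s, s ∈ B ↔ i ∈ N s ∧ k ∈ N s ∧ j ∉ N s := by intro s; simp [hB]
  have mA : ∀ s, s ∈ A ↔ j ∈ N s ∧ k ∈ N s ∧ i ∉ N s := by intro s; simp [hA]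
  -- Hall type inequalities
  have hall1 : ∀ (P : Finset S) (u : U), (∀ s ∈ P, f s = u) → P.card ≤ b u := by
    intro P u h
    rw [← hfb u]
    exact Finset.card_le_card (fun s hs => by simpa using h s hs)
  have hall2 : ∀ (P : Finset S) (u v : U), (∀ s ∈ P, f s = u ∨ f s = v) → P.card ≤ b u + b v := by
    intro P u v h
    rw [← hfb u, ← hfb v]
    exact (Finset.card_le_card (fun s hs => by simpa using h s hs)).trans (Finset.card_union_le _ _)
  have hpi : Pi.card ≤ b i := hall1 _ _ (by
    intro s hs; have := hf s; have := hall (f s); have := (mPi s).1 hs; grind)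
  have hpj : Pj.card ≤ b j := hall1 _ _ (by
    intro s hs; have := hf s; have := hall (f s); have := (mPj s).1 hs; grind)
  have hpk : Pk.card ≤ b k := hall1 _ _ (by
    intro s hs; have := hf s; have := hall (f s); have := (mPk s).1 hs; grind)
  have card3 : ∀ X Y Z : Finset S, (∀ s ∈ X, s ∉ Y ∧ s ∉ Z) → (∀ s ∈ Y, s ∉ Z) →
      (X ∪ Y ∪ Z).card = X.card + Y.card + Z.card := by
    intro X Y Z h h'
    rw [Finset.card_union_of_disjoint, Finset.card_union_of_disjoint]
    · exact Finset.disjoint_left.2 (fun s hs => (h s hs).1)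
    · rw [Finset.disjoint_left]; intro s hs; rcases Finset.mem_union.1 hs with hs | hs
      · exact (h s hs).2
      · exact h' s hs
  have hc : C.card + Pi.card + Pj.card ≤ b i + b j := by
    rw [← card3 C Pi Pj (by intro s; rw [mC, mPi, mPj]; tauto) (by intro s; rw [mPi, mPj]; tauto)]
    refine hall2 _ _ _ ?_
    intro s hs
    rw [mem_union, mem_union, mC, mPi, mPj] at hs
    have := hf s; have := hall (f s); grind
  have hb' : B.card + Pi.card + Pk.card ≤ b i + b k := by
    rw [← card3 B Pi Pk (by intro s; rw [mB, mPi, mPk]; tauto) (by intro s; rw [mPi, mPk]; tauto)]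
    refine hall2 _ _ _ ?_
    intro s hs
    rw [mem_union, mem_union, mB, mPi, mPk] at hs
    have := hf s; have := hall (f s); grind
  have ha : A.card + Pj.card + Pk.card ≤ b j + b k := by
    rw [← card3 A Pj Pk (by intro s; rw [mA, mPj, mPk]; tauto) (by intro s; rw [mPj, mPk]; tauto)]
    refine hall2 _ _ _ ?_
    intro s hs
    rw [mem_union, mem_union, mA, mPj, mPk] at hs
    have := hf s; have := hall (f s); grind
  have htot : A.card + B.card + C.card + (Pi.card + Pj.card + Pk.card) ≤ b i + b j + b k := by
    rw [hsum, ← card3 A B C (by intro s; rw [mA, mB, mC]; tauto) (by intro s; rw [mB, mC]; tauto),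
      ← card3 Pi Pj Pk (by intro s; rw [mPi, mPj, mPk]; tauto) (by intro s; rw [mPj, mPk]; tauto),
      ← Finset.card_union_of_disjoint]
    · exact Finset.card_le_univ _
    · rw [Finset.disjoint_left]
      intro s
      simp only [mem_union, mA, mB, mC, mPi, mPj, mPk]
      tauto
  -- nested demand sets
  have nested : ∀ (X : Finset S) (m n : ℕ), m ≤ n → n ≤ X.card →
      ∃ Y Z : Finset S, Y ⊆ Z ∧ Z ⊆ X ∧ Y.card = m ∧ Z.card = n := by
    intro X m n hmn hn
    obtain ⟨Z, hZ, hZc⟩ := Finset.exists_subset_card_eq hn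
    obtain ⟨Y, hY, hYc⟩ := Finset.exists_subset_card_eq (hZc ▸ hmn)
    exact ⟨Y, Z, hY, hZ, hYc, hZc⟩
  obtain ⟨C1, C2, hC12, hC2, hC1c, hC2c⟩ := nested C (C.card - (b j - Pj.card))
    (C.card - (b i - Pi.card)) (by omega) (by omega)
  obtain ⟨B1, B3, hB13, hB3, hB1c, hB3c⟩ := nested B (B.card - (b k - Pk.card))
    (B.card - (b i - Pi.card)) (by omega) (by omega)
  obtain ⟨A2, A3, hA23, hA3, hA2c, hA3c⟩ := nested A (A.card - (b k - Pk.card))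
    (A.card - (b j - Pj.card)) (by omega) (by omega)
  have hC1 := hC12.trans hC2
  have hB1 := hB13.trans hB3
  have hA2 := hA23.trans hA3
  have nC1 : ∀ s ∈ C1, i ∈ N s ∧ j ∈ N s ∧ k ∉ N s := fun s h => (mC s).1 (hC1 h)
  have nC2 : ∀ s ∈ C2, i ∈ N s ∧ j ∈ N s ∧ k ∉ N s := fun s h => (mC s).1 (hC2 h)
  have nB1 : ∀ s ∈ B1, i ∈ N s ∧ k ∈ N s ∧ j ∉ N s := fun s h => (mB s).1 (hB1 h)
  have nB3 : ∀ s ∈ B3, i ∈ N s ∧ k ∈ N s ∧ j ∉ N s := fun s h => (mB s).1 (hB3 h)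
  have nA2 : ∀ s ∈ A2, j ∈ N s ∧ k ∈ N s ∧ i ∉ N s := fun s h => (mA s).1 (hA2 h)
  have nA3 : ∀ s ∈ A3, j ∈ N s ∧ k ∈ N s ∧ i ∉ N s := fun s h => (mA s).1 (hA3 h)
  obtain ⟨l, hl⟩ : ∃ l : S → ℕ, l = fun s => if s ∈ Pi ∪ Pj ∪ Pk then 0 else
    if s ∈ C1 ∪ B1 then 1 else if s ∈ C2 ∪ A2 then 2 else if s ∈ B3 ∪ A3 then 3 else 4 := ⟨_, rfl⟩
  have hl1 : ∀ s, l s ≤ 1 ↔ s ∈ Pi ∪ Pj ∪ Pk ∨ s ∈ C1 ∪ B1 := by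
    intro s; rw [hl]; exact (lev _ _ _ _).1
  have hl2 : ∀ s, l s ≤ 2 ↔ s ∈ Pi ∪ Pj ∪ Pk ∨ s ∈ C1 ∪ B1 ∨ s ∈ C2 ∪ A2 := by
    intro s; rw [hl]; exact (lev _ _ _ _).2.1
  have hl3 : ∀ s, l s ≤ 3 ↔ s ∈ Pi ∪ Pj ∪ Pk ∨ s ∈ C1 ∪ B1 ∨ s ∈ C2 ∪ A2 ∨ s ∈ B3 ∪ A3 := by
    intro s; rw [hl]; exact (lev _ _ _ _).2.2
  clear hl
  obtain ⟨σ, hσ⟩ := exists_order l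
  have card3' : ∀ X Y Z : Finset S, (X ∪ Y ∪ Z).card ≤ X.card + Y.card + Z.card := by
    intro X Y Z
    have := Finset.card_union_le X Y
    have := Finset.card_union_le (X ∪ Y) Z
    omega
  have ei : ∀ s, s ∈ Pi ∪ C1 ∪ B1 ↔ i ∈ N s ∧ l s ≤ 1 := by
    intro s
    have := nC1 s; have := nB1 s
    simp only [hl1, mem_union, mPi, mPj, mPk]
    tauto
  have ej : ∀ s, s ∈ Pj ∪ C2 ∪ A2 ↔ j ∈ N s ∧ l s ≤ 2 := by
    intro s
    have := nC2 s; have := nA2 s; have := nB1 s; have := @hC12 s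
    simp only [hl2, mem_union, mPi, mPj, mPk]
    tauto
  have ek : ∀ s, s ∈ Pk ∪ B3 ∪ A3 ↔ k ∈ N s ∧ l s ≤ 3 := by
    intro s
    have := nC2 s; have := nB3 s; have := nA3 s; have := @hC12 s
    have := @hB13 s; have := @hA23 s
    simp only [hl3, mem_union, mPi, mPj, mPk]
    tauto
  have swap : ∀ p q r : U, (univ.filter fun s => p ∈ N s ∧ q ∈ N s ∧ r ∉ N s) =
      (univ.filter fun s => q ∈ N s ∧ p ∈ N s ∧ r ∉ N s) := by
    intro p q r; ext s; simp; tauto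
  have swap' : ∀ p q r : U, (univ.filter fun s => p ∈ N s ∧ q ∉ N s ∧ r ∉ N s) =
      (univ.filter fun s => p ∈ N s ∧ r ∉ N s ∧ q ∉ N s) := by
    intro p q r; ext s; simp; tauto
  refine ⟨σ, fun u => ?_⟩
  rcases hall u with rfl | rfl | rfl
  · refine buyer σ N b u j k hij hik hjk hall hne hsum (hNb u) (Pi ∪ C1 ∪ B1) ?_ ?_ ?_ ?_ C1 B1
      ?_ ?_ nC1 nB1 ?_ ?_
    · have := card3' Pi C1 B1; omega
    · intro s hs; exact ((ei s).1 hs).1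
    · intro s hs s' h h'
      rw [ei] at hs h'
      exact hσ _ _ (by by_contra hh; exact h' ⟨h, by omega⟩)
    · intro s x y z; simp [mPi, x, y, z]
    · intro s h; simp [h]
    · intro s h; simp [h]
    · rw [← hC, ← hPj]; omega
    · rw [← hB, ← hPk]; omega
  · refine buyer σ N b u i k hij.symm hjk hik (fun v => by have := hall v; tauto) hne
      (by omega) (hNb u) (Pj ∪ C2 ∪ A2) ?_ ?_ ?_ ?_ C2 A2
      ?_ ?_ (fun s h => by have := nC2 s h; tauto) nA2 ?_ ?_
    · have := card3' Pj C2 A2; omega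
    · intro s hs; exact ((ej s).1 hs).1
    · intro s hs s' h h'
      rw [ej] at hs h'
      exact hσ _ _ (by by_contra hh; exact h' ⟨h, by omega⟩)
    · intro s x y z; simp [mPj, x, y, z]
    · intro s h; simp [h]
    · intro s h; simp [h]
    · rw [swap, ← hC, ← hPi]; omega
    · rw [← hA, swap', ← hPk]; omega
  · refine buyer σ N b u i j hik.symm hjk.symm hij (fun v => by have := hall v; tauto) hne
      (by omega) (hNb u) (Pk ∪ B3 ∪ A3) ?_ ?_ ?_ ?_ B3 A3
      ?_ ?_ (fun s h => by have := nB3 s h; tauto) (fun s h => by have := nA3 s h; tauto) ?_ ?_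
    · have := card3' Pk B3 A3; omega
    · intro s hs; exact ((ek s).1 hs).1
    · intro s hs s' h h'
      rw [ek] at hs h'
      exact hσ _ _ (by by_contra hh; exact h' ⟨h, by omega⟩)
    · intro s x y z; simp [mPk, x, y, z]
    · intro s h; simp [h]
    · intro s h; simp [h]
    · rw [swap, ← hB, swap', ← hPi]; omega
    · rw [swap, ← hA, swap', ← hPj]; omega

lemma core3 {S : Type*} [DecidableEq S] [Fintype S]
    (N : S → Finset (Fin 3)) (b : Fin 3 → ℕ)
    (f : S → Fin 3) (hf : ∀ s, f s ∈ N s) (hfb : ∀ u, (univ.filter fun s => f s = u).card = b u) :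
    ∃ σ : S ≃ Fin (Fintype.card S), ∀ u, ∃ f : S → Fin 3, (∀ s, f s ∈ N s) ∧
      (∀ u, (univ.filter fun s => f s = u).card = b u) ∧
      ∀ s s', f s = u → f s' ≠ u → u ∈ N s' → σ s < σ s' := by
  let c : Fin 3 → ℤ := fun u => (b u : ℤ) - (univ.filter fun s => N s = {u}).card
  let p := Tuple.sort c
  have hm := Tuple.monotone_sort c
  have h01 : c (p 0) ≤ c (p 1) := hm (by decide)
  have h12 : c (p 1) ≤ c (p 2) := hm (by decide)
  refine core N b (p 0) (p 1) (p 2) (by simp) (by simp) (by simp) ?_ f hf hfb ?_ ?_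
  · intro u
    obtain ⟨v, rfl⟩ := p.surjective u
    fin_cases v <;> simp
  · simp only [c] at h01; omega
  · simp only [c] at h12; omega

end Adq

/-- **Theorem 4.2, reformulated.** Every bipartite graph with at most
three buyers that admits a `b`-factor admits an adequate ordering of the items. -/
theorem stmt11 [Fintype S] [Fintype T] (hT : Fintype.card T ≤ 3)
    (E : Finset (S × T)) (b : T → ℕ) (hb : ∀ t, 0 < b t)
    (hfac : ∃ M ⊆ E, (∀ s, degS M s = 1) ∧ ∀ t, degT M t = b t) :
    ∃ σ : S ≃ Fin (Fintype.card S), Adequate σ E b := by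
  classical
  obtain ⟨M, hME, hMS, hMT⟩ := hfac
  have hemb : Nonempty (T ↪ Fin 3) := Function.Embedding.nonempty_of_card_le (by simpa using hT)
  obtain ⟨e⟩ := hemb
  have hM1 : ∀ s, ∃ t, ∀ t', (s, t') ∈ M ↔ t' = t := by
    intro s
    obtain ⟨x, hx⟩ := Finset.card_eq_one.1 (hMS s)
    refine ⟨x.2, fun t' => ?_⟩
    have h1 : x ∈ M.filter fun e => e.1 = s := by rw [hx]; simp
    have h2 : (s, t') ∈ (M.filter fun e => e.1 = s) ↔ (s, t') = x := by rw [hx]; simp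
    simp only [mem_filter, and_true] at h1 h2
    rw [h2, Prod.ext_iff]
    simp [h1.2]
  choose g hg using hM1
  have hgdeg : ∀ t, (univ.filter fun s => g s = t).card = b t := by
    intro t
    rw [← hMT t, degT]
    refine Finset.card_bij (fun s _ => (s, t)) ?_ ?_ ?_
    · intro s hs; simp at hs; simp [hg, hs]
    · intro s _ s' _ h; simpa using h
    · rintro ⟨s, t'⟩ h
      simp only [mem_filter, hg] at h
      exact ⟨s, by simp [← h.1, h.2], by simp [h.2]⟩
  obtain ⟨σ, hσ⟩ := Adq.core3 (fun s => (univ.filter fun t => (s, t) ∈ E).image e)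
    (fun u => (univ.filter fun s => e (g s) = u).card) (fun s => e (g s))
    (fun s => Finset.mem_image_of_mem _ (by simpa using hME ((hg s _).2 rfl))) (fun _ => rfl)
  refine ⟨σ, fun t => ?_⟩
  obtain ⟨f, hf, hfb, hfσ⟩ := hσ (e t)
  have hf' : ∀ s, ∃ t, (s, t) ∈ E ∧ e t = f s := by
    intro s
    have := hf s
    simpa using this
  choose h hhE hhf using hf'
  have hdeg : ∀ t, (univ.filter fun s => h s = t).card = b t := by
    intro t
    have := hfb (e t)
    simp only [← hhf, e.injective.eq_iff, hgdeg] at this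
    exact this
  have hmem : ∀ s t, (s, t) ∈ (univ.image fun s => (s, h s)) ↔ h s = t := by
    intro s t; simp
  have hnb : ∀ (H : Finset (S × T)) s, s ∈ nbhd H {t} ↔ (s, t) ∈ H := by
    intro H s
    simp [nbhd]
  refine ⟨univ.image fun s => (s, h s), ?_, ?_, ?_, ?_⟩
  · rintro ⟨s, t⟩ hs
    rw [hmem] at hs
    exact hs ▸ hhE s
  · intro s
    rw [degS, Finset.card_eq_one]
    refine ⟨(s, h s), ?_⟩
    ext ⟨s', t'⟩
    rw [mem_filter, hmem, mem_singleton, Prod.ext_iff]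
    constructor
    · rintro ⟨rfl, rfl⟩; simp
    · rintro ⟨h1, h2⟩; dsimp at h1 h2; subst h1; simp [h2]
  · intro t'
    rw [← hdeg t', degT]
    symm
    refine Finset.card_bij (fun s _ => (s, t')) ?_ ?_ ?_
    · intro s hs
      rw [mem_filter, hmem]
      simpa using hs
    · intro s _ s' _ h; simpa using h
    · rintro ⟨s, t''⟩ hx
      rw [mem_filter, hmem] at hx
      obtain ⟨hx1, hx2⟩ := hx
      dsimp at hx2
      exact ⟨s, by simp [hx1, hx2], by simp [hx2]⟩
  · intro s hs s' hs'
    rw [hnb, hmem] at hs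
    rw [mem_sdiff, hnb, hnb, hmem] at hs'
    refine hfσ s s' ?_ ?_ ?_
    · rw [← hhf, hs]
    · rw [← hhf]; exact fun hh => hs'.2 (e.injective hh)
    · exact Finset.mem_image_of_mem _ (by simpa using hs'.1)
end

section
/- Let G=(S,T;E) be a finite bipartite graph such that |N(Y)| ≥ 2|Y| + 1 for every nonempty proper subset Y ⊊ T. Let Y_1, Y_2 ⊆ T be dangerous sets (i.e., |N(Y_i)| = 2|Y_i| + 1) with Y_1 ∩ Y_2 = ∅, Y_1 ∪ Y_2 ⊊ T, and N(Y_1) ∩ N(Y_2) ≠ ∅. Then |N(Y_1) ∩ N(Y_2)| = 1 and Y_1 ∪ Y_2 is dangerous. -/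
open Finset

variable {S T : Type*} [DecidableEq S] [DecidableEq T]

/-- **Claim 5.2(a).** Disjoint dangerous sets whose neighborhoods meet
share exactly one neighbor, and their union is dangerous. -/
theorem stmt12 [Fintype S] [Fintype T]
    (E : Finset (S × T))
    (hN : ∀ Y : Finset T, Y.Nonempty → Y ≠ univ → 2 * Y.card + 1 ≤ (nbhd E Y).card)
    (Y₁ Y₂ : Finset T)
    (h1 : (nbhd E Y₁).card = 2 * Y₁.card + 1)
    (h2 : (nbhd E Y₂).card = 2 * Y₂.card + 1)
    (hdisj : Y₁ ∩ Y₂ = ∅) (hproper : Y₁ ∪ Y₂ ≠ univ)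
    (hmeet : (nbhd E Y₁ ∩ nbhd E Y₂).Nonempty) :
    (nbhd E Y₁ ∩ nbhd E Y₂).card = 1 ∧
      (nbhd E (Y₁ ∪ Y₂)).card = 2 * (Y₁ ∪ Y₂).card + 1 := by
  have hU : nbhd E (Y₁ ∪ Y₂) = nbhd E Y₁ ∪ nbhd E Y₂ := by
    ext s
    simp only [nbhd, mem_image, mem_filter, mem_union]
    constructor
    · rintro ⟨e, ⟨he, h | h⟩, rfl⟩
      · exact Or.inl ⟨e, ⟨he, h⟩, rfl⟩
      · exact Or.inr ⟨e, ⟨he, h⟩, rfl⟩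
    · rintro (⟨e, ⟨he, h⟩, rfl⟩ | ⟨e, ⟨he, h⟩, rfl⟩)
      · exact ⟨e, ⟨he, Or.inl h⟩, rfl⟩
      · exact ⟨e, ⟨he, Or.inr h⟩, rfl⟩
  have hne : (Y₁ ∪ Y₂).Nonempty := by
    obtain ⟨s, hs⟩ := hmeet
    have hs1 := (mem_inter.mp hs).1
    simp only [nbhd, mem_image, mem_filter] at hs1
    obtain ⟨e, ⟨_, h⟩, _⟩ := hs1
    exact ⟨e.2, mem_union_left _ h⟩
  have hb := hN _ hne hproper
  have hc := card_union_add_card_inter (nbhd E Y₁) (nbhd E Y₂)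
  have hd := card_union_add_card_inter Y₁ Y₂
  rw [hdisj, card_empty] at hd
  have hp := hmeet.card_pos
  rw [hU] at hb ⊢
  omega
end

section
/- Let G=(S,T;E) be a finite bipartite graph such that |N(Y)| ≥ 2|Y| + 1 for every nonempty proper subset Y ⊊ T. Let Y_1, Y_2 ⊆ T be dangerous sets (i.e., |N(Y_i)| = 2|Y_i| + 1) with Y_1 ∩ Y_2 ≠ ∅ and Y_1 ∪ Y_2 ⊊ T. Then both Y_1 ∩ Y_2 and Y_1 ∪ Y_2 are dangerous. -/
open Finset

variable {S T : Type*} [DecidableEq S] [DecidableEq T]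

/-- **Claim 5.2(b).** Intersecting dangerous sets uncross: both their
intersection and their union are dangerous. -/
theorem stmt13 [Fintype S] [Fintype T]
    (E : Finset (S × T))
    (hN : ∀ Y : Finset T, Y.Nonempty → Y ≠ univ → 2 * Y.card + 1 ≤ (nbhd E Y).card)
    (Y₁ Y₂ : Finset T)
    (h1 : (nbhd E Y₁).card = 2 * Y₁.card + 1)
    (h2 : (nbhd E Y₂).card = 2 * Y₂.card + 1)
    (hmeet : (Y₁ ∩ Y₂).Nonempty) (hproper : Y₁ ∪ Y₂ ≠ univ) :
    (nbhd E (Y₁ ∩ Y₂)).card = 2 * (Y₁ ∩ Y₂).card + 1 ∧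
      (nbhd E (Y₁ ∪ Y₂)).card = 2 * (Y₁ ∪ Y₂).card + 1 := by
  have hu : nbhd E (Y₁ ∪ Y₂) = nbhd E Y₁ ∪ nbhd E Y₂ := by
    ext s
    simp only [nbhd, mem_image, mem_filter, mem_union]
    constructor
    · rintro ⟨e, ⟨he, h | h⟩, rfl⟩
      · exact Or.inl ⟨e, ⟨he, h⟩, rfl⟩
      · exact Or.inr ⟨e, ⟨he, h⟩, rfl⟩
    · rintro (⟨e, ⟨he, h⟩, rfl⟩ | ⟨e, ⟨he, h⟩, rfl⟩)
      · exact ⟨e, ⟨he, Or.inl h⟩, rfl⟩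
      · exact ⟨e, ⟨he, Or.inr h⟩, rfl⟩
  have hi : nbhd E (Y₁ ∩ Y₂) ⊆ nbhd E Y₁ ∩ nbhd E Y₂ := by
    intro s
    simp only [nbhd, mem_image, mem_filter, mem_inter]
    rintro ⟨e, ⟨he, h, h'⟩, rfl⟩
    exact ⟨⟨e, ⟨he, h⟩, rfl⟩, ⟨e, ⟨he, h'⟩, rfl⟩⟩
  have hsub : Y₁ ∩ Y₂ ⊆ Y₁ ∪ Y₂ := fun x hx => mem_union_left _ (mem_inter.1 hx).1
  have hip : Y₁ ∩ Y₂ ≠ univ := fun h => hproper (univ_subset_iff.1 (h ▸ hsub))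
  have a := hN _ hmeet hip
  have b := hN _ (hmeet.mono hsub) hproper
  have c := card_le_card hi
  have d := card_union_add_card_inter (nbhd E Y₁) (nbhd E Y₂)
  have f := card_union_add_card_inter Y₁ Y₂
  rw [← hu] at d
  constructor <;> omega
end

section
/- Let G=(S,T;E) be a finite bipartite graph admitting a (1,2)-factor, and suppose |N(Y)| ≥ 2|Y| + 1 for every nonempty proper subset Y ⊊ T. Let Z ⊆ T be an inclusionwise maximal dangerous set, let X ⊆ T be an inclusionwise minimal dangerous set with X ∩ Z = ∅, and suppose there exist t_0 ∈ X and distinct items s_1, s_2 ∈ N(t_0) such that no (1,2)-factor M of G satisfies N_M(t_0) = {s_1, s_2}. Then X ∪ Z = T and N(X) ∩ N(Z) = {s_1, s_2}. -/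
open Finset

variable {S T : Type*} [DecidableEq S] [DecidableEq T]

theorem mem_nbhd_iff (E : Finset (S × T)) (X : Finset T) (s : S) :
    s ∈ nbhd E X ↔ ∃ t ∈ X, (s, t) ∈ E := by
  unfold nbhd
  simp only [mem_image, mem_filter, Prod.exists]
  constructor
  · rintro ⟨a, b, ⟨h1, h2⟩, rfl⟩
    exact ⟨b, h2, h1⟩
  · rintro ⟨t, h1, h2⟩
    exact ⟨s, t, ⟨h2, h1⟩, rfl⟩

theorem nbhd_union_eq (E : Finset (S × T)) (X Y : Finset T) :
    nbhd E (X ∪ Y) = nbhd E X ∪ nbhd E Y := by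
  ext s
  simp only [mem_nbhd_iff, mem_union]
  grind

theorem nbhd_inter_subset (E : Finset (S × T)) (X Y : Finset T) :
    nbhd E (X ∩ Y) ⊆ nbhd E X ∩ nbhd E Y := by
  intro s
  simp only [mem_nbhd_iff, mem_inter]
  grind

theorem card_eq_of_factor [Fintype S] [Fintype T] (M : Finset (S × T))
    (h1 : ∀ s, degS M s = 1) (h2 : ∀ t, degT M t = 2) :
    Fintype.card S = 2 * Fintype.card T := by
  have a : M.card = ∑ s : S, degS M s :=
    card_eq_sum_card_fiberwise (f := Prod.fst) (fun _ _ => by simp)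
  have b : M.card = ∑ t : T, degT M t :=
    card_eq_sum_card_fiberwise (f := Prod.snd) (fun _ _ => by simp)
  simp only [h1, h2, sum_const, card_univ, smul_eq_mul] at a b
  omega

theorem nbhd_univ_of_factor [Fintype S] [Fintype T] (E M : Finset (S × T)) (hM : M ⊆ E)
    (h1 : ∀ s, degS M s = 1) : nbhd E univ = univ := by
  ext s
  simp only [mem_nbhd_iff, mem_univ, true_and, iff_true]
  have := h1 s
  unfold degS at this
  obtain ⟨e, he⟩ := card_pos.mp (by omega : 0 < (M.filter fun e => e.1 = s).card)
  rw [mem_filter] at he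
  refine ⟨e.2, ?_⟩
  rw [← he.2]
  exact hM he.1

theorem factor_of_injective [Fintype S] [Fintype T] (E : Finset (S × T))
    (hc : Fintype.card S = 2 * Fintype.card T) (g : T × Bool → S) (hg : Function.Injective g)
    (hE : ∀ p, (g p, p.1) ∈ E) :
    ∃ M ⊆ E, (∀ s, degS M s = 1) ∧ (∀ t, degT M t = 2) ∧
      ∀ t, nbhd M {t} = {g (t, true), g (t, false)} := by
  have hb : Function.Bijective g := by
    rw [Fintype.bijective_iff_injective_and_card]
    refine ⟨hg, ?_⟩
    rw [Fintype.card_prod, Fintype.card_bool, hc, mul_comm]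
  refine ⟨univ.image (fun p => (g p, p.1)), ?_, ?_, ?_, ?_⟩
  · intro e he
    simp only [mem_image, mem_univ, true_and] at he
    obtain ⟨p, rfl⟩ := he
    exact hE p
  · intro s
    obtain ⟨p, rfl⟩ := hb.2 s
    unfold degS
    rw [card_eq_one]
    refine ⟨(g p, p.1), ?_⟩
    ext e
    simp only [mem_filter, mem_image, mem_univ, true_and, mem_singleton]
    constructor
    · rintro ⟨⟨q, rfl⟩, h⟩
      rw [hg h]
    · rintro rfl
      exact ⟨⟨p, rfl⟩, rfl⟩
  · intro t
    unfold degT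
    rw [card_eq_two]
    refine ⟨(g (t, true), t), (g (t, false), t), ?_, ?_⟩
    · intro h
      have := hg (congrArg Prod.fst h)
      simp at this
    · ext e
      simp only [mem_filter, mem_image, mem_univ, true_and, mem_singleton, mem_insert]
      constructor
      · rintro ⟨⟨⟨q, b⟩, rfl⟩, h⟩
        cases b <;> simp_all
      · rintro (rfl | rfl)
        · exact ⟨⟨(t, true), rfl⟩, rfl⟩
        · exact ⟨⟨(t, false), rfl⟩, rfl⟩
  · intro t
    ext s
    simp only [mem_nbhd_iff, mem_image, mem_univ, true_and, mem_singleton, mem_insert]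
    constructor
    · rintro ⟨t', rfl, ⟨q, b⟩, h⟩
      simp only [Prod.mk.injEq] at h
      obtain ⟨h1, rfl⟩ := h
      cases b <;> simp [h1]
    · rintro (rfl | rfl)
      · exact ⟨t, rfl, (t, true), rfl⟩
      · exact ⟨t, rfl, (t, false), rfl⟩

theorem hall_violator [Fintype S] [Fintype T] (E : Finset (S × T))
    (hc : Fintype.card S = 2 * Fintype.card T)
    (t₀ : T) (s₁ s₂ : S) (hs : s₁ ≠ s₂) (h₁ : (s₁, t₀) ∈ E) (h₂ : (s₂, t₀) ∈ E)
    (hinfeas : ¬∃ M ⊆ E, (∀ s, degS M s = 1) ∧ (∀ t, degT M t = 2) ∧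
      nbhd M {t₀} = {s₁, s₂}) :
    ∃ Y : Finset T, t₀ ∉ Y ∧ (nbhd E Y \ {s₁, s₂}).card < 2 * Y.card := by
  by_contra! hcon
  apply hinfeas
  let ι := {p : T × Bool // p.1 ≠ t₀}
  have key := (all_card_le_biUnion_card_iff_exists_injective
    (fun p : ι => nbhd E {p.1.1} \ {s₁, s₂})).mp (by
      intro A
      let Y : Finset T := A.image (fun p => p.1.1)
      have hY : t₀ ∉ Y := by
        simp only [Y, mem_image, not_exists, not_and]
        intro p _ h
        exact p.2 h
      have h := hcon Y hY
      have e1 : (A.biUnion fun p : ι => nbhd E {p.1.1} \ {s₁, s₂}) = nbhd E Y \ {s₁, s₂} := by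
        ext s
        simp only [mem_biUnion, mem_sdiff, mem_nbhd_iff, mem_singleton, Y, mem_image]
        constructor
        · rintro ⟨p, hp, ⟨t, rfl, ht⟩, h⟩
          exact ⟨⟨p.1.1, ⟨p, hp, rfl⟩, ht⟩, h⟩
        · rintro ⟨⟨t, ⟨p, hp, rfl⟩, ht⟩, h⟩
          exact ⟨p, hp, ⟨p.1.1, rfl, ht⟩, h⟩
      rw [e1]
      have e2 : A.card ≤ (Y ×ˢ (univ : Finset Bool)).card := by
        apply card_le_card_of_injOn (fun p : ι => p.1)
        · intro p hp
          simp only [coe_product, Set.mem_prod, mem_coe, mem_univ, and_true, Y]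
          exact mem_image_of_mem _ hp
        · intro p _ q _ h
          exact Subtype.ext h
      rw [card_product, card_univ, Fintype.card_bool] at e2
      omega)
  obtain ⟨g, hg, hgE⟩ := key
  have hgE' : ∀ p : ι, (g p, p.1.1) ∈ E ∧ g p ≠ s₁ ∧ g p ≠ s₂ := by
    intro p
    have := hgE p
    simp only [mem_sdiff, mem_nbhd_iff, mem_singleton, mem_insert, not_or] at this
    obtain ⟨⟨t, rfl, h⟩, h'⟩ := this
    exact ⟨h, h'⟩
  let g' : T × Bool → S := fun p =>
    if h : p.1 ≠ t₀ then g ⟨p, h⟩ else if p.2 then s₁ else s₂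
  obtain ⟨M, hM, a, b, c⟩ := factor_of_injective E hc g' (by
    intro p q hpq
    simp only [g'] at hpq
    by_cases hp : p.1 ≠ t₀ <;> by_cases hq : q.1 ≠ t₀
    · rw [dif_pos hp, dif_pos hq] at hpq
      exact congrArg Subtype.val (hg hpq)
    · rw [dif_pos hp, dif_neg hq] at hpq
      have := hgE' ⟨p, hp⟩
      split_ifs at hpq
      · exact absurd hpq this.2.1
      · exact absurd hpq this.2.2
    · rw [dif_neg hp, dif_pos hq] at hpq
      have := hgE' ⟨q, hq⟩
      split_ifs at hpq
      · exact absurd hpq.symm this.2.1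
      · exact absurd hpq.symm this.2.2
    · rw [dif_neg hp, dif_neg hq] at hpq
      obtain ⟨p1, p2⟩ := p
      obtain ⟨q1, q2⟩ := q
      simp only [ne_eq, not_not] at hp hq
      subst hp hq
      cases p2 <;> cases q2 <;> simp_all) (by
    intro p
    simp only [g']
    by_cases hp : p.1 ≠ t₀
    · rw [dif_pos hp]
      exact (hgE' ⟨p, hp⟩).1
    · rw [dif_neg hp]
      rw [not_not] at hp
      rw [hp]
      split_ifs <;> assumption)
  refine ⟨M, hM, a, b, ?_⟩
  rw [c]
  simp [g']

/-- **Claim 5.3.** Let `Z` be an inclusionwise maximal dangerous set and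
`X` an inclusionwise minimal dangerous set disjoint from `Z`. If some buyer `t₀ ∈ X` has
distinct neighbors `s₁, s₂` forming a non-feasible pair, then `X ∪ Z = T` and
`N(X) ∩ N(Z) = {s₁, s₂}`. -/
theorem stmt14 [Fintype S] [Fintype T]
    (E : Finset (S × T))
    (hfac : ∃ M ⊆ E, (∀ s, degS M s = 1) ∧ ∀ t, degT M t = 2)
    (hN : ∀ Y : Finset T, Y.Nonempty → Y ≠ univ → 2 * Y.card + 1 ≤ (nbhd E Y).card)
    (Z : Finset T) (hZ : (nbhd E Z).card = 2 * Z.card + 1)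
    (hZmax : ∀ Z' : Finset T, (nbhd E Z').card = 2 * Z'.card + 1 → Z ⊆ Z' → Z' = Z)
    (X : Finset T) (hX : (nbhd E X).card = 2 * X.card + 1) (hXZ : X ∩ Z = ∅)
    (hXmin : ∀ X' : Finset T, (nbhd E X').card = 2 * X'.card + 1 → X' ∩ Z = ∅ →
      X' ⊆ X → X' = X)
    (t₀ : T) (ht₀ : t₀ ∈ X) (s₁ s₂ : S) (hs : s₁ ≠ s₂)
    (hs₁ : s₁ ∈ nbhd E {t₀}) (hs₂ : s₂ ∈ nbhd E {t₀})
    (hinfeas : ¬∃ M ⊆ E, (∀ s, degS M s = 1) ∧ (∀ t, degT M t = 2) ∧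
      nbhd M {t₀} = {s₁, s₂}) :
    X ∪ Z = univ ∧ nbhd E X ∩ nbhd E Z = {s₁, s₂} := by
  obtain ⟨M, hM, hM1, hM2⟩ := hfac
  have hc := card_eq_of_factor M hM1 hM2
  have hU := nbhd_univ_of_factor E M hM hM1
  rw [mem_nbhd_iff] at hs₁ hs₂
  have h₁ : (s₁, t₀) ∈ E := by simpa using hs₁
  have h₂ : (s₂, t₀) ∈ E := by simpa using hs₂
  obtain ⟨Y, hY0, hY⟩ := hall_violator E hc t₀ s₁ s₂ hs h₁ h₂ hinfeas
  have hpair : ({s₁, s₂} : Finset S).card = 2 := card_pair hs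
  have hYne : Y.Nonempty := by
    rw [nonempty_iff_ne_empty]
    rintro rfl
    simp at hY
  have hYu : Y ≠ univ := by
    rintro rfl
    exact hY0 (mem_univ _)
  have hYN := hN Y hYne hYu
  have hsd := card_sdiff_add_card_inter (nbhd E Y) {s₁, s₂}
  have hle : (nbhd E Y ∩ {s₁, s₂}).card ≤ 2 := hpair ▸ card_le_card inter_subset_right
  have hYd : (nbhd E Y).card = 2 * Y.card + 1 := by omega
  have hYs : ({s₁, s₂} : Finset S) ⊆ nbhd E Y := by
    have : nbhd E Y ∩ {s₁, s₂} = {s₁, s₂} :=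
      eq_of_subset_of_card_le inter_subset_right (by omega)
    rw [← this]
    exact inter_subset_left
  have hXs : ({s₁, s₂} : Finset S) ⊆ nbhd E X := by
    intro s h
    rw [mem_nbhd_iff]
    rcases mem_insert.mp h with rfl | h
    · exact ⟨t₀, ht₀, h₁⟩
    · rw [mem_singleton.mp h]
      exact ⟨t₀, ht₀, h₂⟩
  have hsub := subset_inter hXs hYs
  have hsubc := card_le_card hsub
  have hun := card_union_add_card_inter (nbhd E X) (nbhd E Y)
  have hunT := card_union_add_card_inter X Y
  rw [← nbhd_union_eq] at hun
  have hUne : (X ∪ Y).Nonempty := ⟨t₀, mem_union_left _ ht₀⟩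
  have fin : X ∪ Y = univ → Y = Z := by
    intro h
    apply hZmax Y hYd
    intro t ht
    have h' : t ∈ X ∪ Y := h ▸ mem_univ t
    rcases mem_union.mp h' with h' | h'
    · have : t ∈ X ∩ Z := mem_inter.mpr ⟨h', ht⟩
      simp [hXZ] at this
    · exact h'
  have hcard : 2 * (X ∩ Y).card + 2 ≤ (nbhd E X ∩ nbhd E Y).card := by
    rcases (X ∩ Y).eq_empty_or_nonempty with h | h
    · rw [h, card_empty]
      omega
    · refine le_trans ?_ (card_le_card (nbhd_inter_subset E X Y))
      have h0 : t₀ ∉ X ∩ Y := fun h => hY0 (mem_inter.mp h).2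
      have hn := hN (X ∩ Y) h (by
        intro h'
        rw [h'] at h0
        exact h0 (mem_univ _))
      rcases Nat.lt_or_ge (2 * (X ∩ Y).card + 1) (nbhd E (X ∩ Y)).card with h' | h'
      · exact h'
      · exfalso
        have h3 := hXmin (X ∩ Y) (le_antisymm h' hn) (by
          rw [inter_right_comm, hXZ, empty_inter]) inter_subset_left
        rw [h3] at h0
        exact h0 ht₀
  have hXY : X ∪ Y = univ := by
    by_contra h
    have := hN _ hUne h
    omega
  have hYZ := fin hXY
  subst hYZ
  refine ⟨hXY, ?_⟩
  rw [hXZ, card_empty] at hunT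
  rw [hXY, hU, card_univ, hc] at hun
  rw [hXY, card_univ] at hunT
  exact (eq_of_subset_of_card_le hsub (by omega)).symm
end

section
/- Let G=(S,T;E) be a finite bipartite graph admitting a (1,2)-factor, and suppose every edge of G is contained in some (1,2)-factor. If T' is a nonempty proper subset of T with |N(T')| = 2|T'|, then there is no edge of G between T − T' and N(T'); in particular, G is the disjoint union of the induced subgraphs on T' ∪ N(T') and on (T − T') ∪ (S − N(T')). -/
open Finset

variable {S T : Type*} [DecidableEq S] [DecidableEq T]

/-- **Case 3 of Theorem 5.1.** If every edge lies in some `(1,2)`-factor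
and `T'` is a nonempty proper subset of `T` with `|N(T')| = 2|T'|`, then every edge
either joins `T'` to `N(T')` or joins `T − T'` to `S − N(T')`; in particular there is
no edge between `T − T'` and `N(T')`. -/
theorem stmt15 [Fintype S] [Fintype T]
    (E : Finset (S × T))
    (hfac : ∃ M ⊆ E, (∀ s, degS M s = 1) ∧ ∀ t, degT M t = 2)
    (hall : ∀ e ∈ E, ∃ M ⊆ E, (∀ s, degS M s = 1) ∧ (∀ t, degT M t = 2) ∧ e ∈ M)
    (T' : Finset T) (hne : T'.Nonempty) (hproper : T' ≠ univ)
    (hcard : (nbhd E T').card = 2 * T'.card) :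
    ∀ e ∈ E, (e.2 ∈ T' ∧ e.1 ∈ nbhd E T') ∨ (e.2 ∉ T' ∧ e.1 ∉ nbhd E T') := by
  intro e he
  by_cases h : e.2 ∈ T'
  · exact Or.inl ⟨h, mem_image.2 ⟨e, mem_filter.2 ⟨he, h⟩, rfl⟩⟩
  refine Or.inr ⟨h, fun hN => h ?_⟩
  obtain ⟨M, hM, hS, hT, heM⟩ := hall e he
  have hinj : ∀ a ∈ M, ∀ b ∈ M, a.1 = b.1 → a = b := by
    intro a ha b hb hab
    have h1 : (M.filter fun e => e.1 = b.1).card ≤ 1 := (hS b.1).le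
    exact card_le_one.1 h1 a (mem_filter.2 ⟨ha, hab⟩) b (mem_filter.2 ⟨hb, rfl⟩)
  have hc : (M.filter fun e => e.2 ∈ T').card = 2 * T'.card := by
    have hmaps : ∀ x ∈ M.filter (fun e => e.2 ∈ T'), x.2 ∈ T' :=
      fun x hx => (mem_filter.1 hx).2
    rw [card_eq_sum_card_fiberwise (f := Prod.snd) (t := T') hmaps]
    rw [sum_congr rfl (g := fun _ => 2), sum_const, smul_eq_mul, mul_comm]
    intro t ht
    rw [← hT t, degT, filter_filter]
    congr 1
    ext x
    simp only [mem_filter]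
    constructor
    · rintro ⟨a, _, c⟩
      exact ⟨a, c⟩
    · rintro ⟨a, c⟩
      exact ⟨a, c ▸ ht, c⟩
  have himg : (M.filter fun e => e.2 ∈ T').image Prod.fst = nbhd E T' := by
    apply eq_of_subset_of_card_le
    · exact image_subset_image (filter_subset_filter _ hM)
    · rw [hcard, card_image_of_injOn, hc]
      intro a ha b hb hab
      exact hinj a (mem_filter.1 ha).1 b (mem_filter.1 hb).1 hab
  rw [← himg] at hN
  obtain ⟨f, hf, hfe⟩ := mem_image.1 hN
  obtain ⟨hfM, hfT⟩ := mem_filter.1 hf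
  rw [← hinj f hfM e heM hfe]
  exact hfT
end

section
/- Every finite bipartite graph G=(S,T;E) that admits a (1,2)-factor admits an adequate ordering: there exists a bijection σ: S → {1,…,|S|} such that for every buyer t ∈ T there exists a (1,2)-factor M of G with N_M(t) equal to the set of the two neighbors s of t with smallest σ(s). -/
open Finset

variable {S T : Type*} [DecidableEq S] [DecidableEq T]

namespace AdeqAux

open Classical in
/-- Items of `A` adjacent to some buyer in `Y`. -/
noncomputable def nb (A : Finset S) (R : S → T → Prop) (Y : Finset T) : Finset S :=
  A.filter fun s => ∃ t ∈ Y, R s t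

/-- `m` encodes a (1,2)-factor between `A` and `B`. -/
def Fac (A : Finset S) (B : Finset T) (R : S → T → Prop) (m : S → T) : Prop :=
  (∀ s ∈ A, m s ∈ B ∧ R s (m s)) ∧ ∀ t ∈ B, (A.filter fun s => m s = t).card = 2

/-- `f` is an adequate ordering of `A`. -/
def Good (A : Finset S) (B : Finset T) (R : S → T → Prop) (f : S → ℕ) : Prop :=
  ∀ t ∈ B, ∃ m, Fac A B R m ∧
    ∀ s ∈ A, m s = t → ∀ s' ∈ A, R s' t → m s' ≠ t → f s < f s'

theorem mem_nb {A : Finset S} {R : S → T → Prop} {Y : Finset T} {s : S} :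
    s ∈ nb A R Y ↔ s ∈ A ∧ ∃ t ∈ Y, R s t := by
  simp [nb]

theorem card_pre {A : Finset S} {B : Finset T} {R : S → T → Prop} {m : S → T}
    (h : Fac A B R m) {X : Finset T} (hX : X ⊆ B) :
    (A.filter fun s => m s ∈ X).card = 2 * X.card := by
  have := Finset.card_eq_sum_card_fiberwise (f := m) (s := A.filter fun s => m s ∈ X) (t := X)
    (by intro s hs; simpa using (Finset.mem_filter.1 hs).2)
  rw [this, Finset.sum_const_nat (m := 2), mul_comm]
  intro t ht
  rw [Finset.filter_filter, ← h.2 t (hX ht)]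
  congr 1
  ext s
  simp only [Finset.mem_filter]
  constructor
  · rintro ⟨a, b, c⟩; exact ⟨a, c⟩
  · rintro ⟨a, c⟩; exact ⟨a, c ▸ ht, c⟩

theorem card_all {A : Finset S} {B : Finset T} {R : S → T → Prop} {m : S → T}
    (h : Fac A B R m) : A.card = 2 * B.card := by
  rw [← card_pre h (Finset.Subset.refl B), Finset.filter_true_of_mem]
  exact fun s hs => (h.1 s hs).1

theorem split {A : Finset S} {B : Finset T} {R : S → T → Prop} {m : S → T}
    (h : Fac A B R m) {X : Finset T} (hX : X ⊆ B) {A' : Finset S} (hA : A' ⊆ A)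
    (hc : A'.card ≤ 2 * X.card) (hm : ∀ s ∈ A, m s ∈ X → s ∈ A') :
    Fac A' X R m ∧ Fac (A \ A') (B \ X) R m := by
  have e : (A.filter fun s => m s ∈ X) = A' := by
    apply Finset.eq_of_subset_of_card_le
    · intro s hs
      rw [Finset.mem_filter] at hs
      exact hm s hs.1 hs.2
    · rw [card_pre h hX]; exact hc
  have e' : ∀ s ∈ A, (s ∈ A' ↔ m s ∈ X) := by
    intro s hs; rw [← e]; simp [hs]
  refine ⟨⟨fun s hs => ⟨(e' s (hA hs)).1 hs, (h.1 s (hA hs)).2⟩, fun t ht => ?_⟩,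
    ⟨fun s hs => ?_, fun t ht => ?_⟩⟩
  · rw [← h.2 t (hX ht)]
    congr 1
    ext s
    simp only [Finset.mem_filter]
    constructor
    · rintro ⟨a, c⟩; exact ⟨hA a, c⟩
    · rintro ⟨a, c⟩; exact ⟨(e' s a).2 (c ▸ ht), c⟩
  · rw [Finset.mem_sdiff] at hs ⊢
    exact ⟨⟨(h.1 s hs.1).1, fun hx => hs.2 ((e' s hs.1).2 hx)⟩, (h.1 s hs.1).2⟩
  · rw [Finset.mem_sdiff] at ht
    rw [← h.2 t ht.1]
    congr 1
    ext s
    simp only [Finset.mem_filter, Finset.mem_sdiff]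
    constructor
    · rintro ⟨a, c⟩; exact ⟨a.1, c⟩
    · rintro ⟨a, c⟩; exact ⟨⟨a, fun hx => ht.2 (c ▸ (e' s a).1 hx)⟩, c⟩

theorem glue {A A1 A2 : Finset S} {B B1 B2 : Finset T} {R : S → T → Prop} {m1 m2 : S → T}
    (h1 : Fac A1 B1 R m1) (h2 : Fac A2 B2 R m2)
    (hA : ∀ s, s ∈ A ↔ s ∈ A1 ∨ s ∈ A2) (hB : ∀ t, t ∈ B ↔ t ∈ B1 ∨ t ∈ B2)
    (dA : ∀ s ∈ A1, s ∉ A2) (dB : ∀ t ∈ B1, t ∉ B2) :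
    Fac A B R (fun s => if s ∈ A1 then m1 s else m2 s) := by
  refine ⟨fun s hs => ?_, fun t ht => ?_⟩
  · rw [hA] at hs
    by_cases h : s ∈ A1
    · simp only [h, if_true, hB]
      exact ⟨Or.inl (h1.1 s h).1, (h1.1 s h).2⟩
    · have h' := hs.resolve_left h
      simp only [h, if_false, hB]
      exact ⟨Or.inr (h2.1 s h').1, (h2.1 s h').2⟩
  · rw [hB] at ht
    rcases ht with ht | ht
    · rw [← h1.2 t ht]
      congr 1
      ext s
      simp only [Finset.mem_filter, hA]
      constructor
      · rintro ⟨a, c⟩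
        by_cases h : s ∈ A1
        · simpa [h] using c
        · simp only [h, if_false] at c
          have h' := a.resolve_left h
          exact absurd (h2.1 s h').1 (c ▸ dB t ht)
      · rintro ⟨a, c⟩; simp [a, c]
    · rw [← h2.2 t ht]
      congr 1
      ext s
      simp only [Finset.mem_filter, hA]
      constructor
      · rintro ⟨a, c⟩
        by_cases h : s ∈ A1
        · simp only [h, if_true] at c
          exact absurd ht (dB t (c ▸ (h1.1 s h).1))
        · simp only [h, if_false] at c
          exact ⟨a.resolve_left h, c⟩
      · rintro ⟨a, c⟩
        have : s ∉ A1 := fun h => dA s h a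
        simp [a, c, this]

/-- Hall's theorem for (1,2)-factors. -/
theorem hall {A : Finset S} {B : Finset T} {R : S → T → Prop}
    (hT : Nonempty T)
    (hc : A.card = 2 * B.card) (hH : ∀ Y ⊆ B, 2 * Y.card ≤ (nb A R Y).card) :
    ∃ m, Fac A B R m := by
  classical
  have key := (Finset.all_card_le_biUnion_card_iff_exists_injective
    (fun x : B × Bool => nb A R {x.1.1})).1 (by
      intro Q
      set Y : Finset T := Q.image (fun x => x.1.1) with hY
      have hYB : Y ⊆ B := by
        intro t ht
        rw [hY, Finset.mem_image] at ht
        obtain ⟨x, _, rfl⟩ := ht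
        exact x.1.2
      have h1 : Q.card ≤ 2 * Y.card := by
        have : Q.card ≤ (Y ×ˢ (Finset.univ : Finset Bool)).card := by
          apply Finset.card_le_card_of_injOn (fun x => (x.1.1, x.2))
          · intro x hx
            simp only [Finset.coe_product, Set.mem_prod, Finset.mem_coe, Finset.mem_univ, and_true]
            exact Finset.mem_image_of_mem _ hx
          · rintro ⟨⟨a, ha⟩, b⟩ _ ⟨⟨c, hc⟩, d⟩ _ h
            simpa using h
        rw [Finset.card_product] at this
        simpa [mul_comm] using this
      refine h1.trans ((hH Y hYB).trans (Finset.card_le_card ?_))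
      intro s hs
      rw [mem_nb] at hs
      obtain ⟨hsA, t, ht, hR⟩ := hs
      rw [hY, Finset.mem_image] at ht
      obtain ⟨x, hx, rfl⟩ := ht
      rw [Finset.mem_biUnion]
      exact ⟨x, hx, mem_nb.2 ⟨hsA, _, Finset.mem_singleton_self _, hR⟩⟩)
  obtain ⟨g, hg, hgm⟩ := key
  have him : Finset.univ.image g = A := by
    apply Finset.eq_of_subset_of_card_le
    · intro s hs
      rw [Finset.mem_image] at hs
      obtain ⟨x, _, rfl⟩ := hs
      exact (mem_nb.1 (hgm x)).1
    · rw [Finset.card_image_of_injective _ hg, hc]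
      simp [mul_comm]
  have hex : ∀ s ∈ A, ∃ x, g x = s := by
    intro s hs
    rw [← him, Finset.mem_image] at hs
    obtain ⟨x, _, h⟩ := hs
    exact ⟨x, h⟩
  have hadj : ∀ x, g x ∈ A ∧ R (g x) x.1.1 := by
    intro x
    have := mem_nb.1 (hgm x)
    simpa using this
  have hm : ∃ m : S → T, ∀ x, m (g x) = x.1.1 := by
    obtain ⟨t0⟩ := hT
    refine ⟨fun s => if h : ∃ x, g x = s then h.choose.1.1 else t0, fun x => ?_⟩
    have h : ∃ y, g y = g x := ⟨x, rfl⟩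
    simp only [h, dif_pos]
    rw [hg h.choose_spec]
  obtain ⟨m, hm⟩ := hm
  refine ⟨m, fun s hs => ?_, fun t ht => ?_⟩
  · obtain ⟨x, rfl⟩ := hex s hs
    rw [hm]
    exact ⟨x.1.2, (hadj x).2⟩
  · have : (A.filter fun s => m s = t) = Finset.univ.image (fun b : Bool => g (⟨t, ht⟩, b)) := by
      ext s
      simp only [Finset.mem_filter, Finset.mem_image, Finset.mem_univ, true_and]
      constructor
      · rintro ⟨a, c⟩
        obtain ⟨⟨⟨u, hu⟩, b⟩, rfl⟩ := hex s a
        rw [hm] at c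
        subst c
        exact ⟨b, rfl⟩
      · rintro ⟨b, rfl⟩
        exact ⟨(hadj _).1, hm _⟩
    rw [this, Finset.card_image_of_injective]
    · simp
    · intro a b h
      have := hg h
      simpa using this

/-- Forcing the items of `P` onto `t`. -/
theorem force {A : Finset S} {B : Finset T} {R : S → T → Prop} {m : S → T}
    (h : Fac A B R m) {t : T} {P : Finset S}
    (hPR : ∀ s ∈ P, R s t) (hPA : P ⊆ A)
    (hH : ∀ Y ⊆ B, t ∉ Y → 2 * Y.card ≤ (nb A R Y \ P).card) :
    ∃ m', Fac A B R m' ∧ ∀ s ∈ P, m' s = t := by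
  obtain ⟨m', hm'⟩ := hall (A := A) (B := B) (R := fun s u => R s u ∧ (s ∈ P → u = t))
    ⟨t⟩ (card_all h) (by
      intro Y hY
      by_cases htY : t ∈ Y
      · rw [← card_pre h hY]
        apply Finset.card_le_card
        intro s hs
        rw [Finset.mem_filter] at hs
        rw [mem_nb]
        refine ⟨hs.1, ?_⟩
        by_cases hp : s ∈ P
        · exact ⟨t, htY, hPR s hp, fun _ => rfl⟩
        · exact ⟨m s, hs.2, (h.1 s hs.1).2, fun h' => absurd h' hp⟩
      · refine (hH Y hY htY).trans (Finset.card_le_card ?_)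
        intro s hs
        rw [Finset.mem_sdiff, mem_nb] at hs
        obtain ⟨⟨a, u, hu, hR⟩, hp⟩ := hs
        exact mem_nb.2 ⟨a, u, hu, hR, fun h' => absurd h' hp⟩)
  exact ⟨m', ⟨fun s hs => ⟨(hm'.1 s hs).1, (hm'.1 s hs).2.1⟩, hm'.2⟩,
    fun s hs => (hm'.1 s (hPA hs)).2.2 hs⟩

theorem first_two (N : Finset S) (f : S → ℕ) (hf : Function.Injective f) (hN : 2 ≤ N.card) :
    ∃ P ⊆ N, P.card = 2 ∧ ∀ s ∈ P, ∀ s' ∈ N, s' ∉ P → f s < f s' := by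
  obtain ⟨a, ha, hamin⟩ := Finset.exists_min_image N f (Finset.card_pos.1 (by omega))
  have h2 : 1 ≤ (N.erase a).card := by rw [Finset.card_erase_of_mem ha]; omega
  obtain ⟨b, hb, hbmin⟩ := Finset.exists_min_image (N.erase a) f (Finset.card_pos.1 (by omega))
  rw [Finset.mem_erase] at hb
  refine ⟨{a, b}, ?_, Finset.card_pair hb.1.symm, ?_⟩
  · intro s hs
    simp only [Finset.mem_insert, Finset.mem_singleton] at hs
    rcases hs with rfl | rfl
    · exact ha
    · exact hb.2
  · intro s hs s' hs' hn
    simp only [Finset.mem_insert, Finset.mem_singleton, not_or] at hs hn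
    have h1 := hamin s' hs'
    have h3 := hbmin s' (Finset.mem_erase.2 ⟨hn.1, hs'⟩)
    have h4 : f a ≠ f s' := fun h => hn.1 (hf h).symm
    have h5 : f b ≠ f s' := fun h => hn.2 (hf h).symm
    rcases hs with rfl | rfl <;> omega

/-- Case 1: there is a tight set. -/
theorem case_tight {A : Finset S} {B : Finset T} {R : S → T → Prop} {m : S → T}
    (h : Fac A B R m) {X : Finset T} (hX : X ⊆ B) (ht : (nb A R X).card ≤ 2 * X.card)
    {f1 f2 : S → ℕ} (h1 : Good (nb A R X) X R f1) (h2 : Good (A \ nb A R X) (B \ X) R f2) :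
    ∃ f, Good A B R f := by
  obtain ⟨hm1, hm2⟩ := split h hX (A' := nb A R X) (fun s hs => (mem_nb.1 hs).1) ht
    (fun s hs hx => mem_nb.2 ⟨hs, m s, hx, (h.1 s hs).2⟩)
  have hA : ∀ s, s ∈ A ↔ s ∈ nb A R X ∨ s ∈ A \ nb A R X := by
    intro s
    simp only [Finset.mem_sdiff, mem_nb]
    tauto
  have hB : ∀ t, t ∈ B ↔ t ∈ X ∨ t ∈ B \ X := by
    intro t
    have := @hX t
    simp only [Finset.mem_sdiff]
    tauto
  have dA : ∀ s ∈ nb A R X, s ∉ A \ nb A R X := by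
    intro s hs; simp [hs]
  have dB : ∀ t ∈ X, t ∉ B \ X := by
    intro s hs; simp [hs]
  let N := A.sup f2 + 1
  have hN : ∀ s ∈ A, f2 s < N := fun s hs => Nat.lt_succ_of_le (Finset.le_sup hs)
  refine ⟨fun s => if s ∈ nb A R X then N + f1 s else f2 s, fun t htB => ?_⟩
  by_cases htX : t ∈ X
  · obtain ⟨m', hm', hf⟩ := h1 t htX
    refine ⟨_, glue hm' hm2 hA hB dA dB, ?_⟩
    intro s hs hst s' hs' hR hst'
    have b' : s' ∈ nb A R X := mem_nb.2 ⟨hs', t, htX, hR⟩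
    have b : s ∈ nb A R X := by
      by_contra hb
      simp only [hb, if_false] at hst
      exact dB t htX (hst ▸ (hm2.1 s (Finset.mem_sdiff.2 ⟨hs, hb⟩)).1)
    simp only [b, b', if_true] at hst hst' ⊢
    have := hf s b hst s' b' hR hst'
    omega
  · have htC : t ∈ B \ X := Finset.mem_sdiff.2 ⟨htB, htX⟩
    obtain ⟨m', hm', hf⟩ := h2 t htC
    refine ⟨_, glue hm1 hm' hA hB dA dB, ?_⟩
    intro s hs hst s' hs' hR hst'
    have b : s ∉ nb A R X := by
      intro hb
      simp only [hb, if_true] at hst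
      exact htX (hst ▸ (hm1.1 s hb).1)
    by_cases b' : s' ∈ nb A R X
    · simp only [b, b', if_true, if_false]
      have := hN s hs
      omega
    · simp only [b, b', if_false] at hst hst' ⊢
      exact hf s (Finset.mem_sdiff.2 ⟨hs, b⟩) hst s' (Finset.mem_sdiff.2 ⟨hs', b'⟩) hR hst'

/-- Case 3: no tight sets and all dangerous sets miss just one buyer. -/
theorem case_simple [Fintype S] {A : Finset S} {B : Finset T} {R : S → T → Prop} {m : S → T}
    (h : Fac A B R m)
    (hnt : ∀ Y ⊆ B, Y.Nonempty → Y ≠ B → 2 * Y.card + 1 ≤ (nb A R Y).card)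
    (hd : ∀ Y ⊆ B, Y.Nonempty → Y ≠ B → (nb A R Y).card = 2 * Y.card + 1 →
      (B \ Y).card ≤ 1) :
    ∃ f, Good A B R f := by
  classical
  let e : S → ℕ := fun s => (Fintype.equivFin S s).1
  have he : Function.Injective e := fun a b hab =>
    (Fintype.equivFin S).injective (Fin.ext hab)
  have hel : ∀ s, e s < Fintype.card S := fun s => (Fintype.equivFin S s).2
  let pr : S → Prop := fun s => ∃ t, ∀ t' ∈ B, R s t' → t' = t
  let f : S → ℕ := fun s => if pr s then e s else Fintype.card S + e s
  have hf : Function.Injective f := by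
    intro a b hab
    apply he
    have := hel a
    have := hel b
    simp only [f] at hab
    split_ifs at hab <;> omega
  refine ⟨f, fun t ht => ?_⟩
  have hdeg : 2 ≤ (nb A R {t}).card := by
    rw [← h.2 t ht]
    apply Finset.card_le_card
    intro s hs
    rw [Finset.mem_filter] at hs
    exact mem_nb.2 ⟨hs.1, t, Finset.mem_singleton_self t, hs.2 ▸ (h.1 s hs.1).2⟩
  obtain ⟨P, hPN, hPc, hPf⟩ := first_two (nb A R {t}) f hf hdeg
  have hPR : ∀ s ∈ P, R s t := by
    intro s hs
    have := mem_nb.1 (hPN hs)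
    simpa using this.2
  have hPA : P ⊆ A := fun s hs => (mem_nb.1 (hPN hs)).1
  obtain ⟨m', hm', hP⟩ := force h hPR hPA (by
    intro Y hY htY
    rcases Y.eq_empty_or_nonempty with rfl | hne
    · simp
    have hYB : Y ≠ B := fun hh => htY (hh ▸ ht)
    have hc1 := hnt Y hY hne hYB
    have hc2 := Finset.le_card_sdiff P (nb A R Y)
    by_cases hc3 : 2 * Y.card + 2 ≤ (nb A R Y).card
    · omega
    have hc4 : (nb A R Y).card = 2 * Y.card + 1 := by omega
    have hc5 := hd Y hY hne hYB hc4
    by_contra hlt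
    have hPs : P ⊆ nb A R Y := by
      by_contra hns
      rw [Finset.not_subset] at hns
      obtain ⟨x, hx, hxn⟩ := hns
      have : nb A R Y \ P.erase x ⊆ nb A R Y \ P := by
        intro s hs
        rw [Finset.mem_sdiff] at hs ⊢
        refine ⟨hs.1, fun hp => hs.2 (Finset.mem_erase.2 ⟨?_, hp⟩)⟩
        rintro rfl
        exact hxn hs.1
      have h1 := Finset.card_le_card this
      have h2 := Finset.le_card_sdiff (P.erase x) (nb A R Y)
      rw [Finset.card_erase_of_mem hx] at h2
      omega
    have hYt : ∀ u ∈ B, u ∉ Y → u = t := by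
      intro u hu huY
      exact Finset.card_le_one.1 hc5 u (Finset.mem_sdiff.2 ⟨hu, huY⟩) t
        (Finset.mem_sdiff.2 ⟨ht, htY⟩)
    have hYlt : Y.card < B.card := Finset.card_lt_card ⟨hY, fun hh => htY (hh ht)⟩
    have hq : ∃ q ∈ A, q ∉ nb A R Y := by
      by_contra hh
      push Not at hh
      have := Finset.card_le_card (show A ⊆ nb A R Y from hh)
      rw [card_all h] at this
      omega
    obtain ⟨q, hqA, hqn⟩ := hq
    have hqB : ∀ u ∈ B, R q u → u = t := by
      intro u hu hR
      exact hYt u hu (fun huY => hqn (mem_nb.2 ⟨hqA, u, huY, hR⟩))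
    have hqt : R q t := by
      have := h.1 q hqA
      rw [hqB _ this.1 this.2] at this
      exact this.2
    have hprq : pr q := ⟨t, hqB⟩
    obtain ⟨x, hx⟩ := Finset.card_pos.1 (show 0 < P.card by omega)
    have hlt' := hPf x hx q (mem_nb.2 ⟨hqA, t, Finset.mem_singleton_self t, hqt⟩)
      (fun hqP => hqn (hPs hqP))
    have hprx : pr x := by
      by_contra hn
      simp only [f, hprq, hn, if_true, if_false] at hlt'
      have := hel q
      omega
    obtain ⟨u, hu⟩ := hprx
    obtain ⟨_, v, hv, hRv⟩ := mem_nb.1 (hPs hx)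
    have e1 := hu t ht (hPR x hx)
    have e2 := hu v (hY hv) hRv
    exact htY (e1.trans e2.symm ▸ hv))
  refine ⟨m', hm', ?_⟩
  have hPe : P = A.filter fun s => m' s = t := by
    apply Finset.eq_of_subset_of_card_le
    · intro s hs
      exact Finset.mem_filter.2 ⟨hPA hs, hP s hs⟩
    · rw [hm'.2 t ht, hPc]
  intro s hs hst s' hs' hR hst'
  apply hPf s
  · rw [hPe]; exact Finset.mem_filter.2 ⟨hs, hst⟩
  · exact mem_nb.2 ⟨hs', t, Finset.mem_singleton_self t, hR⟩
  · rw [hPe]; exact fun hh => hst' (Finset.mem_filter.1 hh).2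

/-- No tight sets: every edge is in a factor. -/
theorem edge {A : Finset S} {B : Finset T} {R : S → T → Prop} {m : S → T}
    (h : Fac A B R m)
    (hnt : ∀ Y ⊆ B, Y.Nonempty → Y ≠ B → 2 * Y.card + 1 ≤ (nb A R Y).card)
    {s : S} {t : T} (hs : s ∈ A) (ht : t ∈ B) (hR : R s t) :
    ∃ m', Fac A B R m' ∧ m' s = t := by
  obtain ⟨m', hm', hP⟩ := force h (t := t) (P := {s}) (by simpa using hR) (by simpa using hs) (by
    intro Y hY htY
    rcases Y.eq_empty_or_nonempty with rfl | hne
    · simp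
    have h1 := hnt Y hY hne (fun hh => htY (hh ▸ ht))
    have h2 := Finset.le_card_sdiff {s} (nb A R Y)
    rw [Finset.card_singleton] at h2
    omega)
  exact ⟨m', hm', hP s (Finset.mem_singleton_self s)⟩

/-- Any item of `N(Y)` may be the surplus one, for `Y` dangerous. -/
theorem surplus {A : Finset S} {R : S → T → Prop} {Y : Finset T}
    (hne : Y.Nonempty) (hY : (nb A R Y).card = 2 * Y.card + 1)
    (hnt : ∀ Z ⊆ Y, Z.Nonempty → 2 * Z.card + 1 ≤ (nb A R Z).card)
    {s : S} (hs : s ∈ nb A R Y) :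
    ∃ m, Fac ((nb A R Y).erase s) Y R m := by
  obtain ⟨t, _⟩ := hne
  apply hall ⟨t⟩
  · rw [Finset.card_erase_of_mem hs]; omega
  · intro Z hZ
    rcases Z.eq_empty_or_nonempty with rfl | hne
    · simp
    have h1 := hnt Z hZ hne
    have h2 : (nb A R Z).erase s ⊆ nb ((nb A R Y).erase s) R Z := by
      intro x hx
      rw [Finset.mem_erase, mem_nb] at hx
      obtain ⟨hxs, hxA, u, hu, hR⟩ := hx
      exact mem_nb.2 ⟨Finset.mem_erase.2 ⟨hxs, mem_nb.2 ⟨hxA, u, hZ hu, hR⟩⟩, u, hu, hR⟩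
    have h3 := Finset.card_le_card h2
    have h4 := Finset.pred_card_le_card_erase (s := nb A R Z) (a := s)
    omega

/-- A factor in which `k ∈ N(Y)` is the surplus item, restricted to the complement of `Y`. -/
theorem outer {A : Finset S} {B : Finset T} {R : S → T → Prop} {m : S → T}
    (h : Fac A B R m)
    (hnt : ∀ Y ⊆ B, Y.Nonempty → Y ≠ B → 2 * Y.card + 1 ≤ (nb A R Y).card)
    {Y : Finset T} (hYB : Y ⊆ B) (hY : (nb A R Y).card = 2 * Y.card + 1)
    {k : S} (hk : k ∈ nb A R Y) {c : T} (hc : c ∈ B \ Y) (hR : R k c) :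
    ∃ m', Fac (A \ (nb A R Y).erase k) (B \ Y) R m' := by
  rw [Finset.mem_sdiff] at hc
  obtain ⟨m', hm', hkc⟩ := edge h hnt (mem_nb.1 hk).1 hc.1 hR
  refine ⟨m', (split hm' hYB (A' := (nb A R Y).erase k) ?_ ?_ ?_).2⟩
  · exact fun s hs => (mem_nb.1 (Finset.mem_of_mem_erase hs)).1
  · rw [Finset.card_erase_of_mem hk]; omega
  · intro s hs hsY
    refine Finset.mem_erase.2 ⟨?_, mem_nb.2 ⟨hs, _, hsY, (hm'.1 s hs).2⟩⟩
    rintro rfl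
    exact hc.2 (hkc ▸ hsY)

theorem Fac.congr {A : Finset S} {B : Finset T} {R R' : S → T → Prop} {m : S → T}
    (h : Fac A B R m) (hR : ∀ s ∈ A, ∀ t ∈ B, R s t → R' s t) : Fac A B R' m :=
  ⟨fun s hs => ⟨(h.1 s hs).1, hR s hs _ (h.1 s hs).1 (h.1 s hs).2⟩, h.2⟩

set_option maxHeartbeats 1600000 in
/-- Case 2: no tight set, and a dangerous set missing at least two buyers. -/
theorem case_dangerous {A : Finset S} {B : Finset T} {R : S → T → Prop} {m : S → T}
    (h : Fac A B R m)
    (hnt : ∀ Y ⊆ B, Y.Nonempty → Y ≠ B → 2 * Y.card + 1 ≤ (nb A R Y).card)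
    {Y : Finset T} (hYB : Y ⊆ B) (hne : Y.Nonempty)
    (hY : (nb A R Y).card = 2 * Y.card + 1) (hC : 2 ≤ (B \ Y).card)
    (ih : ∀ (A' : Finset S) (B' : Finset T) (R' : S → T → Prop), B'.card < B.card →
      (∃ m', Fac A' B' R' m') → ∃ f, Good A' B' R' f) :
    ∃ f, Good A B R f := by
  have hcB : (B \ Y).card + Y.card = B.card := Finset.card_sdiff_add_card_eq_card hYB
  have hcA := card_all h
  have hYpos := Finset.card_pos.2 hne
  have hNA : nb A R Y ⊆ A := fun s hs => (mem_nb.1 hs).1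
  have hcAC : (A \ nb A R Y).card + (nb A R Y).card = A.card :=
    Finset.card_sdiff_add_card_eq_card hNA
  have hntY : ∀ Z ⊆ Y, Z.Nonempty → 2 * Z.card + 1 ≤ (nb A R Z).card := by
    intro Z hZ hZne
    refine hnt Z (hZ.trans hYB) hZne ?_
    rintro rfl
    have := Finset.card_le_card hZ
    omega
  obtain ⟨t0, ht0⟩ := Finset.card_pos.1 (show 0 < (B \ Y).card by omega)
  obtain ⟨p, hp⟩ := Finset.card_pos.1 (show 0 < (A \ nb A R Y).card by omega)
  have ht0' := Finset.mem_sdiff.1 ht0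
  have hp' := Finset.mem_sdiff.1 hp
  let K : Finset S := nb (nb A R Y) R (B \ Y)
  have hKne : K.Nonempty := by
    by_contra hK
    rw [Finset.not_nonempty_iff_eq_empty] at hK
    have h1 := card_pre h (X := B \ Y) Finset.sdiff_subset
    have h2 : (A.filter fun s => m s ∈ B \ Y) ⊆ A \ nb A R Y := by
      intro s hs
      rw [Finset.mem_filter] at hs
      refine Finset.mem_sdiff.2 ⟨hs.1, fun hn => ?_⟩
      have : s ∈ K := mem_nb.2 ⟨hn, _, hs.2, (h.1 s hs.1).2⟩
      rw [hK] at this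
      simp at this
    have h3 := Finset.card_le_card h2
    omega
  -- the graph in which the complement of `Y` is contracted to `t0`
  let R1 : S → T → Prop := fun s t =>
    (t = t0 ∧ (s = p ∨ ∃ c ∈ B \ Y, R s c)) ∨ (t ≠ t0 ∧ R s t)
  have hYt0 : ∀ t ∈ Y, t ≠ t0 := fun t ht hh => ht0'.2 (hh ▸ ht)
  have hNp : ∀ s ∈ nb A R Y, s ≠ p := fun s hs hh => hp'.2 (hh ▸ hs)
  obtain ⟨f1, hf1⟩ := ih (insert p (nb A R Y)) (insert t0 Y) R1
    (by rw [Finset.card_insert_of_notMem ht0'.2]; omega) (by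
      obtain ⟨k, hk⟩ := hKne
      obtain ⟨hkN, c, hc, hkc⟩ := mem_nb.1 hk
      obtain ⟨m1, hm1⟩ := surplus hne hY hntY hkN
      have hm1' : Fac ((nb A R Y).erase k) Y R1 m1 :=
        hm1.congr (fun s _ t ht hR => Or.inr ⟨hYt0 t ht, hR⟩)
      have hm2 : Fac {p, k} {t0} R1 (fun _ => t0) := by
        refine ⟨fun s hs => ⟨Finset.mem_singleton_self _, Or.inl ⟨rfl, ?_⟩⟩, fun t ht => ?_⟩
        · simp only [Finset.mem_insert, Finset.mem_singleton] at hs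
          rcases hs with rfl | rfl
          · exact Or.inl rfl
          · exact Or.inr ⟨c, hc, hkc⟩
        · rw [Finset.mem_singleton] at ht
          rw [Finset.filter_true_of_mem (fun _ _ => ht.symm)]
          exact Finset.card_pair (hNp k hkN).symm
      refine ⟨_, glue hm1' hm2 ?_ ?_ ?_ ?_⟩
      · intro s
        simp only [Finset.mem_insert, Finset.mem_erase, Finset.mem_singleton]
        by_cases hsk : s = k
        · subst hsk; simp [hkN]
        · tauto
      · intro t
        simp only [Finset.mem_insert, Finset.mem_singleton]
        tauto
      · intro s hs
        rw [Finset.mem_erase] at hs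
        simp only [Finset.mem_insert, Finset.mem_singleton, not_or]
        exact ⟨hNp s hs.2, hs.1⟩
      · intro t ht
        rw [Finset.mem_singleton]
        exact hYt0 t ht)
  obtain ⟨s0, hs0K, hs0min⟩ := Finset.exists_min_image K f1 hKne
  obtain ⟨hs0N, c0, hc0, hs0c⟩ := mem_nb.1 hs0K
  obtain ⟨f2, hf2⟩ := ih (A \ (nb A R Y).erase s0) (B \ Y) R (by omega)
    (outer h hnt hYB hY hs0N hc0 hs0c)
  let N := A.sup f1 + A.sup f2 + 1
  have hN1 : ∀ s ∈ A, f1 s < N := fun s hs => by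
    have : f1 s ≤ A.sup f1 := Finset.le_sup hs
    omega
  have hN2 : ∀ s ∈ A, f2 s < N := fun s hs => by
    have : f2 s ≤ A.sup f2 := Finset.le_sup hs
    omega
  let f : S → ℕ := fun s => if s ∈ (nb A R Y).erase s0 then
    (if f1 s < f1 s0 then f1 s else 2 * N + f1 s) else N + f2 s
  have dA : ∀ k, ∀ s ∈ (nb A R Y).erase k, s ∉ A \ (nb A R Y).erase k := by
    intro k s hs; simp only [Finset.mem_sdiff]; tauto
  have dB : ∀ t ∈ Y, t ∉ B \ Y := by
    intro s hs; simp [hs]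
  have hA : ∀ k, ∀ s, s ∈ A ↔ s ∈ (nb A R Y).erase k ∨ s ∈ A \ (nb A R Y).erase k := by
    intro k s
    have := @hNA s
    simp only [Finset.mem_sdiff, Finset.mem_erase]
    tauto
  have hB : ∀ t, t ∈ B ↔ t ∈ Y ∨ t ∈ B \ Y := by
    intro t
    have := @hYB t
    simp only [Finset.mem_sdiff]
    tauto
  refine ⟨f, fun t htB => ?_⟩
  by_cases htY : t ∈ Y
  · obtain ⟨m1, hm1, hgood⟩ := hf1 t (Finset.mem_insert_of_mem htY)
    have hpt : m1 p = t0 := by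
      have h1 := hm1.1 p (Finset.mem_insert_self _ _)
      rcases Finset.mem_insert.1 h1.1 with h2 | h2
      · exact h2
      · rcases h1.2 with h3 | h3
        · exact h3.1
        · exact absurd (mem_nb.2 ⟨hp'.1, _, h2, h3.2⟩) hp'.2
    have hk : ∃ k ∈ nb A R Y, m1 k = t0 := by
      have h2 := hm1.2 t0 (Finset.mem_insert_self _ _)
      obtain ⟨k, hk, hkp⟩ := Finset.exists_mem_ne (by rw [h2]; omega) p
      rw [Finset.mem_filter, Finset.mem_insert] at hk
      exact ⟨k, hk.1.resolve_left hkp, hk.2⟩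
    obtain ⟨k, hkN, hkt⟩ := hk
    have hkp := hNp k hkN
    have hkc : ∃ c ∈ B \ Y, R k c := by
      have h1 := (hm1.1 k (Finset.mem_insert_of_mem hkN)).2
      rcases h1 with h3 | h3
      · exact h3.2.resolve_left hkp
      · exact absurd hkt h3.1
    obtain ⟨c, hc, hkc⟩ := hkc
    obtain ⟨m2, hm2⟩ := outer h hnt hYB hY hkN hc hkc
    have hfib : (insert p (nb A R Y)).filter (fun s => m1 s = t0) = {p, k} := by
      symm
      apply Finset.eq_of_subset_of_card_le
      · intro s hs
        simp only [Finset.mem_insert, Finset.mem_singleton] at hs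
        rw [Finset.mem_filter, Finset.mem_insert]
        rcases hs with rfl | rfl
        · exact ⟨Or.inl rfl, hpt⟩
        · exact ⟨Or.inr hkN, hkt⟩
      · rw [hm1.2 t0 (Finset.mem_insert_self _ _), Finset.card_pair hkp.symm]
    have hsp := (split hm1 (X := {t0}) (A' := {p, k}) (by simp)
      (by rw [← hfib]; exact Finset.filter_subset _ _)
      (by rw [Finset.card_pair hkp.symm]; simp)
      (by
        intro s hs hst
        rw [← hfib, Finset.mem_filter]
        exact ⟨hs, Finset.mem_singleton.1 hst⟩)).2
    have e1 : insert p (nb A R Y) \ {p, k} = (nb A R Y).erase k := by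
      ext s
      have := hNp s
      simp only [Finset.mem_sdiff, Finset.mem_insert, Finset.mem_singleton, Finset.mem_erase]
      tauto
    have e2 : insert t0 Y \ {t0} = Y := by
      ext s
      have := hYt0 s
      simp only [Finset.mem_sdiff, Finset.mem_insert, Finset.mem_singleton]
      tauto
    rw [e1, e2] at hsp
    have hm1' : Fac ((nb A R Y).erase k) Y R m1 :=
      hsp.congr (fun s _ t ht hR => by
        rcases hR with hR | hR
        · exact absurd hR.1 (hYt0 t ht)
        · exact hR.2)
    refine ⟨_, glue hm1' hm2 (hA k) hB (dA k) dB, ?_⟩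
    intro s hs hst s' hs' hR hst'
    have b : s ∈ (nb A R Y).erase k := by
      by_contra hb
      simp only [hb, if_false] at hst
      exact dB t htY (hst ▸ (hm2.1 s (Finset.mem_sdiff.2 ⟨hs, hb⟩)).1)
    have b' : s' ∈ nb A R Y := mem_nb.2 ⟨hs', t, htY, hR⟩
    simp only [b, if_true] at hst
    have bN := Finset.mem_of_mem_erase b
    have hne' : m1 s' ≠ t := by
      by_cases hsk : s' = k
      · rw [hsk, hkt]; exact (hYt0 t htY).symm
      · simpa [Finset.mem_erase, hsk, b'] using hst'
    have hlt := hgood s (Finset.mem_insert_of_mem bN) hst s' (Finset.mem_insert_of_mem b')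
      (Or.inr ⟨hYt0 t htY, hR⟩) hne'
    have := hN1 s hs
    have := hN1 s' hs'
    have := hN2 s hs
    have := hN2 s' hs'
    simp only [f, Finset.mem_erase, bN, b', and_true]
    by_cases g1 : s = s0
    · subst g1
      have g2 : s' ≠ s := by rintro rfl; omega
      simp only [g2, ne_eq, not_true_eq_false, not_false_eq_true, if_true, if_false]
      split_ifs <;> omega
    · by_cases g2 : s' = s0
      · subst g2
        simp only [g1, ne_eq, not_true_eq_false, not_false_eq_true, if_true, if_false]
        split_ifs
        omega
      · simp only [g1, g2, ne_eq, not_false_eq_true, if_true]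
        split_ifs <;> omega
  · have htC : t ∈ B \ Y := Finset.mem_sdiff.2 ⟨htB, htY⟩
    obtain ⟨m2, hm2, hgood⟩ := hf2 t htC
    obtain ⟨m1, hm1⟩ := surplus hne hY hntY hs0N
    refine ⟨_, glue hm1 hm2 (hA s0) hB (dA s0) dB, ?_⟩
    intro s hs hst s' hs' hR hst'
    have b : s ∉ (nb A R Y).erase s0 := by
      intro hb
      simp only [hb, if_true] at hst
      exact htY (hst ▸ (hm1.1 s hb).1)
    have := hN2 s hs
    by_cases b' : s' ∈ (nb A R Y).erase s0
    · have hmin := hs0min s' (mem_nb.2 ⟨Finset.mem_of_mem_erase b', t, htC, hR⟩)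
      have hmin' : ¬ f1 s' < f1 s0 := by omega
      simp only [f, b, b', hmin', if_true, if_false]
      omega
    · simp only [b, b', if_false] at hst hst'
      have := hgood s (Finset.mem_sdiff.2 ⟨hs, b⟩) hst s' (Finset.mem_sdiff.2 ⟨hs', b'⟩) hR hst'
      simp only [f, b, b', if_false]
      omega

theorem exists_good [Fintype S] (n : ℕ) : ∀ (A : Finset S) (B : Finset T) (R : S → T → Prop),
    B.card = n → (∃ m, Fac A B R m) → ∃ f, Good A B R f := by
  induction n using Nat.strong_induction_on with
  | _ n ih =>
  intro A B R hn ⟨m, h⟩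
  have ih' : ∀ (A' : Finset S) (B' : Finset T) (R' : S → T → Prop), B'.card < B.card →
      (∃ m', Fac A' B' R' m') → ∃ f, Good A' B' R' f :=
    fun A' B' R' hlt hex => ih B'.card (hn ▸ hlt) A' B' R' rfl hex
  by_cases h1 : ∃ X ⊆ B, X.Nonempty ∧ X ≠ B ∧ (nb A R X).card ≤ 2 * X.card
  · obtain ⟨X, hX, hne, hXB, hc⟩ := h1
    obtain ⟨hm1, hm2⟩ := split h hX (A' := nb A R X) (fun s hs => (mem_nb.1 hs).1) hc
      (fun s hs hx => mem_nb.2 ⟨hs, m s, hx, (h.1 s hs).2⟩)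
    have hlt := Finset.card_lt_card (Finset.ssubset_iff_subset_ne.2 ⟨hX, hXB⟩)
    have hpos := Finset.card_pos.2 hne
    have hcB : (B \ X).card + X.card = B.card := Finset.card_sdiff_add_card_eq_card hX
    obtain ⟨f1, hf1⟩ := ih' _ _ _ hlt ⟨m, hm1⟩
    obtain ⟨f2, hf2⟩ := ih' _ _ _ (by omega) ⟨m, hm2⟩
    exact case_tight h hX hc hf1 hf2
  · have hnt : ∀ Y ⊆ B, Y.Nonempty → Y ≠ B → 2 * Y.card + 1 ≤ (nb A R Y).card := by
      intro Y hY hne hYB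
      by_contra hc
      exact h1 ⟨Y, hY, hne, hYB, by omega⟩
    by_cases h2 : ∃ Y ⊆ B, Y.Nonempty ∧ (nb A R Y).card = 2 * Y.card + 1 ∧ 2 ≤ (B \ Y).card
    · obtain ⟨Y, hYB, hne, hY, hC⟩ := h2
      exact case_dangerous h hnt hYB hne hY hC ih'
    · refine case_simple h hnt (fun Y hY hne _ hc => ?_)
      by_contra hlt
      exact h2 ⟨Y, hY, hne, hc, by omega⟩

theorem exists_equiv [Fintype S] (f : S → ℕ) :
    ∃ σ : S ≃ Fin (Fintype.card S), ∀ s s', f s < f s' → σ s < σ s' := by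
  let g : S → ℕ ×ₗ Fin (Fintype.card S) := fun s => toLex (f s, Fintype.equivFin S s)
  have hg : Function.Injective g := by
    intro a b hab
    have := congrArg (fun x => (ofLex x).2) hab
    exact (Fintype.equivFin S).injective this
  letI : LinearOrder S := LinearOrder.lift' g hg
  let o := Fintype.orderIsoFinOfCardEq S rfl
  refine ⟨o.symm.toEquiv, fun s s' hlt => ?_⟩
  have : s < s' := by
    change g s < g s'
    exact Prod.Lex.toLex_lt_toLex.2 (Or.inl hlt)
  exact o.symm.lt_iff_lt.2 this

end AdeqAux

/-- **core of Theorem 5.1.** Every bipartite graph admitting a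
`(1,2)`-factor admits an adequate ordering of the items. -/
theorem stmt16 [Fintype S] [Fintype T]
    (E : Finset (S × T))
    (hfac : ∃ M ⊆ E, (∀ s, degS M s = 1) ∧ ∀ t, degT M t = 2) :
    ∃ σ : S ≃ Fin (Fintype.card S), Adequate σ E (fun _ => 2) := by
  obtain ⟨M, hME, hS, hT⟩ := hfac
  have hex : ∀ s, ∃ t, (M.filter fun e => e.1 = s) = {(s, t)} := by
    intro s
    obtain ⟨e, he⟩ := Finset.card_eq_one.1 (hS s)
    have h1 : e ∈ M.filter fun e => e.1 = s := by rw [he]; exact Finset.mem_singleton_self e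
    obtain ⟨_, rfl⟩ := Finset.mem_filter.1 h1
    exact ⟨e.2, he⟩
  choose m hm using hex
  have hmem : ∀ s t, (s, t) ∈ M ↔ m s = t := by
    intro s t
    have h1 : (s, t) ∈ M ↔ (s, t) ∈ M.filter fun e => e.1 = s := by simp
    rw [h1, hm s]
    simp [eq_comm]
  have hF : AdeqAux.Fac Finset.univ Finset.univ (fun s t => (s, t) ∈ E) m := by
    refine ⟨fun s _ => ⟨Finset.mem_univ _, hME ((hmem s _).2 rfl)⟩, fun t _ => ?_⟩
    rw [← hT t, degT]
    refine Finset.card_bij (fun s _ => (s, t)) ?_ ?_ ?_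
    · intro s hs
      have := (Finset.mem_filter.1 hs).2
      exact Finset.mem_filter.2 ⟨(hmem s t).2 this, rfl⟩
    · intro a _ b _ hab
      exact (Prod.ext_iff.1 hab).1
    · rintro ⟨s, u⟩ hb
      obtain ⟨h1, h2⟩ := Finset.mem_filter.1 hb
      simp only at h2
      subst h2
      exact ⟨s, Finset.mem_filter.2 ⟨Finset.mem_univ _, (hmem s u).1 h1⟩, rfl⟩
  obtain ⟨f, hf⟩ := AdeqAux.exists_good _ _ _ _ rfl ⟨m, hF⟩
  obtain ⟨σ, hσ⟩ := AdeqAux.exists_equiv f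
  refine ⟨σ, fun t => ?_⟩
  obtain ⟨m', hm', hlt⟩ := hf t (Finset.mem_univ t)
  have hmem' : ∀ s u, (s, u) ∈ (Finset.univ.image fun s => (s, m' s)) ↔ m' s = u := by
    intro s u
    simp [Prod.ext_iff]
  refine ⟨Finset.univ.image fun s => (s, m' s), ?_, ?_, ?_, ?_⟩
  · intro e he
    obtain ⟨s, _, rfl⟩ := Finset.mem_image.1 he
    exact (hm'.1 s (Finset.mem_univ s)).2
  · intro s
    rw [degS, Finset.card_eq_one]
    refine ⟨(s, m' s), ?_⟩
    ext ⟨a, b⟩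
    rw [Finset.mem_filter, hmem', Finset.mem_singleton, Prod.ext_iff]
    constructor
    · rintro ⟨h1, h2⟩
      simp only at h2
      subst h2
      exact ⟨rfl, h1.symm⟩
    · rintro ⟨h1, h2⟩
      simp only at h1 h2
      subst h1
      exact ⟨h2.symm, rfl⟩
  · intro u
    rw [← hm'.2 u (Finset.mem_univ u), degT]
    symm
    refine Finset.card_bij (fun s _ => (s, u)) ?_ ?_ ?_
    · intro s hs
      have := (Finset.mem_filter.1 hs).2
      exact Finset.mem_filter.2 ⟨(hmem' s u).2 this, rfl⟩
    · intro a _ b _ hab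
      exact (Prod.ext_iff.1 hab).1
    · rintro ⟨s, v⟩ hb
      obtain ⟨h1, h2⟩ := Finset.mem_filter.1 hb
      simp only at h2
      subst h2
      exact ⟨s, Finset.mem_filter.2 ⟨Finset.mem_univ _, (hmem' s v).1 h1⟩, rfl⟩
  · have hnb : ∀ (H : Finset (S × T)) s, s ∈ nbhd H {t} ↔ (s, t) ∈ H := by
      intro H s
      simp [nbhd]
    intro s hs s' hs'
    rw [Finset.mem_sdiff, hnb, hnb, hmem'] at hs'
    rw [hnb, hmem'] at hs
    exact hσ s s' (hlt s (Finset.mem_univ s) hs s' (Finset.mem_univ s') hs'.1 hs'.2)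
end
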